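/- (Theorem 3.1) The derivation algebra of 𝒦 decomposes as the direct sum of subspaces Der 𝒦 = (⊕_{p∈Ī₂∪J₃∪I₅} F·∂_{t_p}) ⊕ {d_μ : μ∈Hom*_ℤ(Γ,F)} ⊕ ad 𝒦; that is, every derivation d of 𝒦 can be written uniquely as d = Σ_{p∈Ī₂∪J₃∪I₅} c_p ∂_{t_p} + d_μ + ad u with c_p∈F, μ∈Hom*_ℤ(Γ,F), u∈𝒦. -/

import Mathlib

noncomputable section

/-- `ι_i = ℓ₁ + ⋯ + ℓ_i`. -/
def iot (ℓ : ℕ → ℕ) (i : ℕ) : ℕ := ∑ k ∈ Finset.Icc 1 i, ℓ k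

/-- `I_{i,j} = {ι_{i-1}+1, …, ι_j}`. -/
def iSet (ℓ : ℕ → ℕ) (i j : ℕ) : Finset ℕ := Finset.Icc (iot ℓ (i - 1) + 1) (iot ℓ j)

/-- The index-shift map `p ↦ p̄` (shift by `ι₆`). -/
def bar (ℓ : ℕ → ℕ) (p : ℕ) : ℕ := if p ≤ iot ℓ 6 then p + iot ℓ 6 else p - iot ℓ 6

/-- `K̄ = {p̄ : p ∈ K}`. -/
def barSet (ℓ : ℕ → ℕ) (K : Finset ℕ) : Finset ℕ := K.image (bar ℓ)

/-- `J_{i,j} = I_{i,j} ∪ Ī_{i,j}`. -/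
def jSet (ℓ : ℕ → ℕ) (i j : ℕ) : Finset ℕ := iSet ℓ i j ∪ barSet ℓ (iSet ℓ i j)

/-- The semigroup `𝒥 = 𝒥₀ × 𝒥₁`, encoded as functions `ℕ → ℕ`; `j0 = true`
means `𝒥₀ = ℕ` and `j0 = false` means `𝒥₀ = {0}`. -/
def jIdx (ℓ : ℕ → ℕ) (j0 : Bool) : Set (ℕ → ℕ) :=
  {i | (j0 = false → i 0 = 0) ∧
    ∀ p, 1 ≤ p →
      (p ∈ iSet ℓ 1 2 ∪ iSet ℓ 4 4 ∪ barSet ℓ (iSet ℓ 1 1) ∨ 2 * iot ℓ 6 < p) → i p = 0}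

/-- `σ_p` (with `σ_p = σ_{p̄}`). -/
def sgm (F : Type*) [Field F] (ℓ : ℕ → ℕ) (p : ℕ) : ℕ → F :=
  let q := if p ≤ iot ℓ 6 then p else p - iot ℓ 6
  if q ∈ iSet ℓ 1 3 then -Pi.single q (1 : F) - Pi.single (q + iot ℓ 6) (1 : F)
  else if q ∈ iSet ℓ 4 5 then -Pi.single q (1 : F)
  else 0

/-- The underlying space `𝒜`: the free `F`-module with basis `Γ × 𝒥`. -/
abbrev CA (F : Type*) [Field F] (ℓ : ℕ → ℕ) (Γ : AddSubgroup (ℕ → F)) (j0 : Bool) : Type _ :=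
  (↥Γ × ↥(jIdx ℓ j0)) →₀ F

/-- The basis monomial `x^{α,i⃗}`, with the convention that it is `0` if `(α,i⃗) ∉ Γ × 𝒥`. -/
def X (F : Type*) [Field F] (ℓ : ℕ → ℕ) (Γ : AddSubgroup (ℕ → F)) (j0 : Bool)
    (α : ℕ → F) (i : ℕ → ℕ) : CA F ℓ Γ j0 :=
  @dite _ (α ∈ Γ ∧ i ∈ jIdx ℓ j0) (Classical.dec _)
    (fun h => Finsupp.single (⟨α, h.1⟩, ⟨i, h.2⟩) 1) (fun _ => 0)

variable (F : Type*) [Field F] (ℓ : ℕ → ℕ) (Γ : AddSubgroup (ℕ → F)) (j0 : Bool)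

/-- The commutative associative product on `𝒜`. -/
def mulA (u v : CA F ℓ Γ j0) : CA F ℓ Γ j0 :=
  u.sum fun a ca => v.sum fun b cb =>
    (ca * cb) • X F ℓ Γ j0 (a.1.1 + b.1.1) (a.2.1 + b.2.1)

/-- The grading operator `∂*_p`. -/
def pstar (p : ℕ) (u : CA F ℓ Γ j0) : CA F ℓ Γ j0 :=
  u.sum fun a ca => (ca * a.1.1 p) • Finsupp.single a 1

/-- The down-grading operator `∂_{t_p}`. -/
def pt (p : ℕ) (u : CA F ℓ Γ j0) : CA F ℓ Γ j0 :=
  u.sum fun a ca => (ca * (a.2.1 p : F)) • X F ℓ Γ j0 a.1.1 (a.2.1 - Pi.single p 1)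

/-- `∂_p = ∂*_p + ∂_{t_p}`. -/
def dd (p : ℕ) (u : CA F ℓ Γ j0) : CA F ℓ Γ j0 := pstar F ℓ Γ j0 p u + pt F ℓ Γ j0 p u

/-- `∂ = Σ_{p∈J_{1,3}∪I_{4,5}} ∂*_p + Σ_{p∈I₆∪Ī_{4,6}} t_p ∂_{t_p}`. -/
def Dop (u : CA F ℓ Γ j0) : CA F ℓ Γ j0 :=
  (∑ p ∈ jSet ℓ 1 3 ∪ iSet ℓ 4 5, pstar F ℓ Γ j0 p u) +
    ∑ p ∈ iSet ℓ 6 6 ∪ barSet ℓ (iSet ℓ 4 6),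
      mulA F ℓ Γ j0 (X F ℓ Γ j0 0 (Pi.single p 1)) (pt F ℓ Γ j0 p u)

/-- The contact bracket (2.18):
`[u,v] = Σ_{p∈I} x^{σ_p}(∂_p u·∂_{p̄} v − ∂_{p̄} u·∂_p v) + (2−∂)(u)·∂₀(v) − ∂₀(u)·(2−∂)(v)`. -/
def brk (u v : CA F ℓ Γ j0) : CA F ℓ Γ j0 :=
  (∑ p ∈ iSet ℓ 1 6,
      mulA F ℓ Γ j0 (X F ℓ Γ j0 (sgm F ℓ p) 0)
        (mulA F ℓ Γ j0 (dd F ℓ Γ j0 p u) (dd F ℓ Γ j0 (bar ℓ p) v) -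
          mulA F ℓ Γ j0 (dd F ℓ Γ j0 (bar ℓ p) u) (dd F ℓ Γ j0 p v))) +
    mulA F ℓ Γ j0 ((2 : F) • u - Dop F ℓ Γ j0 u) (dd F ℓ Γ j0 0 v) -
    mulA F ℓ Γ j0 (dd F ℓ Γ j0 0 u) ((2 : F) • v - Dop F ℓ Γ j0 v)


/-- For a function `μ : Γ → F`, the diagonal linear map `d_μ : x^{α,i⃗} ↦ μ(α)x^{α,i⃗}`. -/
def dmu (μ : ↥Γ → F) (u : CA F ℓ Γ j0) : CA F ℓ Γ j0 :=
  u.sum fun a ca => (ca * μ a.1) • Finsupp.single a 1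

/-- Evaluation of the `p`-th coordinate, as an additive homomorphism `Γ →+ F`. -/
def coordHom (F : Type*) [Field F] (Γ : AddSubgroup (ℕ → F)) (p : ℕ) : ↥Γ →+ F :=
  (Pi.evalAddMonoidHom (fun _ : ℕ => F) p).comp Γ.subtype

/-- `Hom'_ℤ(Γ,F)`: additive homomorphisms `μ : Γ → F` with `μ(σ_p) = 0` for `p ∈ I_{1,5}`. -/
def homPrime (F : Type*) [Field F] (ℓ : ℕ → ℕ) (Γ : AddSubgroup (ℕ → F)) :
    Submodule F (↥Γ →+ F) where
  carrier := {μ | ∀ p ∈ iSet ℓ 1 5, ∀ h : sgm F ℓ p ∈ Γ, μ ⟨sgm F ℓ p, h⟩ = 0}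
  add_mem' := by
    intro a b ha hb p hp h
    simp [ha p hp h, hb p hp h]
  zero_mem' := by intro p hp h; simp
  smul_mem' := by
    intro c a ha p hp h
    simp [ha p hp h]

/-- `μ_p(α) = α_{p̄} − α_p` for `p ∈ I_{1,3}`. -/
def muP (F : Type*) [Field F] (ℓ : ℕ → ℕ) (Γ : AddSubgroup (ℕ → F)) (p : ℕ) : ↥Γ →+ F :=
  coordHom F Γ (bar ℓ p) - coordHom F Γ p

/-- `μ₀`: equal to `α ↦ α₀` if `𝒥₀ = {0}`, and `0` if `𝒥₀ = ℕ`. -/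
def muZero (F : Type*) [Field F] (Γ : AddSubgroup (ℕ → F)) (j0 : Bool) : ↥Γ →+ F :=
  if j0 then 0 else coordHom F Γ 0

/-- `span{μ_p : p ∈ {0} ∪ I_{1,3}}`. -/
def spanMu (F : Type*) [Field F] (ℓ : ℕ → ℕ) (Γ : AddSubgroup (ℕ → F)) (j0 : Bool) :
    Submodule F (↥Γ →+ F) :=
  Submodule.span F (insert (muZero F Γ j0) ((muP F ℓ Γ) '' ↑(iSet ℓ 1 3)))

set_option linter.unusedSimpArgs false
set_option linter.unusedVariables false
set_option linter.unusedSectionVars false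

section HeisRing

theorem heis_aux {R : Type*} [Ring R] [IsAddTorsionFree R] (d F G k : R)
    (hk : F * G - G * F = k) (hkd : Commute k d) (hkF : Commute k F) (hkG : Commute k G)
    (h2 : Commute d (F * F)) (hN : Commute d (G * F)) (h3 : Commute d (F * F * F)) :
    k * k * k * (d * F - F * d) = 0 := by
  set N := G * F with hNdef
  set δ := d * F - F * d with hδ
  have kN : k * N = N * k := by
    rw [hNdef, ← mul_assoc, hkG.eq, mul_assoc, hkF.eq, mul_assoc]
  have kδ : k * δ = δ * k := by
    have e1 : k * (d * F) = d * F * k := by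
      rw [← mul_assoc, hkd.eq, mul_assoc, hkF.eq, mul_assoc]
    have e2 : k * (F * d) = F * d * k := by
      rw [← mul_assoc, hkF.eq, mul_assoc, hkd.eq, mul_assoc]
    rw [hδ, mul_sub, sub_mul, e1, e2]
  have FN : F * N = N * F + k * F := by
    have : k * F = F * (G * F) - (G * F) * F := by
      rw [← hk, hNdef]; noncomm_ring
    rw [this, ← hNdef]; abel
  have FG : F * G = N + k := by rw [← hk]; abel
  have δN : δ * N = N * δ + k * δ := by
    have h1 : d * (F * N) = (N * F + k * F) * d + (N * δ + k * δ) := by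
      rw [FN, hδ]
      have e1 : d * (N * F) = N * (d * F) := by rw [← mul_assoc, hN.eq, mul_assoc]
      have e2 : d * (k * F) = k * (d * F) := by rw [← mul_assoc, ← hkd.eq, mul_assoc]
      rw [mul_add, e1, e2]; noncomm_ring
    have h2 : F * (N * d) = (N * F + k * F) * d := by rw [← mul_assoc, FN]
    have h3 : δ * N = d * (F * N) - F * (N * d) := by
      rw [hδ, ← hN.eq]; noncomm_ring
    rw [h3, h1, h2]; abel
  have a0 : F * F * δ = 0 := by
    have e : F * F * δ = (F * F * d) * F - F * F * F * d := by rw [hδ]; noncomm_ring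
    rw [e, ← h2.eq, ← h3.eq]; noncomm_ring
  have b0 : δ * (F * F) = 0 := by
    rw [hδ, sub_mul, mul_assoc F d, h2.eq]
    have := h3.eq
    have e : d * F * (F * F) = d * (F * F * F) := by noncomm_ring
    rw [e, this]; noncomm_ring
  have a1 : G * G * (F * F) = N * N - k * N := by
    have : G * G * (F * F) = G * (N * F) := by rw [hNdef]; noncomm_ring
    have e : G * (k * F) = k * N := by rw [← mul_assoc, ← hkG.eq, mul_assoc]
    rw [this, eq_sub_of_add_eq FN.symm, mul_sub, e, ← mul_assoc]
  have b1 : F * F * (G * G) = (N + k + k) * (N + k) := by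
    have : F * F * (G * G) = F * (F * G) * G := by noncomm_ring
    rw [this, FG, mul_add, FN, ← hkF.eq]
    have : (N * F + k * F + k * F) * G = (N + k + k) * (F * G) := by noncomm_ring
    rw [this, FG]
  have a : N * (N * δ) - k * (N * δ) = 0 := by
    have : (N * N - k * N) * δ = 0 := by
      rw [← a1, mul_assoc, a0, mul_zero]
    rw [← this]; noncomm_ring
  have b : N * (N * δ) + 5 • (k * (N * δ)) + 6 • (k * (k * δ)) = 0 := by
    have h : δ * ((N + k + k) * (N + k)) = 0 := by
      rw [← b1, ← mul_assoc, b0, zero_mul]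
    have e1 : δ * ((N + k + k) * (N + k)) = (δ * N) * N + (δ * N) * k + (δ * k) * N + (δ * k) * N
      + (δ * k) * k + (δ * k) * k := by noncomm_ring
    rw [e1, δN, ← kδ] at h
    have e2 : (N * δ + k * δ) * N = N * (δ * N) + k * (δ * N) := by noncomm_ring
    have e3 : (N * δ + k * δ) * k = N * (δ * k) + k * (δ * k) := by noncomm_ring
    rw [e2, e3, mul_assoc k δ N, mul_assoc k δ k, δN, ← kδ] at h
    have e4 : N * (k * δ) = k * (N * δ) := by rw [← mul_assoc, ← kN, mul_assoc]
    simp only [mul_add, e4] at h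
    rw [← h]; abel
  have c1 : k * (N * δ) + k * (k * δ) = 0 := by
    have : 6 • (k * (N * δ) + k * (k * δ)) = 0 := by
      calc _ = (N * (N * δ) + 5 • (k * (N * δ)) + 6 • (k * (k * δ)))
            - (N * (N * δ) - k * (N * δ)) := by rw [smul_add]; abel
        _ = 0 := by rw [a, b, sub_zero]
    exact (smul_eq_zero_iff_right (by norm_num)).1 this
  have c2 : k * (N * δ) = - (k * (k * δ)) := eq_neg_of_add_eq_zero_left c1
  have e4 : ∀ z, N * (k * z) = k * (N * z) := fun z => by rw [← mul_assoc, ← kN, mul_assoc]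
  have c3 : k * (N * (N * δ)) - k * (k * (N * δ)) = 0 := by rw [← mul_sub, a, mul_zero]
  rw [← e4, c2, mul_neg, mul_neg, e4, e4, c2, mul_neg] at c3
  have c4 : 2 • (k * (k * (k * δ))) = 0 := by rw [← c3]; abel
  have := (smul_eq_zero_iff_right (two_ne_zero)).1 c4
  rw [← this]; noncomm_ring

theorem heis {R : Type*} [Ring R] [IsAddTorsionFree R] (d y z p q c w : R)
    (hcd : Commute c d) (hcy : Commute c y) (hcz : Commute c z) (hcp : Commute c p)
    (hcq : Commute c q) (hcw : Commute c w) (hwd : Commute w d) (hwy : Commute w y)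
    (hwz : Commute w z) (hwp : Commute w p)
    (hwq : Commute w q) (hw : w * w = 1)
    (hyz : Commute y z) (hpq : Commute p q) (hpy : Commute p y) (hqz : Commute q z)
    (hpz : p * z = z * p + w) (hqy : q * y = y * q - w)
    (h1 : Commute d (p + y * c)) (h1' : Commute d (q + z * c))
    (h2 : Commute d (y * p)) (h2' : Commute d (y * q + z * p))
    (h3 : Commute d (3 • (y * y * p) - y * y * y * c)) :
    c * c * c * c * (d * y - y * d) = 0 := by
  have r1 : ∀ x, p * (y * x) = y * (p * x) := fun x => by rw [← mul_assoc, hpy.eq, mul_assoc]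
  have r2 : ∀ x, p * (z * x) = z * (p * x) + w * x := fun x => by
    rw [← mul_assoc, hpz, add_mul, mul_assoc]
  have r3 : ∀ x, q * (y * x) = y * (q * x) - w * x := fun x => by
    rw [← mul_assoc, hqy, sub_mul, mul_assoc]
  have r4 : ∀ x, q * (z * x) = z * (q * x) := fun x => by rw [← mul_assoc, hqz.eq, mul_assoc]
  have r5 : ∀ x, z * (y * x) = y * (z * x) := fun x => by rw [← mul_assoc, ← hyz.eq, mul_assoc]
  have r6 : ∀ x, q * (p * x) = p * (q * x) := fun x => by rw [← mul_assoc, ← hpq.eq, mul_assoc]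
  have s1 : ∀ x, y * (c * x) = c * (y * x) := fun x => by rw [← mul_assoc, ← hcy.eq, mul_assoc]
  have s2 : ∀ x, z * (c * x) = c * (z * x) := fun x => by rw [← mul_assoc, ← hcz.eq, mul_assoc]
  have s3 : ∀ x, p * (c * x) = c * (p * x) := fun x => by rw [← mul_assoc, ← hcp.eq, mul_assoc]
  have s4 : ∀ x, q * (c * x) = c * (q * x) := fun x => by rw [← mul_assoc, ← hcq.eq, mul_assoc]
  set E := p + y * c with hE
  set E' := q + z * c with hE'
  set f := y * c - p with hf
  set g := z * c - q with hg
  have kk : f * g - g * f = -(2 • (c * w)) := by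
    rw [hf, hg]
    simp only [mul_sub, sub_mul, mul_assoc, r1, r2, r3, r4, r5, r6, s1, s2, s3, s4, ← hcy.eq,
      ← hcz.eq, ← hcp.eq, ← hcq.eq, hpy.eq, hpz, hqy, hqz.eq, ← hyz.eq, ← hpq.eq, mul_add, two_nsmul]
    abel
  have Ecomm : f * E = E * f := by
    rw [hf, hE]
    simp only [mul_sub, sub_mul, mul_assoc, r1, r2, r3, r4, r5, r6, s1, s2, s3, s4, ← hcy.eq,
      ← hcz.eq, ← hcp.eq, ← hcq.eq, hpy.eq, hpz, hqy, hqz.eq, ← hyz.eq, ← hpq.eq, mul_add, add_mul]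
    abel
  have hcomm2 : Commute d (f * f) := by
    have : f * f = E * E - 4 • (c * (y * p)) := by
      rw [hf, hE]
      simp only [mul_sub, sub_mul, mul_assoc, r1, r2, r3, r4, r5, r6, s1, s2, s3, s4, ← hcy.eq,
        ← hcz.eq, ← hcp.eq, ← hcq.eq, hpy.eq, hpz, hqy, hqz.eq, ← hyz.eq, ← hpq.eq, mul_add, add_mul]
      abel
    rw [this]
    exact (h1.mul_right h1).sub_right ((hcd.symm.mul_right h2).smul_right 4)
  have hcommN : Commute d (g * f) := by
    have : 2 • (g * f) = E * E' + E' * E - 4 • (c * (y * q + z * p)) + 2 • (c * w) := by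
      rw [hf, hE, hg, hE']
      simp only [mul_sub, sub_mul, mul_assoc, r1, r2, r3, r4, r5, r6, s1, s2, s3, s4, ← hcy.eq,
        ← hcz.eq, ← hcp.eq, ← hcq.eq, hpy.eq, hpz, hqy, hqz.eq, ← hyz.eq, ← hpq.eq, mul_add, add_mul]
      abel
    have h : Commute d (2 • (g * f)) := by
      rw [this]
      exact (((h1.mul_right h1').add_right (h1'.mul_right h1)).sub_right
        ((hcd.symm.mul_right h2').smul_right 4)).add_right ((hcd.symm.mul_right hwd.symm).smul_right 2)
    have h' := h.eq
    rw [mul_smul_comm, smul_mul_assoc] at h'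
    exact nsmul_right_injective two_ne_zero h'
  have hcomm3 : Commute d (f * f * f) := by
    have : 4 • (f * f * f) = 2 • (E * E * E) - 6 • (E * (f * f))
        - 8 • (c * c * (3 • (y * y * p) - y * y * y * c)) := by
      rw [hf, hE]
      simp only [mul_sub, sub_mul, mul_assoc, r1, r2, r3, r4, r5, r6, s1, s2, s3, s4, ← hcy.eq,
        ← hcz.eq, ← hcp.eq, ← hcq.eq, hpy.eq, hpz, hqy, hqz.eq, ← hyz.eq, ← hpq.eq, mul_add, add_mul,
        mul_smul_comm]
      abel
    have h : Commute d (4 • (f * f * f)) := by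
      rw [this]
      exact ((((h1.mul_right h1).mul_right h1).smul_right 2).sub_right
        ((h1.mul_right hcomm2).smul_right 6)).sub_right
        (((hcd.symm.mul_right hcd.symm).mul_right h3).smul_right 8)
    have h' := h.eq
    rw [mul_smul_comm, smul_mul_assoc] at h'
    exact nsmul_right_injective (n := 4) (by norm_num) h'
  have cf : Commute c f := (hcy.mul_right (Commute.refl c)).sub_right hcp
  have cg : Commute c g := (hcz.mul_right (Commute.refl c)).sub_right hcq
  have wf : Commute w f := (hwy.mul_right hcw.symm).sub_right hwp
  have wg : Commute w g := (hwz.mul_right hcw.symm).sub_right hwq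
  have main := heis_aux d f g _ kk
    ((hcd.mul_left hwd).smul_left 2).neg_left
    ((cf.mul_left wf).smul_left 2).neg_left
    ((cg.mul_left wg).smul_left 2).neg_left hcomm2 hcommN hcomm3
  have hδ : d * f - f * d = 2 • (c * (d * y - y * d)) := by
    have e := h1.eq
    have hfe : f = 2 • (c * y) - E := by rw [hf, hE, two_nsmul, ← hcy.eq]; abel
    rw [hfe, mul_sub, sub_mul, e, mul_smul_comm, smul_mul_assoc, ← mul_assoc, ← hcd.eq]
    simp only [mul_assoc, mul_sub, smul_sub]; abel
  rw [hδ] at main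
  have hcw' : ∀ x, w * (c * x) = c * (w * x) := fun x => by rw [← mul_assoc, ← hcw.eq, mul_assoc]
  have hww : ∀ x, w * (w * x) = x := fun x => by rw [← mul_assoc, hw, one_mul]
  have m2 : 16 • (w * (c * c * c * c * (d * y - y * d))) = 0 := by
    rw [← neg_eq_zero, ← main]
    simp only [neg_mul, mul_neg, neg_neg, smul_mul_assoc, mul_smul_comm, smul_smul, mul_assoc, hcw', hww]
    abel
  have m3 := (smul_eq_zero_iff_right (by norm_num : (16:ℕ) ≠ 0)).1 m2
  rw [← hww (c * c * c * c * (d * y - y * d)), m3, mul_zero]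

end HeisRing

/-- Abstract contact data. -/
structure CData (K A J : Type*) [Field K] [CommRing A] [Algebra K A] [Fintype J]
    [DecidableEq J] where
  bar : J → J
  bar_bar : ∀ q, bar (bar q) = q
  ε : J → ℤ
  ε_bar : ∀ q, ε (bar q) = - ε q
  ε_sq : ∀ q, ε q * ε q = 1
  y : J → A
  D : J → Derivation K A A
  D0 : Derivation K A A
  E : Derivation K A A
  D_y : ∀ q r, D q (y r) = if q = r then 1 else 0
  D_comm : ∀ q r a, D q (D r a) = D r (D q a)
  D0_D : ∀ q a, D0 (D q a) = D q (D0 a)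
  D0_E : ∀ a, D0 (E a) = E (D0 a)
  E_D : ∀ q a, E (D q a) = D q (E a) - D q a
  E_y : ∀ q, E (y q) = y q
  D0_y : ∀ q, D0 (y q) = 0
  nil : ∀ a, ∃ n : ℕ,
    (((∑ q, LinearMap.mulLeft K (y q) * (D q).toLinearMap) - E.toLinearMap) ^ n) a = 0
  const : ∀ a, D0 a = 0 → (∀ q, D q a = 0) → ∃ c : K, a = algebraMap K A c
  y_inj : ∀ q a, y q * a = 0 → a = 0
  ES1 : ∀ (c : ℤ) z, E (E z - c * z) = c * (E z - c * z) → E z = c * z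
  ES2 : ∀ (c : ℤ) a, D0 a = 0 → ∃ s, D0 s = 0 ∧
    E (a - (E s - c * s)) = c * (a - (E s - c * s))

namespace CData

section Basics

variable {K A J : Type*} [Field K] [CharZero K] [CommRing A] [Algebra K A] [Fintype J]
  [DecidableEq J] (C : CData K A J)

theorem der_mul (D : Derivation K A A) (a b : A) : D (a * b) = D a * b + a * D b := by
  rw [D.leibniz, smul_eq_mul, smul_eq_mul]; ring

theorem lin_int (d : A →ₗ[K] A) (n : ℤ) (a : A) : d (n * a) = n * d a := by
  rw [← zsmul_eq_mul, map_zsmul, zsmul_eq_mul]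

theorem lin_int' (D : Derivation K A A) (n : ℤ) (a : A) : D (n * a) = n * D a := by
  rw [← zsmul_eq_mul, map_zsmul, zsmul_eq_mul]

theorem lin_two (d : A →ₗ[K] A) (a : A) : d (2 * a) = 2 * d a := by
  rw [two_mul, map_add, two_mul]

theorem lin_two' (D : Derivation K A A) (a : A) : D (2 * a) = 2 * D a := by
  rw [two_mul, map_add, two_mul]

theorem cz {K A : Type*} [Field K] [CharZero K] [CommRing A] [Algebra K A] (n : ℤ) (hn : n ≠ 0) (a : A) (h : (n : A) * a = 0) : a = 0 := by
  have h1 : ((n : K)) • a = 0 := by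
    rw [Algebra.smul_def, map_intCast, h]
  exact (smul_eq_zero_iff_right (by exact_mod_cast hn)).1 h1

def P (u v : A) : A := ∑ q, (C.ε q : A) * (C.D q u * C.D (C.bar q) v)

def L (u : A) : A := 2 * u - C.E u

def br (u v : A) : A := C.P u v + C.L u * C.D0 v - C.D0 u * C.L v

def barE : J ≃ J := ⟨C.bar, C.bar, C.bar_bar, C.bar_bar⟩

theorem sum_bar (f : J → A) : ∑ q, f (C.bar q) = ∑ q, f q := C.barE.sum_comp f

theorem P_anti (u v : A) : C.P v u = - C.P u v := by
  unfold P
  rw [← C.sum_bar, ← Finset.sum_neg_distrib]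
  refine Finset.sum_congr rfl fun q _ => ?_
  rw [C.bar_bar, C.ε_bar]; push_cast; ring

theorem P_add_left (u v w : A) : C.P (u + v) w = C.P u w + C.P v w := by
  unfold P
  rw [← Finset.sum_add_distrib]
  refine Finset.sum_congr rfl fun q _ => ?_
  rw [map_add]; ring

theorem P_add_right (u v w : A) : C.P u (v + w) = C.P u v + C.P u w := by
  rw [C.P_anti, P_add_left, C.P_anti u v, C.P_anti u w]; ring

theorem P_smul_left (c : K) (u v : A) : C.P (c • u) v = c • C.P u v := by
  unfold P
  rw [Finset.smul_sum]
  refine Finset.sum_congr rfl fun q _ => ?_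
  rw [Derivation.map_smul]; simp only [smul_mul_assoc, mul_smul_comm]

theorem P_neg_left (u w : A) : C.P (-u) w = - C.P u w := by
  have := C.P_smul_left (-1) u w; simpa using this

theorem P_sub_left (u v w : A) : C.P (u - v) w = C.P u w - C.P v w := by
  rw [sub_eq_add_neg, P_add_left, P_neg_left]; ring

theorem P_sub_right (u v w : A) : C.P u (v - w) = C.P u v - C.P u w := by
  rw [C.P_anti, P_sub_left, C.P_anti u v, C.P_anti u w]; ring

theorem P_mul_left (u v w : A) : C.P (u * v) w = u * C.P v w + C.P u w * v := by
  unfold P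
  rw [Finset.mul_sum, Finset.sum_mul, ← Finset.sum_add_distrib]
  refine Finset.sum_congr rfl fun q _ => ?_
  rw [der_mul]; ring

theorem P_mul_right (u v w : A) : C.P u (v * w) = v * C.P u w + C.P u v * w := by
  rw [C.P_anti, P_mul_left, C.P_anti u v, C.P_anti u w]; ring

theorem P_two_left (u w : A) : C.P (2 * u) w = 2 * C.P u w := by
  rw [two_mul, P_add_left, two_mul]

theorem P_two_right (u w : A) : C.P u (2 * w) = 2 * C.P u w := by
  rw [two_mul, P_add_right, two_mul]

theorem P_jac (u v w : A) : C.P u (C.P v w) = C.P (C.P u v) w + C.P v (C.P u w) := by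
  have hint : ∀ (D : Derivation K A A) (f g : J → A),
      D (∑ r, (C.ε r : A) * (f r * g r)) =
        ∑ r, (C.ε r : A) * (D (f r) * g r + f r * D (g r)) := by
    intro D f g
    rw [map_sum]
    exact Finset.sum_congr rfl fun r _ => by rw [lin_int', der_mul]
  have e1 : C.P u (C.P v w) =
      (∑ q, ∑ r, (C.ε q : A) * C.ε r * (C.D q u * C.D (C.bar q) (C.D r v) * C.D (C.bar r) w)) +
      (∑ q, ∑ r, (C.ε q : A) * C.ε r *
        (C.D q u * C.D r v * C.D (C.bar q) (C.D (C.bar r) w))) := by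
    rw [← Finset.sum_add_distrib]
    unfold P
    refine Finset.sum_congr rfl fun q _ => ?_
    rw [hint, ← Finset.sum_add_distrib, Finset.mul_sum, Finset.mul_sum]
    exact Finset.sum_congr rfl fun r _ => by ring
  have e3 : C.P v (C.P u w) =
      (∑ q, ∑ r, (C.ε q : A) * C.ε r * (C.D q v * C.D (C.bar q) (C.D r u) * C.D (C.bar r) w)) +
      (∑ q, ∑ r, (C.ε q : A) * C.ε r *
        (C.D q v * C.D r u * C.D (C.bar q) (C.D (C.bar r) w))) := by
    rw [← Finset.sum_add_distrib]
    unfold P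
    refine Finset.sum_congr rfl fun q _ => ?_
    rw [hint, ← Finset.sum_add_distrib, Finset.mul_sum, Finset.mul_sum]
    exact Finset.sum_congr rfl fun r _ => by ring
  have e2 : C.P (C.P u v) w =
      (∑ q, ∑ r, (C.ε q : A) * C.ε r * (C.D q (C.D r u) * C.D (C.bar r) v * C.D (C.bar q) w)) +
      (∑ q, ∑ r, (C.ε q : A) * C.ε r *
        (C.D r u * C.D q (C.D (C.bar r) v) * C.D (C.bar q) w)) := by
    rw [← Finset.sum_add_distrib]
    unfold P
    refine Finset.sum_congr rfl fun q _ => ?_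
    rw [hint, ← Finset.sum_add_distrib, Finset.sum_mul, Finset.mul_sum]
    exact Finset.sum_congr rfl fun r _ => by ring
  have f1 : (∑ q, ∑ r, (C.ε q : A) * C.ε r *
      (C.D q u * C.D (C.bar q) (C.D r v) * C.D (C.bar r) w)) =
      (∑ q, ∑ r, (C.ε q : A) * C.ε r *
        (C.D r u * C.D q (C.D (C.bar r) v) * C.D (C.bar q) w)) := by
    rw [Finset.sum_comm]
    refine Finset.sum_congr rfl fun q _ => Finset.sum_congr rfl fun r _ => ?_
    rw [C.D_comm q]; ring
  have f2 : (∑ q, ∑ r, (C.ε q : A) * C.ε r *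
        (C.D q u * C.D r v * C.D (C.bar q) (C.D (C.bar r) w))) =
      (∑ q, ∑ r, (C.ε q : A) * C.ε r *
        (C.D q v * C.D r u * C.D (C.bar q) (C.D (C.bar r) w))) := by
    rw [Finset.sum_comm]
    refine Finset.sum_congr rfl fun q _ => Finset.sum_congr rfl fun r _ => ?_
    rw [C.D_comm (C.bar q)]; ring
  have f3 : (∑ q, ∑ r, (C.ε q : A) * C.ε r *
        (C.D q v * C.D (C.bar q) (C.D r u) * C.D (C.bar r) w)) =
      - (∑ q, ∑ r, (C.ε q : A) * C.ε r *
        (C.D q (C.D r u) * C.D (C.bar r) v * C.D (C.bar q) w)) := by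
    rw [Finset.sum_comm, ← Finset.sum_neg_distrib]
    refine Finset.sum_congr rfl fun q _ => ?_
    rw [← C.sum_bar, ← Finset.sum_neg_distrib]
    refine Finset.sum_congr rfl fun r _ => ?_
    rw [C.D_comm q, C.bar_bar, C.ε_bar]; push_cast; ring
  rw [e1, e2, e3, f1, f2, f3]; ring

theorem D0_P (u v : A) : C.D0 (C.P u v) = C.P (C.D0 u) v + C.P u (C.D0 v) := by
  unfold P
  rw [← Finset.sum_add_distrib, map_sum]
  refine Finset.sum_congr rfl fun q _ => ?_
  rw [lin_int', der_mul, C.D0_D, C.D0_D]; ring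

theorem E_P (u v : A) : C.E (C.P u v) = C.P (C.E u) v + C.P u (C.E v) - 2 * C.P u v := by
  unfold P
  rw [Finset.mul_sum, ← Finset.sum_add_distrib, ← Finset.sum_sub_distrib, map_sum]
  refine Finset.sum_congr rfl fun q _ => ?_
  rw [lin_int', der_mul, C.E_D, C.E_D]; ring

theorem D_P (r : J) (u v : A) : C.D r (C.P u v) = C.P (C.D r u) v + C.P u (C.D r v) := by
  unfold P
  rw [← Finset.sum_add_distrib, map_sum]
  refine Finset.sum_congr rfl fun q _ => ?_
  rw [lin_int', der_mul, C.D_comm r, C.D_comm r]; ring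

theorem der_two (D : Derivation K A A) : D 2 = 0 := by
  have := D.map_natCast 2
  simpa using this

theorem P_of_two (u : A) : C.P u 2 = 0 := by
  unfold P; simp [der_two]

theorem P_of_two' (u : A) : C.P 2 u = 0 := by
  unfold P; simp [der_two]

theorem jacobi (u v w : A) : C.br u (C.br v w) = C.br (C.br u v) w + C.br v (C.br u w) := by
  have h := C.P_jac u v w
  unfold br L
  simp only [P_add_right, P_sub_right, P_add_left, P_sub_left, P_mul_left, P_mul_right,
    P_of_two, P_of_two', der_two, map_add, map_sub, der_mul, C.D0_P, C.E_P, C.D0_E]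
  rw [h, C.P_anti u v, C.P_anti (C.D0 u) v, C.P_anti (C.E u) v]
  ring

theorem br_anti (u v : A) : C.br v u = - C.br u v := by
  unfold br; rw [C.P_anti]; ring

theorem br_add_left (u v w : A) : C.br (u + v) w = C.br u w + C.br v w := by
  unfold br L; rw [P_add_left]; simp only [map_add]; ring

theorem br_add_right (u v w : A) : C.br u (v + w) = C.br u v + C.br u w := by
  unfold br L; rw [P_add_right]; simp only [map_add]; ring

theorem br_smul_left (c : K) (u w : A) : C.br (c • u) w = c • C.br u w := by
  unfold br L; rw [P_smul_left]
  simp only [Derivation.map_smul]; simp only [Algebra.smul_def]; ring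

theorem br_smul_right (c : K) (u w : A) : C.br u (c • w) = c • C.br u w := by
  rw [C.br_anti, br_smul_left, C.br_anti u w, smul_neg, neg_neg]

def ad (u : A) : A →ₗ[K] A where
  toFun := C.br u
  map_add' := C.br_add_right u
  map_smul' c w := by simp [br_smul_right]

@[simp] theorem ad_apply (u v : A) : C.ad u v = C.br u v := rfl

theorem br_zero (u : A) : C.br u 0 = 0 := (C.ad u).map_zero
theorem zero_br (u : A) : C.br 0 u = 0 := by rw [C.br_anti, br_zero, neg_zero]
theorem br_sub_left (u v w : A) : C.br (u - v) w = C.br u w - C.br v w := by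
  rw [eq_sub_iff_add_eq, ← br_add_left, sub_add_cancel]

theorem br_mul (u v w : A) :
    C.br u (v * w) = C.br u v * w + v * C.br u w + 2 * C.D0 u * v * w := by
  unfold br L; simp only [P_mul_right, der_mul]; ring

/-- Lie derivations. -/
def IsDer (d : A →ₗ[K] A) : Prop := ∀ u v, d (C.br u v) = C.br (d u) v + C.br u (d v)

theorem isDer_sub_ad {d : A →ₗ[K] A} (hd : C.IsDer d) (u : A) : C.IsDer (d - C.ad u) := by
  intro v w
  simp only [LinearMap.sub_apply, ad_apply, hd v w, C.jacobi u v w]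
  rw [sub_eq_add_neg (d v), sub_eq_add_neg (d w), C.br_add_left, C.br_add_right]
  have : C.br (-C.br u v) w = - C.br (C.br u v) w := by
    simpa using C.br_smul_left (-1) (C.br u v) w
  have h2 : C.br v (-C.br u w) = - C.br v (C.br u w) := by
    simpa using C.br_smul_right (-1) v (C.br u w)
  rw [this, h2]; ring

theorem D_one (D : Derivation K A A) : D 1 = 0 := D.map_one_eq_zero

theorem P_y (q : J) (v : A) : C.P (C.y q) v = C.ε q * C.D (C.bar q) v := by
  unfold P
  rw [Finset.sum_eq_single q]
  · rw [C.D_y, if_pos rfl]; ring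
  · intro r _ hr; rw [C.D_y, if_neg hr]; ring
  · intro h; exact absurd (Finset.mem_univ _) h

theorem P_y' (q : J) (v : A) : C.P v (C.y q) = - (C.ε q * C.D (C.bar q) v) := by
  rw [C.P_anti, P_y]

theorem P_one (v : A) : C.P 1 v = 0 := by
  unfold P; simp

theorem P_alg (c : K) (v : A) : C.P (algebraMap K A c) v = 0 := by
  unfold P; simp

theorem br_one (v : A) : C.br 1 v = 2 * C.D0 v := by
  unfold br L; rw [P_one, D_one, D_one]; ring

theorem br_y (q : J) (v : A) : C.br (C.y q) v = C.ε q * C.D (C.bar q) v + C.y q * C.D0 v := by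
  unfold br L; rw [P_y, C.E_y, C.D0_y]; ring

theorem ε_sqA (q : J) : (C.ε q : A) * C.ε q = 1 := by
  rw [← Int.cast_mul, C.ε_sq, Int.cast_one]

/-- solve for the derivative -/
theorem D_of_P (q : J) (v : A) : C.D q v = C.ε q * C.P v (C.y (C.bar q)) := by
  rw [P_y', C.bar_bar, C.ε_bar]; push_cast
  linear_combination (-C.D q v) * C.ε_sqA q

theorem const_of_P (f : A) (h0 : C.D0 f = 0) (h : ∀ q, C.P f (C.y q) = 0) :
    ∃ c : K, f = algebraMap K A c :=
  C.const f h0 fun q => by rw [D_of_P, h, mul_zero]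

theorem ES (c : ℤ) (w z : A) (hw : w = C.E z - c * z) (h : C.E w = c * w) : w = 0 := by
  subst hw
  rw [C.ES1 c z h, sub_self]

theorem alg_wt (c : K) (n : ℤ) (hn : n ≠ 0) (h : C.E (algebraMap K A c) = n * algebraMap K A c) :
    (algebraMap K A c : A) = 0 := by
  rw [Derivation.map_algebraMap] at h
  exact cz (K := K) n hn _ h.symm

end Basics
end CData

namespace CData
section Steps

variable {K A J : Type*} [Field K] [CharZero K] [CommRing A] [Algebra K A] [Fintype J]
  [DecidableEq J] (C : CData K A J)

structure NCase (τ : A) : Prop where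
  D0τ : C.D0 τ = 1
  Dτ : ∀ q, C.D q τ = 0
  Eτ : C.E τ = 0
  surj : ∀ a, ∃ b, C.D0 b = a

structure GCase (e e' : A) : Prop where
  ee : e * e' = 1
  D0e : C.D0 e = e
  D0e' : C.D0 e' = - e'
  De : ∀ q, C.D q e = 0
  De' : ∀ q, C.D q e' = 0
  Ee : C.E e = 0
  Ee' : C.E e' = 0
  DS1 : ∀ (c : ℤ) z, C.D0 (C.D0 z - c * z) = c * (C.D0 z - c * z) → C.D0 z = c * z
  DS2 : ∀ a, ∃ s, C.D0 (a - C.D0 s) = 0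

variable {C}

theorem P_of_D_left {a : A} (h : ∀ q, C.D q a = 0) (v : A) : C.P a v = 0 := by
  unfold P; exact Finset.sum_eq_zero fun q _ => by rw [h]; ring

theorem P_of_D_right {a : A} (h : ∀ q, C.D q a = 0) (v : A) : C.P v a = 0 := by
  rw [C.P_anti, P_of_D_left h, neg_zero]

theorem P_zero_left (v : A) : C.P 0 v = 0 := P_of_D_left (fun q => by rw [map_zero]) v
theorem P_zero_right (v : A) : C.P v 0 = 0 := P_of_D_right (fun q => by rw [map_zero]) v

theorem IsDer.comm_D0 {d : A →ₗ[K] A} (hd : C.IsDer d) (h1 : d 1 = 0) (v : A) :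
    d (C.D0 v) = C.D0 (d v) := by
  have h := hd 1 v
  rw [h1, zero_br, br_one, br_one, lin_two] at h
  have : ((2 : ℤ) : A) * (d (C.D0 v) - C.D0 (d v)) = 0 := by
    push_cast; linear_combination h
  exact sub_eq_zero.1 (cz (K := K) 2 two_ne_zero _ this)

theorem ad_neg_one {s : A} (hs : C.D0 s = 0) : C.br s 1 = 0 := by
  rw [C.br_anti, br_one, hs]; ring

theorem N_step1 {τ : A} (hN : C.NCase τ) {d : A →ₗ[K] A} (hd : C.IsDer d) :
    ∃ u, (d - C.ad u) 1 = 0 := by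
  obtain ⟨b, hb⟩ := hN.surj (d 1)
  refine ⟨-((2 : K)⁻¹ • b), ?_⟩
  rw [LinearMap.sub_apply, ad_apply, C.br_anti, br_one, map_neg, Derivation.map_smul, hb,
    Algebra.smul_def]
  have : (2 : A) * algebraMap K A 2⁻¹ = 1 := by
    rw [← map_ofNat (algebraMap K A) 2, ← map_mul, mul_inv_cancel₀ two_ne_zero, map_one]
  linear_combination (-d 1) * this

theorem N_step2 {τ : A} (hN : C.NCase τ) {d : A →ₗ[K] A} (hd : C.IsDer d) (h1 : d 1 = 0) :
    ∃ u, (d - C.ad u) 1 = 0 ∧ C.E ((d - C.ad u) τ) = 2 * ((d - C.ad u) τ) := by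
  have h0 : C.D0 (d τ) = 0 := by rw [← hd.comm_D0 h1, hN.D0τ, h1]
  obtain ⟨s, hs, hs'⟩ := C.ES2 2 (d τ) h0
  refine ⟨-s, ?_, ?_⟩
  · rw [LinearMap.sub_apply, ad_apply, ad_neg_one (by rw [map_neg, hs, neg_zero]), h1, sub_zero]
  · have : C.br (-s) τ = C.E s - 2 * s := by
      unfold br L
      rw [P_of_D_right hN.Dτ, hN.D0τ, map_neg, map_neg, hs, hN.Eτ]; ring
    rw [LinearMap.sub_apply, ad_apply, this]
    exact_mod_cast hs'

theorem N_step3 {τ : A} (hN : C.NCase τ) {d : A →ₗ[K] A} (hd : C.IsDer d) (h1 : d 1 = 0)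
    (h2 : C.E (d τ) = 2 * d τ) :
    d τ = 0 ∧ ∀ q, C.D0 (d (C.y q)) = 0 ∧ C.E (d (C.y q)) = d (C.y q) := by
  have h0 : C.D0 (d τ) = 0 := by rw [← hd.comm_D0 h1, hN.D0τ, h1]
  have hg : ∀ q, C.D0 (d (C.y q)) = 0 := fun q => by rw [← hd.comm_D0 h1, C.D0_y, map_zero]
  have key : ∀ q, C.P (d τ) (C.y q) = d (C.y q) - C.E (d (C.y q)) := by
    intro q
    have h := hd τ (C.y q)
    have e1 : C.br τ (C.y q) = - C.y q := by
      unfold br L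
      rw [P_of_D_left hN.Dτ, C.D0_y, hN.D0τ, C.E_y]; ring
    have e2 : C.br (d τ) (C.y q) = C.P (d τ) (C.y q) := by
      unfold br L
      rw [C.D0_y, h0]; ring
    have e3 : C.br τ (d (C.y q)) = -(2 * d (C.y q) - C.E (d (C.y q))) := by
      unfold br L
      rw [P_of_D_left hN.Dτ, hg, hN.D0τ]; ring
    rw [e1, e2, e3, map_neg] at h
    linear_combination -h
  have hP : ∀ q, C.P (d τ) (C.y q) = 0 := by
    intro q
    have hE : C.E (C.P (d τ) (C.y q)) = C.P (d τ) (C.y q) := by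
      rw [E_P, h2, C.E_y, P_two_left]; ring
    have := C.ES 1 (-C.P (d τ) (C.y q)) (d (C.y q)) (by rw [key]; push_cast; ring)
      (by rw [map_neg, hE]; push_cast; ring)
    linear_combination -this
  obtain ⟨c, hc⟩ := C.const_of_P _ h0 hP
  refine ⟨?_, fun q => ⟨hg q, ?_⟩⟩
  · rw [hc] at h2 ⊢
    exact C.alg_wt c 2 two_ne_zero (by exact_mod_cast h2)
  · have := key q
    rw [hP] at this
    linear_combination this

theorem G_step1 {e e' : A} (hG : C.GCase e e') {d : A →ₗ[K] A} (hd : C.IsDer d) :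
    ∃ u, C.D0 ((d - C.ad u) 1) = 0 := by
  obtain ⟨b, hb⟩ := hG.DS2 (d 1)
  refine ⟨-((2 : K)⁻¹ • b), ?_⟩
  have : (2 : A) * algebraMap K A 2⁻¹ = 1 := by
    rw [← map_ofNat (algebraMap K A) 2, ← map_mul, mul_inv_cancel₀ two_ne_zero, map_one]
  have e : (d - C.ad (-((2 : K)⁻¹ • b))) 1 = d 1 - C.D0 b := by
    rw [LinearMap.sub_apply, ad_apply, C.br_anti, br_one, map_neg, Derivation.map_smul,
      Algebra.smul_def]
    linear_combination (-C.D0 b) * this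
  rw [e, hb]

theorem GCase.canc {e e' : A} (hG : C.GCase e e') {a : A} (h : e * a = 0) : a = 0 := by
  linear_combination e' * h - a * hG.ee

theorem GCase.canc' {e e' : A} (hG : C.GCase e e') {a : A} (h : e' * a = 0) : a = 0 := by
  linear_combination e * h - a * hG.ee

theorem G_step1b {e e' : A} (hG : C.GCase e e') {d : A →ₗ[K] A} (hd : C.IsDer d)
    (h0 : C.D0 (d 1) = 0) : d 1 = 0 := by
  have key : ∀ v, 2 * d (C.D0 v) = C.br (d 1) v + 2 * C.D0 (d v) := by
    intro v
    have h := hd 1 v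
    rw [br_one, br_one, lin_two] at h
    exact h
  have hP : ∀ q, C.P (d 1) (C.y q) = 0 := by
    intro q
    have h := key (C.y q)
    have e2 : C.br (d 1) (C.y q) = C.P (d 1) (C.y q) := by
      unfold br L
      rw [C.D0_y, h0]; ring
    rw [C.D0_y, map_zero, e2] at h
    have h3 : C.D0 (C.P (d 1) (C.y q)) = 0 := by
      rw [D0_P, h0, C.D0_y, P_zero_left, P_zero_right, add_zero]
    have h4 : ((2 : ℤ) : A) * C.D0 (C.D0 (d (C.y q))) = 0 := by
      have h5 := congrArg C.D0 h
      rw [map_add, h3, mul_zero, map_zero, lin_two'] at h5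
      push_cast; linear_combination -h5
    have h6 := cz (K := K) 2 two_ne_zero _ h4
    have h7 := hG.DS1 0 (d (C.y q)) (by push_cast; rw [zero_mul, sub_zero, zero_mul, h6])
    push_cast at h7
    linear_combination -h - 2 * h7
  obtain ⟨c, hc⟩ := C.const_of_P _ h0 hP
  have h := key e
  have e2 : C.br (d 1) e = 2 * d 1 * e := by
    unfold br L
    rw [P_of_D_right hG.De, hG.D0e, h0, hc, Derivation.map_algebraMap]; ring
  rw [hG.D0e, e2] at h
  have h' : C.D0 (d e) - d e = - (d 1 * e) := by
    have : ((2 : ℤ) : A) * (C.D0 (d e) - d e + d 1 * e) = 0 := by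
      push_cast; linear_combination -h
    linear_combination cz (K := K) 2 two_ne_zero _ this
  have h8 := hG.DS1 1 (d e) (by
    push_cast
    rw [one_mul, one_mul, h', map_neg, der_mul, h0, hG.D0e]; ring)
  push_cast at h8
  refine hG.canc ?_
  linear_combination h' - h8

theorem GCase.br_ee {e e' : A} (hG : C.GCase e e') {v w : A} (hv : C.D0 v = 0) (hw : C.D0 w = 0) :
    C.br (e * v) (e' * w) = C.P v w - C.L v * w - v * C.L w := by
  unfold br L
  rw [P_mul_left, P_mul_right, P_mul_right, P_of_D_left hG.De, P_of_D_left hG.De,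
    P_of_D_right hG.De']
  simp only [der_mul, hv, hw, hG.D0e, hG.D0e', hG.Ee, hG.Ee']
  linear_combination (C.P v w - (2 * v - C.E v) * w - v * (2 * w - C.E w)) * hG.ee

theorem GCase.br_e {e e' : A} (hG : C.GCase e e') {b : A} (hb : C.D0 b = 0) :
    C.br e b = - (e * C.L b) := by
  unfold br L
  rw [P_of_D_left hG.De, hb, hG.D0e]; ring

theorem GCase.br_e' {e e' : A} (hG : C.GCase e e') {b : A} (hb : C.D0 b = 0) :
    C.br e' b = e' * C.L b := by
  unfold br L
  rw [P_of_D_left hG.De', hb, hG.D0e']; ring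

theorem L_one : C.L 1 = 2 := by unfold L; rw [D_one]; ring

theorem GCase.br_e'e {e e' : A} (hG : C.GCase e e') {b : A} (hb : C.D0 b = 0) :
    C.br e' (e * b) = 4 * b - C.E b := by
  have := hG.br_ee hb (D_one C.D0)
  rw [C.br_anti]
  rw [mul_one] at this
  rw [this, C.P_anti, P_one, L_one]; unfold L; ring

theorem GCase.br_ee' {e e' : A} (hG : C.GCase e e') {b : A} (hb : C.D0 b = 0) :
    C.br e (e' * b) = -(4 * b - C.E b) := by
  have := hG.br_ee (D_one C.D0) hb
  rw [mul_one] at this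
  rw [this, P_one, L_one]; unfold L; ring

theorem G_step2 {e e' : A} (hG : C.GCase e e') {d : A →ₗ[K] A} (hd : C.IsDer d) (h1 : d 1 = 0) :
    ∃ u, (d - C.ad u) 1 = 0 ∧ ∃ f, C.D0 f = 0 ∧ C.E f = 2 * f ∧ (d - C.ad u) e = e * f := by
  have h0 : C.D0 (d e) = d e := by rw [← hd.comm_D0 h1, hG.D0e]
  obtain ⟨s, hs, hs'⟩ := C.ES2 2 (e' * d e) (by rw [der_mul, hG.D0e', h0]; ring)
  refine ⟨-s, ?_, e' * d e - (C.E s - 2 * s), ?_, by exact_mod_cast hs', ?_⟩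
  · rw [LinearMap.sub_apply, ad_apply, ad_neg_one (by rw [map_neg, hs, neg_zero]), h1, sub_zero]
  · rw [map_sub, map_sub, lin_two', C.D0_E, der_mul, hG.D0e', h0, hs, map_zero]; ring
  · have : C.br (-s) e = e * (C.E s - 2 * s) := by
      unfold br L
      rw [P_of_D_right hG.De, hG.D0e, map_neg, map_neg, hs, hG.Ee]; ring
    rw [LinearMap.sub_apply, ad_apply, this]
    linear_combination (- d e) * hG.ee

theorem P_self (a : A) : C.P a a = 0 := by
  have := C.P_anti a a
  have h : ((2 : ℤ) : A) * C.P a a = 0 := by push_cast; linear_combination this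
  exact cz (K := K) 2 two_ne_zero _ h

theorem D0_L {b : A} (hb : C.D0 b = 0) : C.D0 (C.L b) = 0 := by
  unfold L; rw [map_sub, lin_two', C.D0_E, hb, map_zero]; ring

theorem G_step3 {e e' : A} (hG : C.GCase e e') {d : A →ₗ[K] A} (hd : C.IsDer d) (h1 : d 1 = 0)
    {f : A} (hf : C.D0 f = 0) (hEf : C.E f = 2 * f) (hde : d e = e * f) (q0 : J) :
    d e = 0 ∧ d e' = 0 ∧ ∀ q, C.D0 (d (C.y q)) = 0 ∧
      C.E (C.E (d (C.y q))) - 6 * C.E (d (C.y q)) + 5 * d (C.y q) = 0 := by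
  have hg : ∀ q, C.D0 (d (C.y q)) = 0 := fun q => by rw [← hd.comm_D0 h1, C.D0_y, map_zero]
  have h0' : C.D0 (d e') = - d e' := by rw [← hd.comm_D0 h1, hG.D0e', map_neg]
  obtain ⟨f', hf', hde'⟩ : ∃ f', C.D0 f' = 0 ∧ d e' = e' * f' := by
    refine ⟨e * d e', by rw [der_mul, hG.D0e, h0']; ring, ?_⟩
    linear_combination (- d e') * hG.ee
  have hE4 : C.E (f + f') = 4 * (f + f') := by
    have hbr : C.br e e' = -4 := by
      have := hG.br_ee' (D_one C.D0)
      rw [mul_one] at this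
      rw [this, D_one]; ring
    have h := hd e e'
    have h4 : d (-4 : A) = 0 := by
      have := lin_int d (-4) 1
      rw [h1, mul_zero, mul_one] at this
      exact_mod_cast this
    have ea := hG.br_ee hf (D_one C.D0)
    rw [mul_one, C.P_anti, P_one, L_one] at ea
    rw [hbr, h4, hde, hde', hG.br_ee' hf', ea] at h
    unfold L at h
    rw [map_add]
    linear_combination -h
  have hEf' : C.E f' = 4 * f' + 2 * f := by
    rw [map_add, hEf] at hE4; linear_combination hE4
  have key : ∀ q, C.E (C.E (d (C.y q))) - 6 * C.E (d (C.y q)) + 5 * d (C.y q) =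
      4 * C.P f (C.y q) - C.P (f + f') (C.y q) + (f + f') * C.y q := by
    intro q
    set g := d (C.y q) with hgdef
    have b1 : C.br e (C.y q) = - (e * C.y q) := by
      rw [hG.br_e (C.D0_y q)]; unfold L; rw [C.E_y]; ring
    have b2 : C.br (e * f) (C.y q) = e * (C.P f (C.y q) - f * C.y q) := by
      unfold br L
      simp only [P_mul_left, P_of_D_left hG.De, der_mul, hG.D0e, hf, C.D0_y, C.E_y]; ring
    have b3 : d (- (e * C.y q)) = e * (C.P f (C.y q) - f * C.y q - C.L g) := by
      rw [← b1, hd, hde, b2, ← hgdef, hG.br_e (hg q)]; ring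
    have hPf : C.D0 (C.P f (C.y q)) = 0 := by
      rw [D0_P, hf, C.D0_y, P_zero_left, P_zero_right, add_zero]
    have hk : C.D0 (C.P f (C.y q) - f * C.y q - C.L g) = 0 := by
      rw [map_sub, map_sub, hPf, der_mul, hf, C.D0_y, D0_L (hg q)]; ring
    have b4 : C.br e' (-(e * C.y q)) = ((-3 : ℤ) : A) * C.y q := by
      have := hG.br_e'e (b := - C.y q) (by rw [map_neg, C.D0_y, neg_zero])
      rw [mul_neg] at this
      rw [this, map_neg, C.E_y]; push_cast; ring
    have h := hd e' (-(e * C.y q))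
    have b5 : C.br (e' * f') (-(e * C.y q)) = C.P (C.y q) f' - C.y q * f' - C.y q * C.L f' := by
      rw [C.br_anti]
      have e1 := hG.br_ee (C.D0_y q) hf'
      have e2 : C.br (-(e * C.y q)) (e' * f') = - C.br (e * C.y q) (e' * f') := by
        simpa using C.br_smul_left (-1) (e * C.y q) (e' * f')
      rw [e2, e1]; unfold L; rw [C.E_y]; ring
    rw [b4, b3, hde', b5, hG.br_e'e hk, lin_int, ← hgdef] at h
    have hEP : C.E (C.P f (C.y q)) = C.P f (C.y q) := by
      rw [E_P, hEf, C.E_y, P_two_left]; ring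
    rw [C.P_anti f' (C.y q)] at h
    unfold L at h
    simp only [map_sub, hEP, der_mul, hEf, hEf', C.E_y, der_two] at h
    push_cast at h
    rw [P_add_left]
    linear_combination h
  have wP : ∀ q, C.E (C.P f (C.y q)) = C.P f (C.y q) := fun q => by
    rw [E_P, hEf, C.E_y, P_two_left]; ring
  have wh : ∀ q, C.E (C.P (f + f') (C.y q)) = 3 * C.P (f + f') (C.y q) := fun q => by
    have : (4 : A) * (f + f') = 2 * (2 * (f + f')) := by ring
    rw [E_P, hE4, C.E_y, this, P_two_left, P_two_left]; ring
  have wy : ∀ q, C.E ((f + f') * C.y q) = 5 * ((f + f') * C.y q) := fun q => by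
    rw [der_mul, hE4, C.E_y]; ring
  have num : ∀ (n : ℕ) a, C.E ((n : A) * a) = n * C.E a := fun n a => by
    rw [der_mul, Derivation.map_natCast]; ring
  have n3 : ∀ a, C.E (3 * a) = 3 * C.E a := fun a => by exact_mod_cast num 3 a
  have n4 : ∀ a, C.E (4 * a) = 4 * C.E a := fun a => by exact_mod_cast num 4 a
  have n5 : ∀ a, C.E (5 * a) = 5 * C.E a := fun a => by exact_mod_cast num 5 a
  have n6 : ∀ a, C.E (6 * a) = 6 * C.E a := fun a => by exact_mod_cast num 6 a
  have n8 : ∀ a, C.E (8 * a) = 8 * C.E a := fun a => by exact_mod_cast num 8 a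
  have n15 : ∀ a, C.E (15 * a) = 15 * C.E a := fun a => by exact_mod_cast num 15 a
  have k1 : ∀ q, C.E (C.E (C.E (d (C.y q)))) - 6 * C.E (C.E (d (C.y q))) + 5 * C.E (d (C.y q)) =
      4 * C.P f (C.y q) - 3 * C.P (f + f') (C.y q) + 5 * ((f + f') * C.y q) := fun q => by
    have := congrArg C.E (key q)
    rw [map_add, map_sub, map_add, map_sub, n6, n5, n4, wP, wh, wy] at this
    exact this
  have k2 : ∀ q, C.E (C.E (C.E (C.E (d (C.y q))))) - 6 * C.E (C.E (C.E (d (C.y q))))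
      + 5 * C.E (C.E (d (C.y q))) =
      4 * C.P f (C.y q) - 9 * C.P (f + f') (C.y q) + 25 * ((f + f') * C.y q) := fun q => by
    have := congrArg C.E (k1 q)
    rw [map_add, map_sub, map_add, map_sub, n6, n5, n4, n5, n3, wP, wh, wy] at this
    linear_combination this
  have hP : ∀ q, C.P f (C.y q) = 0 := fun q => by
    have a1 := key q
    have a2 := k1 q
    have a3 := k2 q
    set g := d (C.y q)
    have := C.ES 1 (32 * C.P f (C.y q))
      (C.E (C.E (C.E g)) - 5 * (C.E (C.E g)) - 8 * (C.E (C.E g) - 5 * C.E g)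
        + 15 * (C.E g - 5 * g)) (by
        simp only [map_add, map_sub, n5, n8, n15]
        push_cast
        linear_combination -a3 + 8 * a2 - 15 * a1) (by
        have := num 32 (C.P f (C.y q))
        rw [wP] at this
        push_cast at this
        rw [this]; push_cast; ring)
    exact cz (K := K) 32 (by norm_num) _ (by exact_mod_cast this)
  have hy : ∀ q, (f + f') * C.y q = 0 := fun q => by
    have a1 := key q
    have a2 := k1 q
    have a3 := k2 q
    set g := d (C.y q)
    have := C.ES 5 (8 * ((f + f') * C.y q))
      (C.E (C.E (C.E g)) - (C.E (C.E g)) - 4 * (C.E (C.E g) - C.E g)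
        + 3 * (C.E g - g)) (by
        simp only [map_add, map_sub, n4, n3]
        push_cast
        linear_combination -a3 + 4 * a2 - 3 * a1) (by
        rw [n8, wy]; push_cast; ring)
    exact cz (K := K) 8 (by norm_num) _ (by exact_mod_cast this)
  have hh : f + f' = 0 := C.y_inj q0 _ (by rw [mul_comm]; exact hy q0)
  obtain ⟨c, hc⟩ := C.const_of_P _ hf hP
  have hf0 : f = 0 := by
    rw [hc] at hEf ⊢
    exact C.alg_wt c 2 two_ne_zero (by exact_mod_cast hEf)
  have hf0' : f' = 0 := by rw [hf0, zero_add] at hh; exact hh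
  refine ⟨by rw [hde, hf0, mul_zero], by rw [hde', hf0', mul_zero], fun q => ⟨hg q, ?_⟩⟩
  rw [key, hP, hh, P_zero_left]; ring

theorem G_step4 {e e' : A} (hG : C.GCase e e') {d : A →ₗ[K] A} (hd : C.IsDer d) (h1 : d 1 = 0)
    (he : d e = 0) (he' : d e' = 0) (q : J) (hg : C.D0 (d (C.y q)) = 0)
    (h15 : C.E (C.E (d (C.y q))) - 6 * C.E (d (C.y q)) + 5 * d (C.y q) = 0) :
    C.E (d (C.y q)) = d (C.y q) := by
  set g := d (C.y q) with hgdef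
  have b1 : C.br e (C.y q) = - (e * C.y q) := by
    rw [hG.br_e (C.D0_y q)]; unfold L; rw [C.E_y]; ring
  have b1' : C.br e' (C.y q) = e' * C.y q := by
    rw [hG.br_e' (C.D0_y q)]; unfold L; rw [C.E_y]; ring
  have d1 : d (e * C.y q) = e * C.L g := by
    have := hd e (C.y q)
    rw [b1, he, zero_br, ← hgdef, hG.br_e hg, map_neg] at this
    linear_combination -this
  have d2 : d (e' * C.y q) = e' * C.L g := by
    have := hd e' (C.y q)
    rw [b1', he', zero_br, ← hgdef, hG.br_e' hg] at this
    linear_combination this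
  have d3 : d (C.y q * C.y q) = C.y q * (C.L (C.L g) + C.L g) := by
    have h := hd (e * C.y q) (e' * C.y q)
    rw [d1, d2, hG.br_ee (C.D0_y q) (C.D0_y q), hG.br_ee (D0_L hg) (C.D0_y q),
      hG.br_ee (C.D0_y q) (D0_L hg), P_self, C.P_anti (C.L g) (C.y q)] at h
    have ly : C.L (C.y q) = C.y q := by unfold L; rw [C.E_y]; ring
    rw [ly] at h
    have e1 : (0 : A) - C.y q * C.y q - C.y q * C.y q = ((-2 : ℤ) : A) * (C.y q * C.y q) := by
      push_cast; ring
    rw [e1, lin_int] at h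
    have : ((2 : ℤ) : A) * (d (C.y q * C.y q) - C.y q * (C.L (C.L g) + C.L g)) = 0 := by
      push_cast at h ⊢; linear_combination -h
    exact sub_eq_zero.1 (cz (K := K) 2 two_ne_zero _ this)
  have hyy : C.D0 (C.y q * C.y q) = 0 := by rw [der_mul, C.D0_y]; ring
  have h := hd e (C.y q * C.y q)
  have ly2 : C.L (C.y q * C.y q) = 0 := by unfold L; rw [der_mul, C.E_y]; ring
  rw [hG.br_e hyy, ly2, mul_zero, neg_zero, map_zero, he, zero_br, zero_add, d3,
    hG.br_e (by rw [der_mul, map_add, C.D0_y, D0_L (D0_L hg), D0_L hg]; ring)] at h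
  have h2 := hG.canc (neg_eq_zero.1 h.symm)
  have h3 : C.y q * ((C.L (C.L g) + C.L g) - C.E (C.L (C.L g) + C.L g)) = 0 := by
    rw [← h2]
    conv_rhs => unfold L
    rw [der_mul, C.E_y]; unfold L; ring
  have h4 := C.y_inj q _ h3
  unfold L at h4
  simp only [map_add, map_sub, lin_two'] at h4
  have h5 := congrArg C.E h15
  have num : ∀ (n : ℕ) a, C.E ((n : A) * a) = n * C.E a := fun n a => by
    rw [der_mul, Derivation.map_natCast]; ring
  have n5 : ∀ a, C.E (5 * a) = 5 * C.E a := fun a => by exact_mod_cast num 5 a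
  have n6 : ∀ a, C.E (6 * a) = 6 * C.E a := fun a => by exact_mod_cast num 6 a
  rw [map_add, map_sub, n6, n5, map_zero] at h5
  have h6 : ((6 : ℤ) : A) * (C.E g - g) = 0 := by
    push_cast
    linear_combination -h4 - h5 + (0 : A) * h15
  exact sub_eq_zero.1 (cz (K := K) 6 (by norm_num) _ h6)

end Steps
end CData

namespace CData
section Poin

variable {K A J : Type*} [Field K] [CharZero K] [CommRing A] [Algebra K A] [Fintype J]
  [DecidableEq J] {C : CData K A J}

variable (C) in
def Θ : A →ₗ[K] A := (∑ q, LinearMap.mulLeft K (C.y q) * (C.D q).toLinearMap) - C.E.toLinearMap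

theorem Θ_apply (a : A) : C.Θ a = (∑ q, C.y q * C.D q a) - C.E a := by
  simp [Θ, LinearMap.sum_apply]

theorem sum_D_y (r : J) (G : J → A) : ∑ q, C.D r (C.y q) * G q = G r := by
  rw [Finset.sum_eq_single r]
  · rw [C.D_y, if_pos rfl, one_mul]
  · intro q _ hq; rw [C.D_y, if_neg (Ne.symm hq), zero_mul]
  · intro h; exact absurd (Finset.mem_univ _) h

theorem D_Θ (r : J) (a : A) : C.D r (C.Θ a) = C.Θ (C.D r a) := by
  rw [Θ_apply, Θ_apply, map_sub, map_sum]
  simp only [der_mul, Finset.sum_add_distrib]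
  rw [sum_D_y, C.E_D, Finset.sum_congr rfl fun q _ => by rw [C.D_comm r q]]
  ring

theorem D0_Θ (a : A) : C.D0 (C.Θ a) = C.Θ (C.D0 a) := by
  rw [Θ_apply, Θ_apply, map_sub, map_sum, C.D0_E]
  congr 1
  exact Finset.sum_congr rfl fun q _ => by rw [der_mul, C.D0_y, C.D0_D]; ring

theorem E_Θ (a : A) : C.E (C.Θ a) = C.Θ (C.E a) := by
  rw [Θ_apply, Θ_apply, map_sub, map_sum]
  congr 1
  exact Finset.sum_congr rfl fun q _ => by rw [der_mul, C.E_y, C.E_D]; ring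

theorem poincare_aux (n : ℕ) : ∀ G : J → A, (∀ q, C.D0 (G q) = 0) → (∀ q, C.E (G q) = G q) →
    (∀ q r, C.D r (G q) = C.D q (G r)) → (∀ q, (C.Θ ^ n) (G q) = 0) →
    ∃ u, C.D0 u = 0 ∧ C.E u = 2 * u ∧ ∀ q, C.D q u = G q := by
  have half : (2 : A) * algebraMap K A 2⁻¹ = 1 := by
    rw [← map_ofNat (algebraMap K A) 2, ← map_mul, mul_inv_cancel₀ two_ne_zero, map_one]
  induction n with
  | zero =>
    intro G _ _ _ h
    refine ⟨0, map_zero _, by rw [map_zero, mul_zero], fun q => ?_⟩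
    have := h q
    simp only [pow_zero, Module.End.one_apply] at this
    rw [this, map_zero]
  | succ n ih =>
    intro G h0 hE hD hn
    set hf := algebraMap K A 2⁻¹ with hfd
    have dh : ∀ (D : Derivation K A A) a, D (hf * a) = hf * D a := fun D a => by
      rw [der_mul, hfd, Derivation.map_algebraMap, zero_mul, zero_add]
    obtain ⟨u, hu0, huE, huD⟩ := ih (fun q => - (hf * C.Θ (G q)))
      (fun q => by rw [map_neg, dh, D0_Θ, h0, map_zero, mul_zero, neg_zero])
      (fun q => by rw [map_neg, dh, E_Θ, hE])
      (fun q r => by rw [map_neg, dh, D_Θ, hD, map_neg, dh, D_Θ])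
      (fun q => by
        have h := hn q
        rw [pow_succ, Module.End.mul_apply] at h
        rw [map_neg, ← Algebra.smul_def, map_smul, h, smul_zero, neg_zero])
    refine ⟨hf * ∑ q, C.y q * G q + u, ?_, ?_, fun r => ?_⟩
    · rw [map_add, hu0, dh, map_sum, Finset.sum_eq_zero (fun q _ => by
        rw [der_mul, C.D0_y, h0]; ring)]; ring
    · rw [map_add, huE, dh, map_sum]
      have : ∑ q, C.E (C.y q * G q) = 2 * ∑ q, C.y q * G q := by
        rw [Finset.mul_sum]
        exact Finset.sum_congr rfl fun q _ => by rw [der_mul, C.E_y, hE]; ring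
      rw [this]; ring
    · rw [map_add, huD, dh, map_sum, Θ_apply]
      simp only [der_mul, Finset.sum_add_distrib]
      rw [sum_D_y, Finset.sum_congr rfl fun q _ => by rw [hD q r], hE]
      linear_combination (G r) * half

theorem poincare (G : J → A) (h0 : ∀ q, C.D0 (G q) = 0) (hE : ∀ q, C.E (G q) = G q)
    (hD : ∀ q r, C.D r (G q) = C.D q (G r)) :
    ∃ u, C.D0 u = 0 ∧ C.E u = 2 * u ∧ ∀ q, C.D q u = G q := by
  choose n hn using C.nil
  refine poincare_aux (∑ q, n (G q)) G h0 hE hD fun q => ?_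
  have : n (G q) ≤ ∑ q, n (G q) :=
    Finset.single_le_sum (f := fun q => n (G q)) (fun _ _ => Nat.zero_le _) (Finset.mem_univ q)
  obtain ⟨k, hk⟩ := Nat.exists_eq_add_of_le this
  rw [hk, add_comm, pow_add, Module.End.mul_apply]
  have h := hn (G q)
  change (C.Θ ^ n (G q)) (G q) = 0 at h
  rw [h, map_zero]

theorem y_step {d : A →ₗ[K] A} (hd : C.IsDer d) (h1 : d 1 = 0)
    (h0 : ∀ q, C.D0 (d (C.y q)) = 0) (hE : ∀ q, C.E (d (C.y q)) = d (C.y q)) :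
    ∃ u, C.D0 u = 0 ∧ C.E u = 2 * u ∧ ∀ q, (d - C.ad u) (C.y q) = 0 := by
  have key : ∀ q r, (C.ε r : A) * C.D (C.bar r) (d (C.y q)) =
      C.ε q * C.D (C.bar q) (d (C.y r)) := by
    intro q r
    have h := hd (C.y q) (C.y r)
    have b2 : C.br (d (C.y q)) (C.y r) = - (C.ε r * C.D (C.bar r) (d (C.y q))) := by
      rw [C.br_anti, br_y, h0]; ring
    have b3 : d (C.br (C.y q) (C.y r)) = 0 := by
      rw [br_y, C.D0_y, C.D_y]
      split_ifs
      · rw [mul_zero, add_zero, lin_int, h1, mul_zero]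
      · rw [mul_zero, mul_zero, add_zero, map_zero]
    rw [b3, b2, br_y, h0] at h
    linear_combination h
  obtain ⟨u, hu0, huE, huD⟩ := poincare (C := C) (fun q => C.ε q * d (C.y (C.bar q)))
    (fun q => by rw [lin_int', h0, mul_zero]) (fun q => by rw [lin_int', hE])
    (fun q r => by
      have := key (C.bar q) (C.bar r)
      rw [C.bar_bar, C.bar_bar, C.ε_bar, C.ε_bar] at this
      push_cast at this
      rw [lin_int', lin_int']
      linear_combination (-C.ε q * C.ε r : A) * this - C.ε q * C.D r (d (C.y (C.bar q))) * C.ε_sqA r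
        + C.ε r * C.D q (d (C.y (C.bar r))) * C.ε_sqA q)
  refine ⟨u, hu0, huE, fun q => ?_⟩
  rw [LinearMap.sub_apply, ad_apply, C.br_anti, br_y, hu0, huD, C.bar_bar, C.ε_bar]
  push_cast
  linear_combination (-d (C.y q)) * C.ε_sqA q

theorem ad_add (u v : A) : C.ad (u + v) = C.ad u + C.ad v := by
  ext a; simp [br_add_left]

theorem sub_ad_ad (d : A →ₗ[K] A) (u v : A) : d - C.ad u - C.ad v = d - C.ad (u + v) := by
  rw [ad_add]; abel

theorem N_norm {τ : A} (hN : C.NCase τ) {d : A →ₗ[K] A} (hd : C.IsDer d) :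
    ∃ u, C.IsDer (d - C.ad u) ∧ (d - C.ad u) 1 = 0 ∧ (d - C.ad u) τ = 0 ∧
      ∀ q, (d - C.ad u) (C.y q) = 0 := by
  obtain ⟨u1, h1⟩ := N_step1 hN hd
  have hd1 := C.isDer_sub_ad hd u1
  obtain ⟨u2, h2, h2'⟩ := N_step2 hN hd1 h1
  have hd2 := C.isDer_sub_ad hd1 u2
  obtain ⟨h3, h3'⟩ := N_step3 hN hd2 h2 h2'
  obtain ⟨u3, hu0, huE, hy⟩ := y_step hd2 h2 (fun q => (h3' q).1) (fun q => (h3' q).2)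
  have hd3 := C.isDer_sub_ad hd2 u3
  refine ⟨u1 + u2 + u3, ?_⟩
  rw [← sub_ad_ad, ← sub_ad_ad]
  refine ⟨hd3, ?_, ?_, hy⟩
  · rw [LinearMap.sub_apply, h2, ad_apply, ad_neg_one hu0, sub_zero]
  · rw [LinearMap.sub_apply, h3, ad_apply]
    unfold br L
    rw [P_of_D_right hN.Dτ, huE, hu0]; ring

theorem G_norm {e e' : A} (hG : C.GCase e e') (q0 : J) {d : A →ₗ[K] A} (hd : C.IsDer d) :
    ∃ u, C.IsDer (d - C.ad u) ∧ (d - C.ad u) 1 = 0 ∧ (d - C.ad u) e = 0 ∧ (d - C.ad u) e' = 0 ∧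
      ∀ q, (d - C.ad u) (C.y q) = 0 := by
  obtain ⟨u1, h1⟩ := G_step1 hG hd
  have hd1 := C.isDer_sub_ad hd u1
  obtain ⟨u2, h2, f, hf, hEf, hde⟩ := G_step2 hG hd1 (G_step1b hG hd1 h1)
  have hd2 := C.isDer_sub_ad hd1 u2
  obtain ⟨h3, h3', h4⟩ := G_step3 hG hd2 h2 hf hEf hde q0
  obtain ⟨u3, hu0, huE, hy⟩ := y_step hd2 h2 (fun q => (h4 q).1)
    (fun q => G_step4 hG hd2 h2 h3 h3' q (h4 q).1 (h4 q).2)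
  have hd3 := C.isDer_sub_ad hd2 u3
  refine ⟨u1 + u2 + u3, ?_⟩
  rw [← sub_ad_ad, ← sub_ad_ad]
  refine ⟨hd3, ?_, ?_, ?_, hy⟩
  · rw [LinearMap.sub_apply, h2, ad_apply, ad_neg_one hu0, sub_zero]
  · rw [LinearMap.sub_apply, h3, ad_apply]
    unfold br L
    rw [P_of_D_right hG.De, huE, hu0]; ring
  · rw [LinearMap.sub_apply, h3', ad_apply]
    unfold br L
    rw [P_of_D_right hG.De', huE, hu0]; ring

end Poin
end CData

namespace CData
section Assoc

variable {K A J : Type*} [Field K] [CharZero K] [CommRing A] [Algebra K A] [Fintype J]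
  [DecidableEq J] {C : CData K A J}

theorem comm_D_B {d : A →ₗ[K] A} (hd : C.IsDer d) (h1 : d 1 = 0) (hy : ∀ q, d (C.y q) = 0)
    (q : J) (b : A) (hb : C.D0 b = 0) : d (C.D q b) = C.D q (d b) := by
  have h := hd (C.y (C.bar q)) b
  have hb' : C.D0 (d b) = 0 := by rw [← hd.comm_D0 h1, hb, map_zero]
  rw [hy, zero_br, br_y, br_y, hb, hb', C.bar_bar, mul_zero, add_zero, add_zero,
    lin_int, zero_add, C.ε_bar] at h
  push_cast at h
  linear_combination (-C.ε q : A) * h - (d (C.D q b) - C.D q (d b)) * C.ε_sqA q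

theorem mono_const {d : A →ₗ[K] A} (hd : C.IsDer d) (h1 : d 1 = 0) (hy : ∀ q, d (C.y q) = 0)
    (b : A) (hb : C.D0 b = 0) (h : ∀ q, d (C.D q b) = 0) : ∃ c : K, d b = algebraMap K A c :=
  C.const _ (by rw [← hd.comm_D0 h1, hb, map_zero])
    (fun q => by rw [← comm_D_B hd h1 hy q b hb, h])

/-- constants of weight two or three in the image are zero -/
def Kill (C : CData K A J) (d : A →ₗ[K] A) : Prop := ∀ b (c : K), C.D0 b = 0 →
  (C.E b = 2 * b ∨ C.E b = 3 * b) → d b = algebraMap K A c → d b = 0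

theorem N_kill {τ : A} (hN : C.NCase τ) {d : A →ₗ[K] A} (hd : C.IsDer d) (hτ : d τ = 0) :
    Kill C d := by
  intro b c hb hE hc
  have b1 : ∀ b, C.D0 b = 0 → C.br τ b = -(2 * b - C.E b) := fun b hb => by
    unfold br L
    rw [P_of_D_left hN.Dτ, hb, hN.D0τ]; ring
  have h := hd τ b
  rw [hτ, zero_br, b1 b hb, b1 (d b) (by rw [hc, Derivation.map_algebraMap]), zero_add] at h
  have hE0 : C.E (d b) = 0 := by rw [hc, Derivation.map_algebraMap]
  rw [hE0] at h
  rcases hE with hE | hE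
  · rw [hE, sub_self, neg_zero, map_zero] at h
    exact cz (K := K) 2 two_ne_zero _ (by push_cast; linear_combination h)
  · have e : -(2 * b - C.E b) = b := by rw [hE]; ring
    rw [e] at h
    exact cz (K := K) 3 three_ne_zero _ (by push_cast; linear_combination h)

theorem G_kill {e e' : A} (hG : C.GCase e e') {d : A →ₗ[K] A} (hd : C.IsDer d) (he : d e = 0)
    (he' : d e' = 0) : Kill C d := by
  intro b c hb hE hc
  have hE0 : C.E (d b) = 0 := by rw [hc, Derivation.map_algebraMap]
  have h0 : C.D0 (d b) = 0 := by rw [hc, Derivation.map_algebraMap]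
  have h := hd e b
  rw [he, zero_br, hG.br_e hb, hG.br_e h0, zero_add] at h
  unfold L at h
  rw [hE0] at h
  rcases hE with hE | hE
  · rw [hE, sub_self, mul_zero, neg_zero, map_zero] at h
    refine cz (K := K) 2 two_ne_zero _ (hG.canc ?_)
    push_cast; linear_combination h
  · have e1 : -(e * (2 * b - C.E b)) = e * b := by rw [hE]; ring
    rw [e1] at h
    have h2 := hd e' (e * b)
    have e2 : -(e * (2 * d b - 0)) = e * (-(2 * d b)) := by ring
    rw [he', zero_br, hG.br_e'e hb, h, e2, hG.br_e'e (by rw [map_neg, lin_two', h0]; ring),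
      map_neg, lin_two', hE0, hE] at h2
    have e3 : 4 * b - 3 * b = b := by ring
    rw [e3] at h2
    exact cz (K := K) 9 (by norm_num) _ (by push_cast; linear_combination h2)

theorem d_quad {d : A →ₗ[K] A} (hd : C.IsDer d) (h1 : d 1 = 0) (hy : ∀ q, d (C.y q) = 0)
    (hk : Kill C d) (q r : J) : d (C.y q * C.y r) = 0 := by
  have hb : C.D0 (C.y q * C.y r) = 0 := by rw [der_mul, C.D0_y, C.D0_y]; ring
  obtain ⟨c, hc⟩ := mono_const hd h1 hy (C.y q * C.y r) hb (fun s => by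
    rw [der_mul, C.D_y, C.D_y]
    split_ifs <;> simp [hy])
  exact hk _ c hb (Or.inl (by rw [der_mul, C.E_y, C.E_y]; ring)) hc

theorem d_cube {d : A →ₗ[K] A} (hd : C.IsDer d) (h1 : d 1 = 0) (hy : ∀ q, d (C.y q) = 0)
    (hk : Kill C d) (q : J) : d (C.y q * C.y q * C.y q) = 0 := by
  have hb : C.D0 (C.y q * C.y q * C.y q) = 0 := by rw [der_mul, der_mul, C.D0_y]; ring
  have hq := d_quad hd h1 hy hk q q
  obtain ⟨c, hc⟩ := mono_const hd h1 hy _ hb (fun s => by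
    rw [der_mul, der_mul, C.D_y]
    split_ifs
    · have : (1 * C.y q + C.y q * 1) * C.y q + C.y q * C.y q * 1 =
        C.y q * C.y q + C.y q * C.y q + C.y q * C.y q := by ring
      rw [this, map_add, map_add, hq]; simp
    · simp)
  exact hk _ c hb (Or.inr (by rw [der_mul, der_mul, C.E_y]; ring)) hc

theorem torsionFree_end : IsAddTorsionFree (Module.End K A) := by
  constructor
  intro n hn f g h
  have h' : n • f = n • g := h
  have h2 : (n : K) • f = (n : K) • g := by
    rw [Nat.cast_smul_eq_nsmul, Nat.cast_smul_eq_nsmul, h']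
  exact (smul_right_injective _ (by exact_mod_cast hn : (n : K) ≠ 0)) h2

theorem comm_ad {d : A →ₗ[K] A} (hd : C.IsDer d) {u : A} (hu : d u = 0) :
    Commute (d : Module.End K A) (C.ad u) := by
  ext v
  change d (C.br u v) = C.br u (d v)
  rw [hd, hu, zero_br, zero_add]

theorem heis_app {d : A →ₗ[K] A} (hd : C.IsDer d) (h1 : d 1 = 0) (hy : ∀ q, d (C.y q) = 0)
    (hk : Kill C d) (s : J) (a : A) :
    C.D0 (C.D0 (C.D0 (C.D0 (d (C.y s * a) - C.y s * d a)))) = 0 := by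
  haveI := torsionFree_end (K := K) (A := A)
  let Y : Module.End K A := LinearMap.mulLeft K (C.y s)
  let Z : Module.End K A := LinearMap.mulLeft K (C.y (C.bar s))
  let w : Module.End K A := (C.ε s : Module.End K A)
  let p : Module.End K A := w * (C.D (C.bar s)).toLinearMap
  let q : Module.End K A := - (w * (C.D s).toLinearMap)
  let c : Module.End K A := C.D0.toLinearMap
  have aw : ∀ v, w v = C.ε s * v := fun v => by
    change (C.ε s : Module.End K A) v = _
    rw [Module.End.intCast_apply, zsmul_eq_mul]
  have aY : ∀ v, Y v = C.y s * v := fun v => rfl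
  have aZ : ∀ v, Z v = C.y (C.bar s) * v := fun v => rfl
  have ap : ∀ v, p v = C.ε s * C.D (C.bar s) v := fun v => aw _
  have aq : ∀ v, q v = - (C.ε s * C.D s v) := fun v => congrArg Neg.neg (aw _)
  have ac : ∀ v, c v = C.D0 v := fun v => rfl
  have hne : C.bar s ≠ s := fun h => by
    have h1 := C.ε_bar s
    have h2 := C.ε_sq s
    rw [h] at h1
    have : C.ε s = 0 := by omega
    rw [this] at h2; norm_num at h2
  have y1 : C.D s (C.y s) = 1 := by rw [C.D_y, if_pos rfl]
  have y2 : C.D (C.bar s) (C.y (C.bar s)) = 1 := by rw [C.D_y, if_pos rfl]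
  have y3 : C.D (C.bar s) (C.y s) = 0 := by rw [C.D_y, if_neg hne]
  have y4 : C.D s (C.y (C.bar s)) = 0 := by rw [C.D_y, if_neg (Ne.symm hne)]
  have H := heis (R := Module.End K A) d Y Z p q c w
    (by ext v; exact (hd.comm_D0 h1 v).symm)
    (by ext v; simp only [Module.End.mul_apply, aY, ac, der_mul, C.D0_y]; ring)
    (by ext v; simp only [Module.End.mul_apply, aZ, ac, der_mul, C.D0_y]; ring)
    (by ext v; simp only [Module.End.mul_apply, ap, ac, lin_int', C.D0_D])
    (by ext v; simp only [Module.End.mul_apply, aq, ac, map_neg, lin_int', C.D0_D])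
    (by ext v; simp only [Module.End.mul_apply, aw, ac, lin_int'])
    (by ext v; simp only [Module.End.mul_apply, aw, lin_int])
    (by ext v; simp only [Module.End.mul_apply, aw, aY]; ring)
    (by ext v; simp only [Module.End.mul_apply, aw, aZ]; ring)
    (by ext v; simp only [Module.End.mul_apply, aw, ap, lin_int'])
    (by ext v; simp only [Module.End.mul_apply, aw, aq, lin_int']; ring)
    (by ext v; simp only [Module.End.mul_apply, aw, Module.End.one_apply]
        linear_combination v * C.ε_sqA s)
    (by ext v; simp only [Module.End.mul_apply, aY, aZ]; ring)
    (by ext v; simp only [Module.End.mul_apply, ap, aq, lin_int', map_neg]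
        rw [C.D_comm]; ring)
    (by ext v; simp only [Module.End.mul_apply, ap, aY, der_mul, y3]; ring)
    (by ext v; simp only [Module.End.mul_apply, aq, aZ, der_mul, y4]; ring)
    (by ext v; simp only [Module.End.mul_apply, LinearMap.add_apply, aw, ap, aZ, der_mul, y2]; ring)
    (by ext v; simp only [Module.End.mul_apply, LinearMap.sub_apply, aw, aq, aY, der_mul, y1]; ring)
    (by
      have : p + Y * c = C.ad (C.y s) := by
        ext v
        simp only [Module.End.mul_apply, LinearMap.add_apply, ap, aY, ac, ad_apply, br_y]
      rw [this]; exact comm_ad hd (hy s))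
    (by
      have : q + Z * c = C.ad (C.y (C.bar s)) := by
        ext v
        simp only [Module.End.mul_apply, LinearMap.add_apply, aq, aZ, ac, ad_apply, br_y, C.bar_bar,
          C.ε_bar]
        push_cast; ring
      rw [this]; exact comm_ad hd (hy _))
    (by
      have h2 : 2 • (Y * p) = C.ad (C.y s * C.y s) := by
        rw [two_nsmul]
        ext v
        simp only [Module.End.mul_apply, LinearMap.add_apply, ap, aY, ad_apply, br, L, P_mul_left,
          P_y, der_mul, C.E_y, C.D0_y]
        ring
      have h3 := (comm_ad hd (d_quad hd h1 hy hk s s)).eq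
      rw [← h2, mul_smul_comm, smul_mul_assoc] at h3
      exact nsmul_right_injective two_ne_zero h3)
    (by
      have : Y * q + Z * p = C.ad (C.y s * C.y (C.bar s)) := by
        ext v
        simp only [Module.End.mul_apply, LinearMap.add_apply, ap, aq, aY, aZ, ad_apply, br, L,
          P_mul_left, P_y, der_mul, C.E_y, C.D0_y, C.bar_bar, C.ε_bar]
        push_cast; ring
      rw [this]; exact comm_ad hd (d_quad hd h1 hy hk _ _))
    (by
      have : 3 • (Y * Y * p) - Y * Y * Y * c = C.ad (C.y s * C.y s * C.y s) := by
        rw [show 3 • (Y * Y * p) = Y * Y * p + Y * Y * p + Y * Y * p by abel]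
        ext v
        simp only [Module.End.mul_apply, LinearMap.sub_apply, LinearMap.add_apply, ap, aY, ac,
          ad_apply, br, L, P_mul_left, P_y, der_mul, C.E_y, C.D0_y]
        ring
      rw [this]; exact comm_ad hd (d_cube hd h1 hy hk _))
  have := LinearMap.congr_fun H a
  simpa only [Module.End.mul_apply, LinearMap.sub_apply, aY, ac, LinearMap.zero_apply] using this

theorem comm_D_of {d : A →ₗ[K] A} (hd : C.IsDer d) (h1 : d 1 = 0) (hy : ∀ q, d (C.y q) = 0)
    (hY : ∀ q a, d (C.y q * C.D0 a) = C.y q * d (C.D0 a)) (q : J) (a : A) :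
    d (C.D q a) = C.D q (d a) := by
  have h := hd (C.y (C.bar q)) a
  rw [hy, zero_br, br_y, br_y, C.bar_bar, map_add, hY, hd.comm_D0 h1,
    lin_int, zero_add, C.ε_bar] at h
  push_cast at h
  linear_combination (-C.ε q : A) * h - (d (C.D q a) - C.D q (d a)) * C.ε_sqA q

theorem N_Y {τ : A} (hN : C.NCase τ) {d : A →ₗ[K] A} (hd : C.IsDer d) (h1 : d 1 = 0)
    (hτ : d τ = 0) (hy : ∀ q, d (C.y q) = 0) (q : J) (a : A) :
    d (C.y q * a) = C.y q * d a := by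
  obtain ⟨a1, rfl⟩ := hN.surj a
  obtain ⟨a2, rfl⟩ := hN.surj a1
  obtain ⟨a3, rfl⟩ := hN.surj a2
  obtain ⟨a4, rfl⟩ := hN.surj a3
  have h := heis_app hd h1 hy (N_kill hN hd hτ) q a4
  have c1 : ∀ v, C.D0 (d (C.y q * v) - C.y q * d v) =
      d (C.y q * C.D0 v) - C.y q * d (C.D0 v) := fun v => by
    rw [map_sub, ← hd.comm_D0 h1, der_mul, der_mul, C.D0_y, ← hd.comm_D0 h1]
    simp
  rw [c1, c1, c1, c1] at h
  exact sub_eq_zero.1 h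

theorem GCase.ker {e e' : A} (hG : C.GCase e e') {a : A} (h : C.D0 (C.D0 a) = 0) :
    C.D0 a = 0 := by
  have := hG.DS1 0 a (by push_cast; simp [h])
  simpa using this

theorem G_Y1 {e e' : A} (hG : C.GCase e e') {d : A →ₗ[K] A} (hd : C.IsDer d) (h1 : d 1 = 0)
    (he : d e = 0) (he' : d e' = 0) (hy : ∀ q, d (C.y q) = 0) (q : J) (a : A) :
    d (C.y q * C.D0 a) = C.y q * d (C.D0 a) := by
  have h := hG.ker (hG.ker (hG.ker (heis_app hd h1 hy (G_kill hG hd he he') q a)))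
  have c1 : ∀ v, C.D0 (d (C.y q * v) - C.y q * d v) =
      d (C.y q * C.D0 v) - C.y q * d (C.D0 v) := fun v => by
    rw [map_sub, ← hd.comm_D0 h1, der_mul, der_mul, C.D0_y, ← hd.comm_D0 h1]
    simp
  rw [c1] at h
  exact sub_eq_zero.1 h

theorem G_dp {e e' : A} (hG : C.GCase e e') (q0 : J) {d : A →ₗ[K] A} (hd : C.IsDer d)
    (h1 : d 1 = 0)
    (he : d e = 0) (he' : d e' = 0) (hy : ∀ q, d (C.y q) = 0) (b : A) (hb : C.D0 b = 0) :
    d b = e' * d (e * b) := by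
  have hY := G_Y1 hG hd h1 he he' hy
  have hD := comm_D_of hd h1 hy hY
  obtain ⟨dp, hdp⟩ : ∃ dp : A →ₗ[K] A, ∀ b, dp b = e' * d (e * b) :=
    ⟨LinearMap.mulLeft K e' ∘ₗ d ∘ₗ LinearMap.mulLeft K e, fun b => rfl⟩
  have hde : ∀ b, d (e * b) = e * dp b := fun b => by
    rw [hdp]; linear_combination (- d (e * b)) * hG.ee
  have D0e : ∀ b, C.D0 b = 0 → C.D0 (e * b) = e * b := fun b hb => by
    rw [der_mul, hb, hG.D0e]; ring
  have B1 : ∀ b, C.D0 b = 0 → C.D0 (dp b) = 0 := fun b hb => by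
    rw [hdp, der_mul, ← hd.comm_D0 h1, D0e b hb, hG.D0e']; ring
  have Bd : ∀ b, C.D0 b = 0 → C.D0 (d b) = 0 := fun b hb => by
    rw [← hd.comm_D0 h1, hb, map_zero]
  have BE : ∀ b, C.D0 b = 0 → C.D0 (C.E b) = 0 := fun b hb => by rw [C.D0_E, hb, map_zero]
  have py : ∀ q b, C.D0 b = 0 → dp (C.y q * b) = C.y q * dp b := fun q b hb => by
    have := hY q (e * b)
    rw [D0e b hb] at this
    rw [hdp, hdp]
    have e1 : e * (C.y q * b) = C.y q * (e * b) := by ring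
    rw [e1, this]; ring
  have pD : ∀ q b, C.D q (dp b) = dp (C.D q b) := fun q b => by
    rw [hdp, hdp, der_mul, hG.De', ← hD, der_mul, hG.De]; simp
  have A1 : ∀ b, C.D0 b = 0 → dp (C.L b) = C.L (d b) := fun b hb => by
    have h := hd e b
    rw [he, zero_br, hG.br_e hb, hG.br_e (Bd b hb), map_neg, hde, zero_add] at h
    have := hG.canc (a := dp (C.L b) - C.L (d b)) (by linear_combination -h)
    exact sub_eq_zero.1 this
  have A2 : ∀ b, C.D0 b = 0 → d (4 * b - C.E b) = 4 * dp b - C.E (dp b) := fun b hb => by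
    have h := hd e' (e * b)
    rw [he', zero_br, hG.br_e'e hb, hde, hG.br_e'e (B1 b hb), zero_add] at h
    exact h
  have l4 : ∀ a, dp (4 * a) = 4 * dp a := fun a => by exact_mod_cast lin_int dp 4 a
  have l5 : ∀ a, dp (5 * a) = 5 * dp a := fun a => by exact_mod_cast lin_int dp 5 a
  have l6 : ∀ a, dp (6 * a) = 6 * dp a := fun a => by exact_mod_cast lin_int dp 6 a
  have l8 : ∀ a, dp (8 * a) = 8 * dp a := fun a => by exact_mod_cast lin_int dp 8 a
  have e4 : ∀ a, C.E (4 * a) = 4 * C.E a := fun a => by exact_mod_cast lin_int' C.E 4 a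
  have A3 : ∀ b, C.D0 b = 0 → 8 * dp b - 6 * dp (C.E b) + dp (C.E (C.E b)) =
      8 * dp b - 6 * C.E (dp b) + C.E (C.E (dp b)) := fun b hb => by
    have h4 : C.D0 (4 * b - C.E b) = 0 := by
      have : C.D0 (4 * b) = 4 * C.D0 b := by exact_mod_cast lin_int' C.D0 4 b
      rw [map_sub, BE b hb, this, hb]; ring
    have h := A1 _ h4
    rw [A2 b hb] at h
    unfold L at h
    simp only [map_sub, e4, lin_two, l4] at h
    linear_combination h
  have A4 : ∀ b, C.D0 b = 0 → dp (C.E b) = C.E (dp b) := fun b hb => by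
    have h := A3 (C.y q0 * b) (by rw [der_mul, hb, C.D0_y]; ring)
    simp only [der_mul, C.E_y, map_add, py q0 b hb, py q0 _ (BE b hb),
      py q0 _ (BE _ (BE b hb))] at h
    have h3 := A3 b hb
    have : ((2 : ℤ) : A) * (dp (C.E b) - C.E (dp b)) = 0 := C.y_inj q0 _ (by
      push_cast; linear_combination h - C.y q0 * h3)
    exact sub_eq_zero.1 (cz (K := K) 2 two_ne_zero _ this)
  have A5 : ∀ b, C.D0 b = 0 → C.E (d b - dp b) = 2 * (d b - dp b) := fun b hb => by
    have h := A1 b hb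
    unfold L at h
    rw [map_sub, lin_two, A4 b hb] at h
    rw [map_sub]; linear_combination h
  have A6 : ∀ q, C.D q (d b - dp b) = 0 := fun q => by
    have hb' : C.D0 (C.D q b) = 0 := by rw [C.D0_D, hb, map_zero]
    have h1 := A5 _ hb'
    rw [hD, ← pD, ← map_sub, C.E_D, A5 b hb, lin_two'] at h1
    linear_combination -h1
  obtain ⟨c, hc⟩ := C.const _ (by rw [map_sub, Bd b hb, B1 b hb, sub_zero]) A6
  have h5 := A5 b hb
  rw [hc] at h5
  have := C.alg_wt c 2 two_ne_zero (by exact_mod_cast h5)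
  rw [this, hdp] at hc
  exact sub_eq_zero.1 hc

theorem G_Y {e e' : A} (hG : C.GCase e e') {d : A →ₗ[K] A} (hd : C.IsDer d) (h1 : d 1 = 0)
    (he : d e = 0) (he' : d e' = 0) (hy : ∀ q, d (C.y q) = 0) (q : J) (a : A) :
    d (C.y q * a) = C.y q * d a := by
  have hY := G_Y1 hG hd h1 he he' hy
  obtain ⟨s, hs⟩ := hG.DS2 a
  have hB : ∀ b, C.D0 b = 0 → d (C.y q * b) = C.y q * d b := fun b hb => by
    rw [G_dp hG q hd h1 he he' hy b hb, G_dp hG q hd h1 he he' hy (C.y q * b)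
      (by rw [der_mul, hb, C.D0_y]; ring)]
    have := hY q (e * b)
    have e1 : C.D0 (e * b) = e * b := by rw [der_mul, hb, hG.D0e]; ring
    rw [e1] at this
    have e2 : e * (C.y q * b) = C.y q * (e * b) := by ring
    rw [e2, this]; ring
  have ea : a = (a - C.D0 s) + C.D0 s := by ring
  rw [ea, mul_add, map_add, map_add, hB _ hs, hY]; ring

theorem good_D0 {d : A →ₗ[K] A} (hd : C.IsDer d) (h1 : d 1 = 0) (hy : ∀ q, d (C.y q) = 0)
    (hY : ∀ q a, d (C.y q * a) = C.y q * d a) (s : J) (u w : A) :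
    d (C.D0 u * w) = C.D0 u * d w + w * d (C.D0 u) := by
  have hD := comm_D_of hd h1 hy (fun q a => hY q _)
  have T : ∀ s u, d ((C.ε s * C.D (C.bar s) u - C.y s * C.D0 u) * w) =
      (C.ε s * C.D (C.bar s) u - C.y s * C.D0 u) * d w +
        w * d (C.ε s * C.D (C.bar s) u - C.y s * C.D0 u) := by
    intro s u
    have X : ∀ u, C.br u (C.y s) = - (C.ε s * C.D (C.bar s) u + C.y s * C.D0 u) := fun u => by
      rw [C.br_anti, br_y]
    have h := hd u (C.y s * w)
    rw [hY, br_mul, br_mul, br_mul, X, X] at h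
    have e1 : -(C.ε s * C.D (C.bar s) u + C.y s * C.D0 u) * w + C.y s * C.br u w
        + 2 * C.D0 u * C.y s * w = - (C.ε s * (C.D (C.bar s) u * w)) + C.y s * (C.D0 u * w)
        + C.y s * C.br u w := by ring
    rw [e1, map_add, map_add, map_neg, lin_int, hY, hY, hd u w] at h
    have e2 : (C.ε s * C.D (C.bar s) u - C.y s * C.D0 u) * w =
      C.ε s * (C.D (C.bar s) u * w) - C.y s * (C.D0 u * w) := by ring
    rw [e2, map_sub, map_sub, lin_int, lin_int, hY, hY, hD, hd.comm_D0 h1]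
    linear_combination -h
  have hne : C.bar s ≠ s := fun h => by
    have h1 := C.ε_bar s
    have h2 := C.ε_sq s
    rw [h] at h1
    have : C.ε s = 0 := by omega
    rw [this] at h2; norm_num at h2
  have y1 : C.D s (C.y s) = 1 := by rw [C.D_y, if_pos rfl]
  have y2 : C.D (C.bar s) (C.y (C.bar s)) = 1 := by rw [C.D_y, if_pos rfl]
  have t1 := T s (C.ε (C.bar s) * C.D (C.bar (C.bar s)) u - C.y (C.bar s) * C.D0 u)
  have t2 := T (C.bar s) (C.ε s * C.D (C.bar s) u - C.y s * C.D0 u)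
  have hc : (C.ε s * C.D (C.bar s) (C.ε (C.bar s) * C.D (C.bar (C.bar s)) u
      - C.y (C.bar s) * C.D0 u) -
      C.y s * C.D0 (C.ε (C.bar s) * C.D (C.bar (C.bar s)) u - C.y (C.bar s) * C.D0 u)) =
      (C.ε (C.bar s) * C.D (C.bar (C.bar s)) (C.ε s * C.D (C.bar s) u - C.y s * C.D0 u) -
      C.y (C.bar s) * C.D0 (C.ε s * C.D (C.bar s) u - C.y s * C.D0 u)) -
      ((2 * C.ε s : ℤ) : A) * C.D0 u := by
    simp only [C.bar_bar, C.ε_bar, map_sub, lin_int', der_mul, C.D0_y, y1, y2, C.D0_D,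
      C.D_comm (C.bar s) s, Derivation.map_intCast]
    push_cast; ring
  rw [hc] at t1
  generalize (C.ε (C.bar s) * C.D (C.bar (C.bar s)) (C.ε s * C.D (C.bar s) u - C.y s * C.D0 u) -
      C.y (C.bar s) * C.D0 (C.ε s * C.D (C.bar s) u - C.y s * C.D0 u)) = Q at t1 t2
  rw [ sub_mul, map_sub, map_sub, t2, mul_assoc, lin_int, lin_int] at t1
  have t3 : ((2 : ℤ) : A) * (d (C.D0 u * w) - (C.D0 u * d w + w * d (C.D0 u))) = 0 := by
    push_cast at t1 ⊢
    linear_combination (- C.ε s : A) * t1 -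
      2 * (d (C.D0 u * w) - (C.D0 u * d w + w * d (C.D0 u))) * C.ε_sqA s
  exact sub_eq_zero.1 (cz (K := K) 2 two_ne_zero _ t3)

theorem N_main {τ : A} (hN : C.NCase τ) (q0 : J) {d : A →ₗ[K] A} (hd : C.IsDer d) :
    ∃ (u : A) (δ : Derivation K A A), (∀ v, d v = δ v + C.br u v) ∧
      (∀ q a, δ (C.D q a) = C.D q (δ a)) ∧ (∀ a, δ (C.D0 a) = C.D0 (δ a)) ∧
      (∀ q, δ (C.y q) = 0) ∧ δ τ = 0 := by
  obtain ⟨u, hd', h1, hτ, hy⟩ := N_norm hN hd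
  have hY := N_Y hN hd' h1 hτ hy
  refine ⟨u, Derivation.mk' (d - C.ad u) (fun a b => ?_), fun v => ?_, fun q a => ?_, fun a => ?_,
    fun q => hy q, hτ⟩
  · obtain ⟨a', rfl⟩ := hN.surj a
    exact good_D0 hd' h1 hy hY q0 a' b
  · change d v = d v - C.br u v + C.br u v
    ring
  · exact comm_D_of hd' h1 hy (fun q a => hY q _) q a
  · exact hd'.comm_D0 h1 a

theorem G_main {e e' : A} (hG : C.GCase e e') (q0 : J) {d : A →ₗ[K] A} (hd : C.IsDer d) :
    ∃ (u : A) (δ : Derivation K A A), (∀ v, d v = δ v + C.br u v) ∧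
      (∀ q a, δ (C.D q a) = C.D q (δ a)) ∧ (∀ a, δ (C.D0 a) = C.D0 (δ a)) ∧
      (∀ q, δ (C.y q) = 0) := by
  obtain ⟨u, hd', h1, he, he', hy⟩ := G_norm hG q0 hd
  have hY := G_Y hG hd' h1 he he' hy
  refine ⟨u, Derivation.mk' (d - C.ad u) (fun a b => ?_), fun v => ?_, fun q a => ?_, fun a => ?_,
    fun q => hy q⟩
  · set f := d - C.ad u
    have hgood := good_D0 hd' h1 hy hY q0
    have g0 : ∀ b w, C.D0 b = 0 → f (b * w) = b * f w + w * f b := by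
      intro b w hb
      have e1 : C.D0 (e * b) = e * b := by rw [der_mul, hb, hG.D0e]; ring
      have ge := hgood (e * b)
      rw [e1] at ge
      have ge' := hgood (- e')
      rw [map_neg, hG.D0e', neg_neg] at ge'
      have eb : b = e' * (e * b) := by linear_combination (- b) * hG.ee
      have i1 : f (b * w) = e' * (f (e * b * w)) + (e * b * w) * f e' := by
        rw [← ge']; congr 1; linear_combination (- b * w) * hG.ee
      have i2 : f b = e' * (f (e * b)) + (e * b) * f e' := by
        rw [← ge']; congr 1
      rw [i1, ge, i2]; linear_combination (b * f w) * hG.ee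
    obtain ⟨s, hs⟩ := hG.DS2 a
    have ea : a = (a - C.D0 s) + C.D0 s := by ring
    rw [smul_eq_mul, smul_eq_mul]
    have i1 : f (a * b) = f ((a - C.D0 s) * b) + f (C.D0 s * b) := by
      rw [← map_add]; congr 1; ring
    rw [i1, g0 _ _ hs, hgood, map_sub]; ring
  · change d v = d v - C.br u v + C.br u v
    ring
  · exact comm_D_of hd' h1 hy (fun q a => hY q _) q a
  · exact hd'.comm_D0 h1 a

end Assoc
end CData

namespace MonAlg
noncomputable section Gen

variable {k M : Type*} [Field k] [AddCommMonoid M]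

/-- basis monomials -/
def b (k : Type*) [Field k] {M : Type*} [AddCommMonoid M] (m : M) : AddMonoidAlgebra k M :=
  AddMonoidAlgebra.single m 1

theorem b_add (m n : M) : b k (m + n) = b k m * b k n := by
  unfold b; rw [AddMonoidAlgebra.single_mul_single, one_mul]

theorem b_zero : b k (0 : M) = 1 := rfl

@[elab_as_elim]
theorem b_ind {p : AddMonoidAlgebra k M → Prop} (x : AddMonoidAlgebra k M) (h0 : p 0)
    (ha : ∀ x y, p x → p y → p (x + y)) (hb : ∀ (c : k) m, p (c • b k m)) : p x := by
  refine AddMonoidAlgebra.induction_linear x h0 ha (fun m r => ?_)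
  have := hb r m
  unfold b at this
  rwa [AddMonoidAlgebra.smul_single, smul_eq_mul, mul_one] at this

theorem lext {V : Type*} [AddCommGroup V] [Module k V] {f g : AddMonoidAlgebra k M →ₗ[k] V}
    (h : ∀ m, f (b k m) = g (b k m)) : f = g := by
  refine LinearMap.ext fun x => ?_
  refine b_ind x (by simp) (fun x y hx hy => by simp [hx, hy]) (fun c m => by simp [h])

theorem lext_app {V : Type*} [AddCommGroup V] [Module k V] (f g : AddMonoidAlgebra k M →ₗ[k] V)
    (h : ∀ m, f (b k m) = g (b k m)) (x : AddMonoidAlgebra k M) : f x = g x := by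
  rw [lext h]

/-- linear extension -/
def lc {V : Type*} [AddCommGroup V] [Module k V] (T : M → V) : AddMonoidAlgebra k M →ₗ[k] V :=
  (Finsupp.linearCombination k T) ∘ₗ (AddMonoidAlgebra.coeffLinearEquiv k).toLinearMap

theorem lc_b {V : Type*} [AddCommGroup V] [Module k V] (T : M → V) (m : M) :
    lc T (b k m) = T m := by
  change Finsupp.linearCombination k T (Finsupp.single m 1) = _
  simp

/-- build a derivation -/
def mkDer (T : M → AddMonoidAlgebra k M)
    (h : ∀ m n, T (m + n) = b k m * T n + b k n * T m) :
    Derivation k (AddMonoidAlgebra k M) (AddMonoidAlgebra k M) :=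
  Derivation.mk' (lc T) (by
    intro x y
    refine b_ind x (by simp) (fun x x' hx hx' => ?_) (fun c m => ?_)
    · simp only [add_mul, map_add, hx, hx', smul_eq_mul, mul_add]; ring
    · refine b_ind y (by simp) (fun y y' hy hy' => ?_) (fun c' n => ?_)
      · simp only [add_mul, map_add, hy, hy', smul_eq_mul, mul_add]; ring
      · simp only [smul_mul_assoc, mul_smul_comm, map_smul, ← b_add, lc_b, h, smul_eq_mul]
        simp only [Algebra.smul_def]; ring)

theorem mkDer_b (T : M → AddMonoidAlgebra k M) (h) (m : M) : mkDer T h (b k m) = T m :=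
  lc_b T m

theorem der_ext {D D' : Derivation k (AddMonoidAlgebra k M) (AddMonoidAlgebra k M)}
    (h : ∀ m, D (b k m) = D' (b k m)) (x : AddMonoidAlgebra k M) : D x = D' x :=
  lext_app D.toLinearMap D'.toLinearMap h x

/-- diagonal operator -/
def diag (f : M → k) : AddMonoidAlgebra k M →ₗ[k] AddMonoidAlgebra k M :=
  lc fun m => f m • b k m

theorem diag_b (f : M → k) (m : M) : diag f (b k m) = f m • b k m := lc_b _ m

theorem diag_diag (f g : M → k) (x : AddMonoidAlgebra k M) :
    diag f (diag g x) = diag (fun m => f m * g m) x := by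
  refine lext_app (diag f ∘ₗ diag g) _ (fun m => ?_) x
  simp only [LinearMap.comp_apply, diag_b, map_smul, smul_smul]
  rw [mul_comm]

theorem diag_coeff (f : M → k) (x : AddMonoidAlgebra k M) (m : M) :
    (diag f x).coeff m = f m * x.coeff m := by
  classical
  refine b_ind x (by simp) (fun x y hx hy => ?_) (fun c n => ?_)
  · rw [map_add, AddMonoidAlgebra.coeff_add, Finsupp.add_apply, hx, hy,
      AddMonoidAlgebra.coeff_add, Finsupp.add_apply]; ring
  · rw [map_smul, diag_b]
    unfold b
    simp only [AddMonoidAlgebra.coeff_smul, Finsupp.smul_apply, AddMonoidAlgebra.coeff_single,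
      smul_eq_mul, Finsupp.single_apply]
    split_ifs with h
    · subst h; ring
    · simp

theorem b_ne (m : M) : b k m ≠ 0 := by
  intro h
  have := congrArg (fun x => AddMonoidAlgebra.coeff x m) h
  simp [b] at this

theorem smul_b_inj {c c' : k} (m : M) (h : c • b k m = c' • b k m) : c = c' := by
  have := congrArg (fun x => AddMonoidAlgebra.coeff x m) h
  simpa [b] using this

/-- diagonal kernel is semisimple -/
theorem diag_ss (f : M → k) (x : AddMonoidAlgebra k M) (h : diag f (diag f x) = 0) :
    diag f x = 0 := by
  have h2 : diag (fun m => (f m)⁻¹) (diag f (diag f x)) = 0 := by rw [h, map_zero]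
  rw [diag_diag f f, diag_diag] at h2
  have e : (fun m => (f m)⁻¹ * (f m * f m)) = f := by
    ext m
    by_cases hf : f m = 0
    · simp [hf]
    · field_simp
  rwa [e] at h2

theorem diag_ss_pow (f : M → k) (n : ℕ) (x : AddMonoidAlgebra k M) (h : (diag f ^ n) x = 0) :
    diag f x = 0 := by
  induction n with
  | zero => have : x = 0 := h
            rw [this, map_zero]
  | succ n ih =>
    cases n with
    | zero => simpa using h
    | succ n =>
      refine ih ?_
      rw [pow_succ', Module.End.mul_apply]
      refine diag_ss f _ ?_
      rw [pow_succ', pow_succ'] at h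
      exact h

theorem loc_nil (T : Module.End k (AddMonoidAlgebra k M)) (deg : M → ℕ)
    (h : ∀ m, ∀ S : Submodule k (AddMonoidAlgebra k M),
      (∀ n, deg n < deg m → b k n ∈ S) → T (b k m) ∈ S) (x : AddMonoidAlgebra k M) :
    ∃ n : ℕ, (T ^ n) x = 0 := by
  have key : ∀ N m, deg m < N → (T ^ N) (b k m) = 0 := by
    intro N
    induction N with
    | zero => intro m hm; omega
    | succ N ih =>
      intro m hm
      rw [pow_succ, Module.End.mul_apply]
      exact h m (LinearMap.ker (T ^ N)) (fun n hn => LinearMap.mem_ker.2 (ih n (by omega)))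
  refine b_ind x ⟨0, by simp⟩ ?_ ?_
  · rintro x y ⟨n, hn⟩ ⟨n', hn'⟩
    refine ⟨n + n', ?_⟩
    have e1 : (T ^ (n + n')) x = 0 := by
      rw [add_comm, pow_add, Module.End.mul_apply, hn, map_zero]
    have e2 : (T ^ (n + n')) y = 0 := by
      rw [pow_add, Module.End.mul_apply, hn', map_zero]
    rw [map_add, e1, e2, add_zero]
  · intro c m
    exact ⟨deg m + 1, by rw [map_smul, key _ m (by omega), smul_zero]⟩

theorem b_mul_inj [IsCancelAdd M] (m : M) (x : AddMonoidAlgebra k M) (h : b k m * x = 0) :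
    x = 0 := by
  ext n
  have := congrArg (fun x => AddMonoidAlgebra.coeff x (m + n)) h
  simpa [b] using this

theorem alg_eq (c : k) : algebraMap k (AddMonoidAlgebra k M) c = c • b k 0 := by
  rw [b_zero, Algebra.algebraMap_eq_smul_one]

theorem eq_const (x : AddMonoidAlgebra k M) (h : ∀ m, m ≠ 0 → x.coeff m = 0) :
    ∃ c : k, x = algebraMap k (AddMonoidAlgebra k M) c := by
  classical
  refine ⟨x.coeff 0, ?_⟩
  rw [alg_eq]
  ext m
  by_cases hm : m = 0
  · subst hm; simp [b]
  · rw [h m hm]; simp [b, Finsupp.single_apply, Ne.symm hm]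

end Gen
end MonAlg

namespace Conc
noncomputable section Idx
open MonAlg

theorem iot_facts (l : ℕ → ℕ) : iot l 0 = 0 ∧ iot l 0 ≤ iot l 1 ∧ iot l 1 ≤ iot l 2 ∧
    iot l 2 ≤ iot l 3 ∧ iot l 3 ≤ iot l 4 ∧ iot l 4 ≤ iot l 5 ∧ iot l 5 ≤ iot l 6 := by
  have : ∀ i, iot l i ≤ iot l (i + 1) := fun i =>
    Finset.sum_le_sum_of_subset (Finset.Icc_subset_Icc le_rfl (Nat.le_succ i))
  exact ⟨rfl, this 0, this 1, this 2, this 3, this 4, this 5⟩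

theorem mem_iSet {l : ℕ → ℕ} {i j q : ℕ} :
    q ∈ iSet l i j ↔ iot l (i - 1) + 1 ≤ q ∧ q ≤ iot l j := Finset.mem_Icc

theorem mem_barSet {l : ℕ → ℕ} {i j q : ℕ} (hj : iot l j ≤ iot l 6) :
    q ∈ barSet l (iSet l i j) ↔
      iot l (i - 1) + 1 + iot l 6 ≤ q ∧ q ≤ iot l j + iot l 6 := by
  unfold barSet
  rw [Finset.mem_image]
  constructor
  · rintro ⟨p, hp, rfl⟩
    rw [mem_iSet] at hp
    unfold bar
    rw [if_pos (by omega)]; omega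
  · intro h
    refine ⟨q - iot l 6, mem_iSet.2 (by omega), ?_⟩
    unfold bar
    rw [if_pos (by omega)]; omega

/-- group-like indices -/
def grp (l : ℕ → ℕ) : Finset ℕ := jSet l 1 3 ∪ iSet l 4 5
/-- polynomial indices -/
def pur (l : ℕ → ℕ) : Finset ℕ := iSet l 6 6 ∪ barSet l (iSet l 4 6)
/-- indices without a polynomial variable -/
def bad (l : ℕ → ℕ) : Finset ℕ := iSet l 1 2 ∪ iSet l 4 4 ∪ barSet l (iSet l 1 1)
/-- indices with both -/
def mix (l : ℕ → ℕ) : Finset ℕ := barSet l (iSet l 2 2) ∪ jSet l 3 3 ∪ iSet l 5 5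

theorem mem_grp {l : ℕ → ℕ} {q : ℕ} : q ∈ grp l ↔
    (1 ≤ q ∧ q ≤ iot l 5) ∨ (1 + iot l 6 ≤ q ∧ q ≤ iot l 3 + iot l 6) := by
  have := iot_facts l
  unfold grp jSet
  rw [Finset.mem_union, Finset.mem_union, mem_barSet (by omega), mem_iSet, mem_iSet]
  simp only [Nat.reduceSub]
  omega

theorem mem_pur {l : ℕ → ℕ} {q : ℕ} : q ∈ pur l ↔
    (iot l 5 + 1 ≤ q ∧ q ≤ iot l 6) ∨ (iot l 3 + 1 + iot l 6 ≤ q ∧ q ≤ 2 * iot l 6) := by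
  have := iot_facts l
  unfold pur
  rw [Finset.mem_union, mem_barSet (by omega), mem_iSet]
  simp only [Nat.reduceSub]
  omega

theorem mem_bad {l : ℕ → ℕ} {q : ℕ} : q ∈ bad l ↔
    (1 ≤ q ∧ q ≤ iot l 2) ∨ (iot l 3 + 1 ≤ q ∧ q ≤ iot l 4) ∨
      (1 + iot l 6 ≤ q ∧ q ≤ iot l 1 + iot l 6) := by
  have := iot_facts l
  unfold bad
  rw [Finset.mem_union, Finset.mem_union, mem_barSet (by omega), mem_iSet, mem_iSet]
  simp only [Nat.reduceSub]
  omega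

theorem mem_mix {l : ℕ → ℕ} {q : ℕ} : q ∈ mix l ↔
    (iot l 1 + 1 + iot l 6 ≤ q ∧ q ≤ iot l 3 + iot l 6) ∨ (iot l 2 + 1 ≤ q ∧ q ≤ iot l 3) ∨
      (iot l 4 + 1 ≤ q ∧ q ≤ iot l 5) := by
  have := iot_facts l
  unfold mix jSet
  rw [Finset.mem_union, Finset.mem_union, Finset.mem_union, mem_barSet (by omega),
    mem_barSet (by omega), mem_iSet, mem_iSet]
  simp only [Nat.reduceSub]
  omega

/-- indices carrying a polynomial variable -/
def tok (l : ℕ → ℕ) (jz : Bool) (p : ℕ) : Prop :=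
  (p = 0 → jz = true) ∧ (1 ≤ p → ¬ (p ∈ bad l ∨ 2 * iot l 6 < p))

theorem mem_jIdx {l : ℕ → ℕ} {jz : Bool} {i : ℕ → ℕ} :
    i ∈ jIdx l jz ↔ ∀ p, ¬ tok l jz p → i p = 0 := by
  unfold tok
  constructor
  · rintro ⟨h0, h1⟩ p hp
    by_cases hp0 : p = 0
    · subst hp0
      refine h0 ?_
      by_contra h
      exact hp ⟨fun _ => by simpa using h, by omega⟩
    · refine h1 p (by omega) ?_
      by_contra h
      exact hp ⟨fun h' => absurd h' hp0, fun _ => h⟩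
  · intro h
    refine ⟨fun hj => h 0 (fun h' => ?_), fun p hp hb => h p (fun h' => h'.2 hp hb)⟩
    have := h'.1 rfl
    rw [hj] at this; simp at this

/-- the additive monoid of polynomial exponents -/
def Jsub (l : ℕ → ℕ) (jz : Bool) : AddSubmonoid (ℕ → ℕ) where
  carrier := jIdx l jz
  add_mem' := by
    intro a c ha hc
    rw [mem_jIdx] at *
    intro p hp
    rw [Pi.add_apply, ha p hp, hc p hp]
  zero_mem' := by
    rw [mem_jIdx]; intro p hp; rfl

theorem mem_Jsub {l : ℕ → ℕ} {jz : Bool} {i : ℕ → ℕ} :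
    i ∈ Jsub l jz ↔ ∀ p, ¬ tok l jz p → i p = 0 := mem_jIdx

/-- lowering an exponent -/
def dec {l : ℕ → ℕ} {jz : Bool} (p : ℕ) (i : Jsub l jz) : Jsub l jz :=
  ⟨i.1 - Pi.single p 1, mem_Jsub.2 fun q hq => by
    rw [Pi.sub_apply, mem_Jsub.1 i.2 q hq, Nat.zero_sub]⟩

theorem dec_same {l : ℕ → ℕ} {jz : Bool} (p : ℕ) (i : Jsub l jz) : (dec p i).1 p = i.1 p - 1 := by
  simp [dec]

theorem dec_ne {l : ℕ → ℕ} {jz : Bool} {p q : ℕ} (h : q ≠ p) (i : Jsub l jz) :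
    (dec p i).1 q = i.1 q := by
  simp [dec, h]

theorem dec_le {l : ℕ → ℕ} {jz : Bool} {p q : ℕ} (i : Jsub l jz) :
    (dec p i).1 q ≤ i.1 q := by
  simp [dec]

theorem dec_comm {l : ℕ → ℕ} {jz : Bool} (p q : ℕ) (i : Jsub l jz) :
    dec p (dec q i) = dec q (dec p i) := by
  apply Subtype.ext
  simp only [dec]
  rw [tsub_right_comm]

theorem dec_add {l : ℕ → ℕ} {jz : Bool} {p : ℕ} {i : Jsub l jz} (h : i.1 p ≠ 0) (j : Jsub l jz) :
    dec p (i + j) = dec p i + j := by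
  apply Subtype.ext
  funext q
  by_cases hq : q = p
  · subst hq
    rw [dec_same]
    change i.1 q + j.1 q - 1 = (dec q i).1 q + j.1 q
    rw [dec_same]; omega
  · rw [dec_ne hq]
    change i.1 q + j.1 q = (dec p i).1 q + j.1 q
    rw [dec_ne hq]

/-- unit polynomial exponent -/
def ee (l : ℕ → ℕ) (jz : Bool) (p : ℕ) : Jsub l jz :=
  @dite _ (tok l jz p) (Classical.dec _) (fun h => ⟨Pi.single p 1, mem_Jsub.2 fun q hq => by
    have : q ≠ p := fun e => hq (e ▸ h)
    simp [this]⟩) (fun _ => 0)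

theorem ee_val {l : ℕ → ℕ} {jz : Bool} {p : ℕ} (h : tok l jz p) :
    (ee l jz p).1 = Pi.single p 1 := by
  unfold ee; rw [dif_pos h]

theorem ee_dec {l : ℕ → ℕ} {jz : Bool} {p : ℕ} (i : Jsub l jz) (h : i.1 p ≠ 0) :
    ee l jz p + dec p i = i := by
  have ht : tok l jz p := by
    by_contra hn
    exact h (mem_Jsub.1 i.2 p hn)
  apply Subtype.ext
  funext q
  change (ee l jz p).1 q + (dec p i).1 q = i.1 q
  rw [ee_val ht]
  by_cases hq : q = p
  · subst hq; rw [dec_same]; simp; omega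
  · rw [dec_ne hq]; simp [hq]

theorem dec_ee {l : ℕ → ℕ} {jz : Bool} {p : ℕ} (h : tok l jz p) : dec p (ee l jz p) = 0 := by
  apply Subtype.ext
  simp only [dec, ee_val h]
  rw [tsub_self]; rfl

end Idx

noncomputable section Ops
open MonAlg

variable {k : Type*} [Field k] {l : ℕ → ℕ} {G : AddSubgroup (ℕ → k)} {jz : Bool}

/-- exponents -/
abbrev MM (l : ℕ → ℕ) (G : AddSubgroup (ℕ → k)) (jz : Bool) := ↥G × ↥(Jsub l jz)

/-- the algebra -/
abbrev RR (l : ℕ → ℕ) (G : AddSubgroup (ℕ → k)) (jz : Bool) := AddMonoidAlgebra k (MM l G jz)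

theorem fst_add_app (m n : MM l G jz) (p : ℕ) : (m + n).1.1 p = m.1.1 p + n.1.1 p := rfl
theorem snd_add_app (m n : MM l G jz) (p : ℕ) : (m + n).2.1 p = m.2.1 p + n.2.1 p := rfl

instance : IsCancelAdd (Jsub l jz) := inferInstance
instance : IsCancelAdd (MM l G jz) := inferInstance

/-- additive diagonal derivation -/
def dg (f : MM l G jz →+ k) : Derivation k (RR l G jz) (RR l G jz) :=
  mkDer (fun m => f m • b k m) (by
    intro m n
    simp only [map_add, b_add, Algebra.smul_def]; ring)

theorem dg_b (f : MM l G jz →+ k) (m : MM l G jz) : dg f (b k m) = f m • b k m := mkDer_b _ _ _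

theorem dg_eq (f : MM l G jz →+ k) (x : RR l G jz) : dg f x = diag f x :=
  lext_app (dg f).toLinearMap (diag f) (fun m => by rw [diag_b]; exact dg_b f m) x

/-- coordinate functional on the group part -/
def co (p : ℕ) : MM l G jz →+ k where
  toFun m := m.1.1 p
  map_zero' := rfl
  map_add' _ _ := rfl

/-- coordinate functional on the polynomial part -/
def ci (p : ℕ) : MM l G jz →+ k where
  toFun m := (m.2.1 p : k)
  map_zero' := by simp
  map_add' m n := by simp [snd_add_app]

/-- lowering -/
def dm (p : ℕ) (m : MM l G jz) : MM l G jz := (m.1, dec p m.2)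

/-- partial derivative in t -/
def ptD (p : ℕ) : Derivation k (RR l G jz) (RR l G jz) :=
  mkDer (fun m => (m.2.1 p : k) • b k (dm p m)) (by
    intro m n
    have h1 : ∀ m n : MM l G jz, m.2.1 p ≠ 0 → b k (dm p (m + n)) = b k (dm p m) * b k n := by
      intro m n h
      rw [← b_add]; congr 1
      exact Prod.ext rfl (dec_add h _)
    by_cases hm : m.2.1 p = 0
    · by_cases hn : n.2.1 p = 0
      · simp [snd_add_app, hm, hn]
      · simp only [snd_add_app, hm, zero_add, Nat.cast_zero, zero_smul, mul_zero, add_zero]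
        rw [add_comm m n, h1 n m hn, mul_smul_comm, mul_comm]
    · rw [h1 m n hm]
      by_cases hn : n.2.1 p = 0
      · simp only [snd_add_app, hn, add_zero, Nat.cast_zero, zero_smul, mul_zero, zero_add]
        rw [mul_smul_comm, mul_comm]
      · have := h1 n m hn
        rw [add_comm n m, h1 m n hm] at this
        rw [mul_smul_comm, mul_smul_comm, mul_comm (b k m), ← this, mul_comm (b k n), ← add_smul]
        rw [snd_add_app]; push_cast; rw [add_comm])

theorem ptD_b (p : ℕ) (m : MM l G jz) : ptD p (b k m) = (m.2.1 p : k) • b k (dm p m) :=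
  mkDer_b _ _ _

/-- `∂_p` -/
def dD (p : ℕ) : Derivation k (RR l G jz) (RR l G jz) := dg (co p) + ptD p

theorem dD_b (p : ℕ) (m : MM l G jz) :
    dD p (b k m) = m.1.1 p • b k m + (m.2.1 p : k) • b k (dm p m) := by
  unfold dD
  rw [Derivation.add_apply, ptD_b, dg_b]; rfl

theorem dg_dg (f g : MM l G jz →+ k) (x : RR l G jz) : dg f (dg g x) = dg g (dg f x) := by
  rw [dg_eq, dg_eq, dg_eq, dg_eq, diag_diag, diag_diag]
  congr 1; congr 1; ext m; ring

theorem ptD_ptD (p q : ℕ) (x : RR l G jz) : ptD p (ptD q x) = ptD q (ptD p x) := by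
  refine lext_app ((ptD p).toLinearMap ∘ₗ (ptD q).toLinearMap)
    ((ptD q).toLinearMap ∘ₗ (ptD p).toLinearMap) (fun m => ?_) x
  change ptD p (ptD q (b k m)) = ptD q (ptD p (b k m))
  simp only [ptD_b, Derivation.map_smul, smul_smul]
  by_cases h : p = q
  · rw [h]
  · have e : dm p (dm q m) = dm q (dm p m) := Prod.ext rfl (dec_comm _ _ _)
    rw [e]
    congr 1
    change (m.2.1 q : k) * ((dec q m.2).1 p : k) = (m.2.1 p : k) * ((dec p m.2).1 q : k)
    rw [dec_ne h, dec_ne (Ne.symm h), mul_comm]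

/-- commutation of a diagonal operator with a lowering operator -/
theorem diag_ptD (f : MM l G jz → k) (p : ℕ) (c : k)
    (h : ∀ m : MM l G jz, m.2.1 p ≠ 0 → f (dm p m) = f m - c)
    (x : RR l G jz) : diag f (ptD p x) = ptD p (diag f x) - c • ptD p x := by
  refine lext_app (diag f ∘ₗ (ptD p).toLinearMap)
    ((ptD p).toLinearMap ∘ₗ diag f - c • (ptD p).toLinearMap) (fun m => ?_) x
  change diag f (ptD p (b k m)) = ptD p (diag f (b k m)) - c • ptD p (b k m)
  simp only [ptD_b, diag_b, Derivation.map_smul, map_smul, smul_smul]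
  by_cases hm : m.2.1 p = 0
  · simp [hm]
  · rw [h m hm, ← sub_smul]; congr 1; ring

theorem dg_ptD (f : MM l G jz →+ k) (p : ℕ) (c : k)
    (h : ∀ m : MM l G jz, m.2.1 p ≠ 0 → f (dm p m) = f m - c)
    (x : RR l G jz) : dg f (ptD p x) = ptD p (dg f x) - c • ptD p x := by
  rw [dg_eq, dg_eq, diag_ptD f p c h]

theorem co_ptD (q p : ℕ) (x : RR l G jz) : dg (co q) (ptD p x) = ptD p (dg (co q) x) := by
  rw [dg_ptD (co q) p 0 (fun m _ => by rw [sub_zero]; rfl), zero_smul, sub_zero]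

theorem dD_dD (p q : ℕ) (x : RR l G jz) : dD p (dD q x) = dD q (dD p x) := by
  unfold dD
  simp only [Derivation.add_apply, map_add]
  rw [dg_dg (co p), ptD_ptD, co_ptD, co_ptD]
  abel

end Ops
end Conc

namespace Conc
noncomputable section Build
open MonAlg

variable {k : Type*} [Field k] {l : ℕ → ℕ} {G : AddSubgroup (ℕ → k)} {jz : Bool}

theorem dmul {A : Type*} [CommRing A] [Algebra k A] (D : Derivation k A A) (x y : A) :
    D (x * y) = D x * y + x * D y := by
  rw [D.leibniz, smul_eq_mul, smul_eq_mul]; ring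

/-- the standing hypotheses -/
structure Hyp (l : ℕ → ℕ) (G : AddSubgroup (ℕ → k)) (jz : Bool) : Prop where
  pos : 0 < iot l 6
  g1 : ∀ p ∈ grp l, (Pi.single p (1 : k) : ℕ → k) ∈ G
  g2 : ∀ α ∈ G, ∀ p ∈ pur l, α p = 0
  g3 : ∀ α ∈ G, ∀ p, 2 * iot l 6 < p → α p = 0
  g0 : (∃ α ∈ G, α 0 ≠ 0) → (Pi.single 0 (1 : k) : ℕ → k) ∈ G
  j0 : jz = false → ∃ α ∈ G, α 0 ≠ 0

/-- index type -/
abbrev JJ (l : ℕ → ℕ) := ↥(Finset.Icc 1 (2 * iot l 6))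

theorem bar_mem {q : ℕ} (h : q ∈ Finset.Icc 1 (2 * iot l 6)) :
    bar l q ∈ Finset.Icc 1 (2 * iot l 6) := by
  rw [Finset.mem_Icc] at *
  unfold bar; split_ifs <;> omega

theorem bar_bar' {q : ℕ} (h : q ∈ Finset.Icc 1 (2 * iot l 6)) : bar l (bar l q) = q := by
  rw [Finset.mem_Icc] at h
  unfold bar; split_ifs <;> omega

theorem JJ_cases (q : JJ l) : (q.1 ∈ grp l ∧ q.1 ∉ pur l) ∨ (q.1 ∉ grp l ∧ q.1 ∈ pur l) := by
  have := iot_facts l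
  have h := Finset.mem_Icc.1 q.2
  rw [mem_grp, mem_pur]; omega

theorem pur_tok {q : ℕ} (h : q ∈ pur l) : tok l jz q := by
  have := iot_facts l
  rw [mem_pur] at h
  unfold tok
  rw [mem_bad]; omega

theorem grp_pos {q : ℕ} (h : q ∈ grp l) : q ≠ 0 := by
  rw [mem_grp] at h; omega

theorem pur_pos {q : ℕ} (h : q ∈ pur l) : q ≠ 0 := by
  rw [mem_pur] at h; omega

theorem grp_pur {q : ℕ} (h : q ∈ grp l) : q ∉ pur l := by
  have := iot_facts l
  rw [mem_grp] at h; rw [mem_pur]; omega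

/-- unit vector in the group -/
def gG (hy : Hyp l G jz) (q : ℕ) : G :=
  @dite _ (q ∈ grp l) (Classical.dec _) (fun h => ⟨Pi.single q 1, hy.g1 q h⟩) (fun _ => 0)

theorem gG_val (hy : Hyp l G jz) {q : ℕ} (h : q ∈ grp l) :
    (gG hy q).1 = Pi.single q 1 := by
  unfold gG; rw [dif_pos h]

theorem gG_zero (hy : Hyp l G jz) {q : ℕ} (h : q ∉ grp l) : gG hy q = 0 := by
  unfold gG; rw [dif_neg h]

theorem gG_ne (hy : Hyp l G jz) {q r : ℕ} (h : r ≠ q) : (gG hy q).1 r = 0 := by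
  by_cases hq : q ∈ grp l
  · rw [gG_val hy hq]; simp [h]
  · rw [gG_zero hy hq]; rfl

theorem gG_self (hy : Hyp l G jz) {q : ℕ} (h : q ∈ grp l) : (gG hy q).1 q = 1 := by
  rw [gG_val hy h]; simp

/-- exponent of `y` -/
def ym (hy : Hyp l G jz) (q : ℕ) : MM l G jz :=
  @ite _ (q ∈ grp l) (Classical.dec _) (gG hy q, 0) (0, ee l jz q)

theorem ym_grp (hy : Hyp l G jz) {q : ℕ} (h : q ∈ grp l) : ym hy q = (gG hy q, 0) := by
  unfold ym; rw [if_pos h]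

theorem ym_pur (hy : Hyp l G jz) {q : ℕ} (h : q ∈ pur l) : ym hy q = (0, ee l jz q) := by
  unfold ym; rw [if_neg (fun h' => grp_pur h' h)]

/-- weight -/
def wt (l : ℕ → ℕ) (G : AddSubgroup (ℕ → k)) (jz : Bool) : MM l G jz →+ k :=
  ∑ q ∈ grp l, co q + ∑ q ∈ pur l, ci q

theorem wt_app (m : MM l G jz) :
    wt l G jz m = ∑ q ∈ grp l, m.1.1 q + ∑ q ∈ pur l, (m.2.1 q : k) := by
  unfold wt
  rw [AddMonoidHom.add_apply, AddMonoidHom.finsetSum_apply, AddMonoidHom.finsetSum_apply]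
  rfl

theorem wt_dm (p : ℕ) (m : MM l G jz) (h : m.2.1 p ≠ 0) :
    wt l G jz (dm p m) = wt l G jz m - (if p ∈ pur l then 1 else 0) := by
  rw [wt_app, wt_app]
  have : ∀ q ∈ pur l, ((dm p m).2.1 q : k) = (m.2.1 q : k) - (if p = q then 1 else 0) := by
    intro q _
    split_ifs with hq
    · subst hq
      have e : (dm p m).2.1 p = m.2.1 p - 1 := dec_same p m.2
      rw [e, Nat.cast_sub (by omega), Nat.cast_one]
    · have e : (dm p m).2.1 q = m.2.1 q := dec_ne (Ne.symm hq) m.2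
      rw [e, sub_zero]
  rw [Finset.sum_congr rfl this, Finset.sum_sub_distrib, Finset.sum_ite_eq]
  change ∑ q ∈ grp l, m.1.1 q + _ = _
  ring

theorem wt_g (hy : Hyp l G jz) {q : ℕ} (h : q ∈ grp l) : wt l G jz (gG hy q, 0) = 1 := by
  rw [wt_app]
  have h1 : ∑ r ∈ grp l, ((gG hy q, 0) : MM l G jz).1.1 r = 1 := by
    rw [Finset.sum_eq_single q]
    · exact gG_self hy h
    · intro r _ hr; exact gG_ne hy hr
    · intro h'; exact absurd h h'
  rw [h1]
  have : ∀ r ∈ pur l, ((((gG hy q, 0) : MM l G jz).2.1 r : ℕ) : k) = 0 := by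
    intro r _; exact Nat.cast_zero
  rw [Finset.sum_congr rfl this]; simp

theorem wt_neg (a : G) : wt l G jz (-a, 0) = - wt l G jz (a, 0) := by
  rw [eq_neg_iff_add_eq_zero, ← map_add]
  have : ((-a, 0) : MM l G jz) + (a, 0) = 0 := by ext <;> simp
  rw [this, map_zero]

theorem wt_e {q : ℕ} (h : q ∈ pur l) : wt l G jz (0, ee l jz q) = 1 := by
  have h' := wt_dm (k := k) (G := G) (jz := jz) q (0, ee l jz q) (by
    change (ee l jz q).1 q ≠ 0
    rw [ee_val (pur_tok h)]; simp)
  have e : (dm q (0, ee l jz q) : MM l G jz) = 0 := Prod.ext rfl (dec_ee (pur_tok h))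
  rw [e, map_zero, if_pos h] at h'
  linear_combination -h'

/-- Euler operator -/
def EE (l : ℕ → ℕ) (G : AddSubgroup (ℕ → k)) (jz : Bool) :
    Derivation k (RR l G jz) (RR l G jz) := dg (wt l G jz)

/-- normalized derivations -/
def DD (hy : Hyp l G jz) (q : ℕ) : Derivation k (RR l G jz) (RR l G jz) :=
  (b k (-gG hy q, 0) : RR l G jz) • dD q

theorem DD_app (hy : Hyp l G jz) (q : ℕ) (x : RR l G jz) :
    DD hy q x = b k (-gG hy q, 0) * dD q x := rfl

theorem dD_g (hy : Hyp l G jz) {q r : ℕ} (h : q ≠ r) :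
    dD q (b k ((-gG hy r, 0) : MM l G jz)) = 0 := by
  rw [dD_b]
  have e1 : ((-gG hy r, 0) : MM l G jz).1.1 q = 0 := by
    change -((gG hy r).1 q) = 0
    rw [gG_ne hy h, neg_zero]
  have e2 : ((-gG hy r, 0) : MM l G jz).2.1 q = 0 := rfl
  rw [e1, e2]; simp

theorem DD_comm (hy : Hyp l G jz) (q r : ℕ) (x : RR l G jz) :
    DD hy q (DD hy r x) = DD hy r (DD hy q x) := by
  by_cases h : q = r
  · rw [h]
  · simp only [DD_app, dmul, dD_g hy h, dD_g hy (Ne.symm h)]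
    rw [dD_dD]; ring

theorem D0_DD (hy : Hyp l G jz) {q : ℕ} (h : q ≠ 0) (x : RR l G jz) :
    dD 0 (DD hy q x) = DD hy q (dD 0 x) := by
  simp only [DD_app, dmul, dD_g hy (Ne.symm h)]
  rw [dD_dD]; ring

theorem EE_dD (hy : Hyp l G jz) (q : ℕ) (x : RR l G jz) :
    EE l G jz (dD q x) = dD q (EE l G jz x) - (if q ∈ pur l then dD q x else 0) := by
  unfold dD EE
  simp only [Derivation.add_apply, map_add]
  rw [dg_ptD _ q _ (wt_dm q), dg_dg]
  split_ifs with h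
  · have : dg (co q) x = 0 := by
      have e : (co q : MM l G jz →+ k) = 0 := by
        ext m; exact hy.g2 _ m.1.2 q h
      rw [e]
      exact lext_app (dg 0).toLinearMap 0 (fun m => by
        change dg 0 (b k m) = 0
        rw [dg_b]; simp) x
    rw [this, one_smul]; abel
  · rw [zero_smul]; abel

theorem EE_DD (hy : Hyp l G jz) (q : JJ l) (x : RR l G jz) :
    EE l G jz (DD hy q x) = DD hy q (EE l G jz x) - DD hy q x := by
  rw [DD_app, DD_app, dmul, EE_dD hy]
  rcases JJ_cases q with ⟨h1, h2⟩ | ⟨h1, h2⟩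
  · rw [if_neg h2]
    have : EE l G jz (b k (-gG hy q, 0)) = - b k (-gG hy q, 0) := by
      unfold EE
      rw [dg_b, wt_neg, wt_g hy h1]; simp
    rw [this]; ring
  · rw [if_pos h2]
    have : EE l G jz (b k (-gG hy q, 0)) = 0 := by
      rw [gG_zero hy h1, neg_zero]
      exact Derivation.map_one_eq_zero _
    rw [this]; ring

theorem EE_y (hy : Hyp l G jz) (q : JJ l) : EE l G jz (b k (ym hy q)) = b k (ym hy q) := by
  unfold EE
  rw [dg_b]
  rcases JJ_cases q with ⟨h1, h2⟩ | ⟨h1, h2⟩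
  · rw [ym_grp hy h1, wt_g hy h1, one_smul]
  · rw [ym_pur hy h2, wt_e h2, one_smul]

theorem dD_y (hy : Hyp l G jz) (q : ℕ) (r : JJ l) :
    dD q (b k (ym hy r)) = if q = r then b k (gG hy r, 0) else 0 := by
  rw [dD_b]
  rcases JJ_cases r with ⟨h1, h2⟩ | ⟨h1, h2⟩
  · rw [ym_grp hy h1]
    have e2 : ((gG hy r, 0) : MM l G jz).2.1 q = 0 := rfl
    rw [e2, Nat.cast_zero, zero_smul, add_zero]
    change (gG hy r).1 q • _ = _
    split_ifs with h
    · rw [h, gG_self hy h1, one_smul]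
    · rw [gG_ne hy h, zero_smul]
  · rw [ym_pur hy h2]
    have e1 : ((0, ee l jz r) : MM l G jz).1.1 q = 0 := rfl
    rw [e1, zero_smul, zero_add]
    change ((ee l jz r).1 q : k) • _ = _
    rw [ee_val (pur_tok h2), gG_zero hy h1]
    split_ifs with h
    · have e : (dm q (0, ee l jz r) : MM l G jz) = (0, 0) :=
        Prod.ext rfl (by rw [h]; exact dec_ee (pur_tok h2))
      rw [e, h]; simp
    · simp [h]

theorem g_neg_mul (a : G) : b k ((-a, 0) : MM l G jz) * b k (a, 0) = 1 := by
  rw [← b_add, ← b_zero]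
  congr 1
  ext <;> simp

theorem DD_y (hy : Hyp l G jz) (q r : JJ l) :
    DD hy q (b k (ym hy r)) = if q = r then 1 else 0 := by
  rw [DD_app, dD_y]
  by_cases h : q = r
  · rw [if_pos h, if_pos (congrArg _ h), h, g_neg_mul]
  · rw [if_neg h, if_neg (fun h' => h (Subtype.ext h')), mul_zero]

theorem D0_y (hy : Hyp l G jz) (r : JJ l) : dD 0 (b k (ym hy r)) = 0 := by
  rw [dD_y, if_neg]
  have := Finset.mem_Icc.1 r.2
  omega

theorem ci_eq (p : ℕ) (x : RR l G jz) : diag (ci p) x = b k (0, ee l jz p) * ptD p x := by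
  refine lext_app (diag (ci p)) (LinearMap.mulLeft k (b k (0, ee l jz p)) ∘ₗ (ptD p).toLinearMap)
    (fun m => ?_) x
  change diag (ci p) (b k m) = b k (0, ee l jz p) * ptD p (b k m)
  rw [diag_b, ptD_b, mul_smul_comm, ← b_add]
  change (m.2.1 p : k) • _ = _
  by_cases h : m.2.1 p = 0
  · rw [h]; simp
  · congr 2
    exact Prod.ext (zero_add _).symm (ee_dec _ h).symm

theorem ptD_nil (p : ℕ) (x : RR l G jz) : ∃ n : ℕ, ((ptD p).toLinearMap ^ n) x = 0 := by
  refine loc_nil _ (fun m => m.2.1 p) (fun m S hS => ?_) x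
  change ptD p (b k m) ∈ S
  rw [ptD_b]
  by_cases h : m.2.1 p = 0
  · rw [h]; simp
  · refine S.smul_mem _ (hS _ ?_)
    have e : (dm p m).2.1 p = m.2.1 p - 1 := dec_same p m.2
    rw [e]; omega

theorem dD_ker (p : ℕ) (x : RR l G jz) (h : dD p x = 0) :
    diag (co p) x = 0 ∧ ptD p x = 0 := by
  have h1 : diag (co p) x = - ptD p x := by
    rw [← dg_eq, eq_neg_iff_add_eq_zero]; exact h
  have hc : Commute (diag (co p)) ((ptD p).toLinearMap : Module.End k (RR l G jz)) := by
    refine LinearMap.ext fun x => ?_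
    change diag (co p) (ptD p x) = ptD p (diag (co p) x)
    rw [← dg_eq, ← dg_eq, co_ptD]
  have h2 : ∀ n : ℕ, (diag (co p) ^ n) x = (-1 : k) ^ n • ((ptD p).toLinearMap ^ n) x := by
    intro n
    induction n with
    | zero => simp
    | succ n ih =>
      rw [pow_succ', Module.End.mul_apply, ih, map_smul]
      have := LinearMap.congr_fun (hc.pow_right n).eq x
      rw [Module.End.mul_apply, Module.End.mul_apply, h1, map_neg] at this
      rw [this, pow_succ, pow_succ, Module.End.mul_apply, mul_smul, neg_one_smul]
      rfl
  obtain ⟨n, hn⟩ := ptD_nil p x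
  have h3 : diag (co p) x = 0 := diag_ss_pow _ n x (by rw [h2, hn, smul_zero])
  refine ⟨h3, ?_⟩
  rw [h3] at h1
  exact neg_eq_zero.1 h1.symm

theorem const_lem [CharZero k] (hy : Hyp l G jz) (x : RR l G jz)
    (h : ∀ p ≤ 2 * iot l 6, dD p x = 0) : ∃ c : k, x = algebraMap k (RR l G jz) c := by
  refine eq_const x (fun m hm => ?_)
  by_contra hx
  apply hm
  have key : ∀ p, m.1.1 p = 0 ∧ m.2.1 p = 0 := by
    intro p
    by_cases hp : p ≤ 2 * iot l 6
    · obtain ⟨h1, h2⟩ := dD_ker p x (h p hp)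
      have h3 : diag (ci p) x = 0 := by rw [ci_eq, h2, mul_zero]
      have c1 := diag_coeff (co p) x m
      have c2 := diag_coeff (ci p) x m
      rw [h1, AddMonoidAlgebra.coeff_zero, Finsupp.zero_apply] at c1
      rw [h3, AddMonoidAlgebra.coeff_zero, Finsupp.zero_apply] at c2
      refine ⟨(mul_eq_zero.1 c1.symm).resolve_right hx, ?_⟩
      have : (m.2.1 p : k) = 0 := (mul_eq_zero.1 c2.symm).resolve_right hx
      exact_mod_cast this
    · refine ⟨hy.g3 _ m.1.2 p (by omega), mem_Jsub.1 m.2.2 p (fun ht => ?_)⟩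
      exact ht.2 (by omega) (Or.inr (by omega))
  refine Prod.ext (Subtype.ext (funext fun p => (key p).1)) (Subtype.ext (funext fun p => (key p).2))

theorem const_lem' [CharZero k] (hy : Hyp l G jz) (x : RR l G jz) (h0 : dD 0 x = 0)
    (h : ∀ q : JJ l, DD hy q x = 0) : ∃ c : k, x = algebraMap k (RR l G jz) c := by
  refine const_lem hy x (fun p hp => ?_)
  by_cases hp0 : p = 0
  · rw [hp0, h0]
  · exact b_mul_inj _ _ (h ⟨p, Finset.mem_Icc.2 ⟨by omega, hp⟩⟩)

theorem E_sub (c : ℤ) (z : RR l G jz) :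
    EE l G jz z - c * z = diag (fun m => wt l G jz m - c) z := by
  have e : (c : RR l G jz) * z = (c : k) • z := by
    rw [Algebra.smul_def, map_intCast]
  rw [e]
  refine lext_app ((EE l G jz).toLinearMap - (c : k) • LinearMap.id) _ (fun m => ?_) z
  change EE l G jz (b k m) - (c : k) • b k m = _
  unfold EE
  rw [dg_b, diag_b, sub_smul]

theorem ES1' (c : ℤ) (z : RR l G jz)
    (h : EE l G jz (EE l G jz z - c * z) = c * (EE l G jz z - c * z)) :
    EE l G jz z = c * z := by
  rw [← sub_eq_zero, E_sub, E_sub] at h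
  rw [← sub_eq_zero, E_sub]
  exact diag_ss _ _ h

theorem diag_sub (f g : MM l G jz → k) (x : RR l G jz) :
    diag f x - diag g x = diag (fun m => f m - g m) x := by
  refine lext_app (diag f - diag g) _ (fun m => ?_) x
  rw [LinearMap.sub_apply, diag_b, diag_b, diag_b, sub_smul]

theorem diag_one (x : RR l G jz) : diag (fun _ => 1) x = x := by
  refine lext_app (diag _) LinearMap.id (fun m => ?_) x
  rw [diag_b, one_smul]; rfl

theorem diag_zero (x : RR l G jz) : diag (fun _ => 0) x = 0 := by
  refine lext_app (diag _) 0 (fun m => ?_) x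
  rw [diag_b, zero_smul]; rfl

theorem semis (f : MM l G jz → k) (a : RR l G jz) :
    diag f (a - diag f (diag (fun m => (f m)⁻¹) a)) = 0 := by
  rw [map_sub, diag_diag, diag_diag, diag_sub]
  have : (fun m => f m - f m * f m * (f m)⁻¹) = fun _ => 0 := by
    ext m
    by_cases h : f m = 0
    · simp [h]
    · field_simp; ring
  rw [this, diag_zero]

theorem ES2' (c : ℤ) (a : RR l G jz) (ha : dD 0 a = 0) : ∃ s, dD 0 s = 0 ∧
    EE l G jz (a - (EE l G jz s - c * s)) = c * (a - (EE l G jz s - c * s)) := by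
  refine ⟨diag (fun m => (wt l G jz m - c)⁻¹) a, ?_, ?_⟩
  · unfold dD at ha ⊢
    rw [Derivation.add_apply] at ha ⊢
    have h := diag_ptD (fun m => (wt l G jz m - c)⁻¹) 0 0 (fun m hm => by
      rw [wt_dm 0 m hm, if_neg (fun h => pur_pos h rfl)]; simp) a
    rw [zero_smul, sub_zero] at h
    rw [← h, dg_eq, diag_diag]
    have e : (fun m => co 0 m * (wt l G jz m - c)⁻¹) = fun m => (wt l G jz m - c)⁻¹ * co 0 m := by
      ext m; ring
    rw [e, ← diag_diag, ← dg_eq, ← map_add, ha, map_zero]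
  · rw [← sub_eq_zero, E_sub, E_sub]
    exact semis _ a

theorem Icc_split : Finset.Icc 1 (2 * iot l 6) = grp l ∪ pur l := by
  have := iot_facts l
  ext q
  rw [Finset.mem_union, Finset.mem_Icc, mem_grp, mem_pur]; omega

theorem disj : Disjoint (grp l) (pur l) := Finset.disjoint_left.2 fun _ h => grp_pur h

theorem sum_JJ {V : Type*} [AddCommMonoid V] (f : ℕ → V) :
    ∑ q : JJ l, f q = ∑ q ∈ grp l, f q + ∑ q ∈ pur l, f q := by
  rw [Finset.sum_coe_sort (Finset.Icc 1 (2 * iot l 6)) f, Icc_split, Finset.sum_union disj]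

theorem nil_eq (hy : Hyp l G jz) :
    (∑ q : JJ l, LinearMap.mulLeft k (b k (ym hy q)) * (DD hy q).toLinearMap)
      - (EE l G jz).toLinearMap =
    (∑ q ∈ grp l, (ptD q).toLinearMap : Module.End k (RR l G jz)) := by
  rw [sum_JJ (fun q => LinearMap.mulLeft k (b k (ym hy q)) * (DD hy q).toLinearMap)]
  refine lext fun m => ?_
  rw [LinearMap.sub_apply, LinearMap.add_apply, LinearMap.sum_apply, LinearMap.sum_apply,
    LinearMap.sum_apply]
  have h1 : ∀ q ∈ grp l, (LinearMap.mulLeft k (b k (ym hy q)) * (DD hy q).toLinearMap) (b k m) =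
      m.1.1 q • b k m + ptD q (b k m) := by
    intro q hq
    change b k (ym hy q) * (DD hy q (b k m)) = _
    rw [DD_app, ← mul_assoc, ym_grp hy hq, mul_comm (b k _), g_neg_mul, one_mul, dD_b, ptD_b]
  have h2 : ∀ q ∈ pur l, (LinearMap.mulLeft k (b k (ym hy q)) * (DD hy q).toLinearMap) (b k m) =
      (m.2.1 q : k) • b k m := by
    intro q hq
    change b k (ym hy q) * (DD hy q (b k m)) = _
    have e : b k ((-gG hy q, 0) : MM l G jz) = 1 := by
      rw [gG_zero hy (fun h => grp_pur h hq), neg_zero]; rfl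
    rw [DD_app, e, one_mul, dD_b, hy.g2 _ m.1.2 q hq, zero_smul, zero_add, ym_pur hy hq,
      ← ptD_b, ← ci_eq, diag_b]; rfl
  rw [Finset.sum_congr rfl h1, Finset.sum_congr rfl h2, Finset.sum_add_distrib, ← Finset.sum_smul,
    ← Finset.sum_smul]
  change _ - EE l G jz (b k m) = _
  unfold EE
  rw [dg_b, wt_app, add_smul]
  change _ = ∑ q ∈ grp l, ptD q (b k m)
  abel

theorem nil' (hy : Hyp l G jz) (a : RR l G jz) : ∃ n : ℕ,
    (((∑ q : JJ l, LinearMap.mulLeft k (b k (ym hy q)) * (DD hy q).toLinearMap)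
      - (EE l G jz).toLinearMap) ^ n) a = 0 := by
  rw [nil_eq]
  refine loc_nil _ (fun m => ∑ q ∈ grp l, m.2.1 q) (fun m S hS => ?_) a
  rw [LinearMap.sum_apply]
  refine S.sum_mem fun q hq => ?_
  change ptD q (b k m) ∈ S
  rw [ptD_b]
  by_cases h : m.2.1 q = 0
  · rw [h]; simp
  · refine S.smul_mem _ (hS _ ?_)
    refine Finset.sum_lt_sum (fun r _ => dec_le _) ⟨q, hq, ?_⟩
    have e : (dm q m).2.1 q = m.2.1 q - 1 := dec_same q m.2
    rw [e]; omega

/-- the concrete contact data -/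
def CC [CharZero k] (hy : Hyp l G jz) : CData k (RR l G jz) (JJ l) where
  bar q := ⟨bar l q, bar_mem q.2⟩
  bar_bar q := Subtype.ext (bar_bar' q.2)
  ε q := if q.1 ≤ iot l 6 then 1 else -1
  ε_bar q := by
    have := Finset.mem_Icc.1 q.2
    simp only [bar]; split_ifs <;> omega
  ε_sq q := by split_ifs <;> simp
  y q := b k (ym hy q)
  D q := DD hy q
  D0 := dD 0
  E := EE l G jz
  D_y := DD_y hy
  D_comm q r := DD_comm hy q r
  D0_D q := D0_DD hy (by have := Finset.mem_Icc.1 q.2; omega)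
  D0_E a := by
    have h := EE_dD hy 0 a
    rw [if_neg (fun h => pur_pos h rfl), sub_zero] at h
    exact h.symm
  E_D := EE_DD hy
  E_y := EE_y hy
  D0_y := D0_y hy
  nil := nil' hy
  const := const_lem' hy
  y_inj q := b_mul_inj _
  ES1 := ES1'
  ES2 := ES2'

end Build
end Conc

namespace Conc
noncomputable section Cases
open MonAlg

variable {k : Type*} [Field k] [CharZero k] {l : ℕ → ℕ} {G : AddSubgroup (ℕ → k)} {jz : Bool}

theorem tok_zero (h : jz = true) : tok l jz 0 := ⟨fun _ => h, fun h => by omega⟩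

theorem dD_t (p : ℕ) {q : ℕ} (hq : tok l jz q) :
    dD p (b k ((0, ee l jz q) : MM l G jz)) = if p = q then 1 else 0 := by
  rw [dD_b]
  have e1 : ((0, ee l jz q) : MM l G jz).1.1 p = 0 := rfl
  rw [e1, zero_smul, zero_add]
  change ((ee l jz q).1 p : k) • _ = _
  rw [ee_val hq]
  split_ifs with h
  · have e : (dm p (0, ee l jz q) : MM l G jz) = 0 := Prod.ext rfl (by rw [h]; exact dec_ee hq)
    rw [e, h, b_zero]; simp
  · simp [h]

theorem dD_x (p : ℕ) (a : G) :
    dD p (b k ((a, 0) : MM l G jz)) = a.1 p • b k (a, 0) := by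
  rw [dD_b]
  have e1 : ((a, 0) : MM l G jz).2.1 p = 0 := rfl
  rw [e1, Nat.cast_zero, zero_smul, add_zero]

theorem EE_x (p : ℕ) (a : G) (h : ∀ q ∈ grp l, a.1 q = 0) :
    EE l G jz (b k ((a, 0) : MM l G jz)) = 0 := by
  unfold EE
  rw [dg_b, wt_app]
  have h1 : ∑ q ∈ grp l, ((a, 0) : MM l G jz).1.1 q = 0 := Finset.sum_eq_zero h
  have h2 : ∑ q ∈ pur l, ((((a, 0) : MM l G jz).2.1 q : ℕ) : k) = 0 :=
    Finset.sum_eq_zero fun q _ => Nat.cast_zero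
  rw [h1, h2]; simp

theorem ncase (hy : Hyp l G jz) (hj : jz = true) : (CC hy).NCase (b k (0, ee l jz 0)) where
  D0τ := by
    change dD 0 _ = _
    rw [dD_t 0 (tok_zero hj), if_pos rfl]
  Dτ q := by
    change DD hy q _ = _
    have := Finset.mem_Icc.1 q.2
    rw [DD_app, dD_t _ (tok_zero hj), if_neg (by omega), mul_zero]
  Eτ := by
    change EE l G jz _ = _
    unfold EE
    rw [dg_b, wt_app]
    have h1 : ∑ q ∈ grp l, ((0, ee l jz 0) : MM l G jz).1.1 q = 0 :=
      Finset.sum_eq_zero fun q _ => rfl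
    have h2 : ∑ q ∈ pur l, ((((0, ee l jz 0) : MM l G jz).2.1 q : ℕ) : k) = 0 := by
      refine Finset.sum_eq_zero fun q hq => ?_
      change (((ee l jz 0).1 q : ℕ) : k) = 0
      rw [ee_val (tok_zero hj)]
      simp [pur_pos hq]
    rw [h1, h2]; simp
  surj a := by
    change ∃ x, dD 0 x = a
    have key : ∀ n, ∀ m : MM l G jz, m.2.1 0 = n → ∃ x, dD 0 x = b k m := by
      intro n
      induction n with
      | zero =>
        intro m hm
        by_cases ha : m.1.1 0 = 0
        · refine ⟨b k (m + (0, ee l jz 0)), ?_⟩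
          have e1 : (dD 0) (b k m) = (0 : RR l G jz) := by
            rw [dD_b, ha, hm]; simp
          rw [b_add, dmul, dD_t 0 (tok_zero hj), if_pos rfl, e1]; simp
        · refine ⟨(m.1.1 0)⁻¹ • b k m, ?_⟩
          rw [Derivation.map_smul, dD_b, hm, smul_add, smul_smul, inv_mul_cancel₀ ha]
          simp
      | succ n ih =>
        intro m hm
        have e : (dm 0 m).2.1 0 = m.2.1 0 - 1 := dec_same 0 m.2
        by_cases ha : m.1.1 0 = 0
        · have ht : tok l jz 0 := tok_zero hj
          refine ⟨((n : k) + 2)⁻¹ • b k (m + (0, ee l jz 0)), ?_⟩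
          have hne : (n : k) + 2 ≠ 0 := by exact_mod_cast (by omega : n + 2 ≠ 0)
          have h2 : dm 0 (m + (0, ee l jz 0)) = m := by
            rw [add_comm]
            refine Prod.ext (zero_add _) ?_
            change dec 0 (ee l jz 0 + m.2) = m.2
            rw [dec_add (by rw [ee_val ht]; simp), dec_ee ht, zero_add]
          have h3 : (m + (0, ee l jz 0)).2.1 0 = n + 2 := by
            change m.2.1 0 + (ee l jz 0).1 0 = _
            rw [ee_val ht, hm]; simp
          have h4 : (m + (0, ee l jz 0)).1.1 0 = 0 := by
            change m.1.1 0 + 0 = 0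
            rw [ha, add_zero]
          rw [Derivation.map_smul, dD_b, h2, h3, h4, zero_smul, zero_add, smul_smul]
          push_cast
          rw [inv_mul_cancel₀ hne, one_smul]
        · obtain ⟨x, hx⟩ := ih (dm 0 m) (by omega)
          refine ⟨(m.1.1 0)⁻¹ • (b k m - (m.2.1 0 : k) • x), ?_⟩
          rw [Derivation.map_smul, map_sub, Derivation.map_smul, hx, dD_b, add_sub_cancel_right,
            smul_smul, inv_mul_cancel₀ ha, one_smul]
    refine b_ind a ⟨0, map_zero _⟩ ?_ ?_
    · rintro x y ⟨x', rfl⟩ ⟨y', rfl⟩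
      exact ⟨x' + y', map_add _ _ _⟩
    · intro c m
      obtain ⟨x, hx⟩ := key _ m rfl
      exact ⟨c • x, by rw [Derivation.map_smul, hx]⟩

/-- unit vector in direction zero -/
def e0 (hy : Hyp l G jz) (hj : jz = false) : G := ⟨Pi.single 0 1, hy.g0 (hy.j0 hj)⟩

theorem D0_diag (hj : jz = false) (x : RR l G jz) : dD 0 x = diag (co 0) x := by
  have h : ∀ m : MM l G jz, m.2.1 0 = 0 := fun m => mem_Jsub.1 m.2.2 0 (fun h => by
    have := h.1 rfl
    rw [hj] at this; simp at this)
  refine lext_app (dD 0).toLinearMap _ (fun m => ?_) x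
  change dD 0 (b k m) = _
  rw [dD_b, h, diag_b]; simp; rfl

theorem gcase (hy : Hyp l G jz) (hj : jz = false) :
    (CC hy).GCase (b k (e0 hy hj, 0)) (b k (-e0 hy hj, 0)) := by
  have v : ∀ q, q ≠ 0 → (e0 hy hj).1 q = 0 := fun q hq => by
    change (Pi.single 0 1 : ℕ → k) q = 0
    simp [hq]
  have v0 : (e0 hy hj).1 0 = 1 := by
    change (Pi.single 0 1 : ℕ → k) 0 = 1
    simp
  have w : ∀ q, q ≠ 0 → (-e0 hy hj).1 q = 0 := fun q hq => by
    change -((e0 hy hj).1 q) = 0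
    rw [v q hq, neg_zero]
  have w0 : (-e0 hy hj).1 0 = -1 := by
    change -((e0 hy hj).1 0) = -1
    rw [v0]
  have sub : ∀ (c : ℤ) (z : RR l G jz), dD 0 z - c * z = diag (fun m : MM l G jz => (co 0 m : k) - (c : k)) z := by
    intro c z
    have e : (c : RR l G jz) * z = (c : k) • z := by
      rw [Algebra.smul_def, map_intCast]
    rw [e, D0_diag hj]
    refine lext_app (diag (co 0) - (c : k) • LinearMap.id) _ (fun m => ?_) z
    change diag (co 0) (b k m) - (c : k) • b k m = _
    rw [diag_b, diag_b, sub_smul]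
  constructor
  · rw [mul_comm, g_neg_mul]
  · change dD 0 _ = _
    rw [dD_x, v0, one_smul]
  · change dD 0 _ = _
    rw [dD_x, w0, neg_one_smul]
  · intro q
    change DD hy q _ = _
    have := Finset.mem_Icc.1 q.2
    rw [DD_app, dD_x, v _ (by omega), zero_smul, mul_zero]
  · intro q
    change DD hy q _ = _
    have := Finset.mem_Icc.1 q.2
    rw [DD_app, dD_x, w _ (by omega), zero_smul, mul_zero]
  · exact EE_x 0 _ (fun q hq => v q (grp_pos hq))
  · exact EE_x 0 _ (fun q hq => w q (grp_pos hq))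
  · intro c z h
    change dD 0 (dD 0 z - (c : RR l G jz) * z) = (c : RR l G jz) * (dD 0 z - (c : RR l G jz) * z) at h
    change dD 0 z = (c : RR l G jz) * z
    rw [← sub_eq_zero, sub, sub] at h
    rw [← sub_eq_zero, sub]
    exact diag_ss _ _ h
  · intro a
    refine ⟨diag (fun m => (co 0 m)⁻¹) a, ?_⟩
    change dD 0 (a - dD 0 _) = 0
    rw [D0_diag hj, D0_diag hj]
    exact semis _ a

/-- lift of a group functional -/
def mu1 (μ : G →+ k) : MM l G jz →+ k := μ.comp (AddMonoidHom.fst _ _)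

theorem mix_of {q : ℕ} (h : tok l jz q) (hq : q ∉ pur l) (h0 : q ≠ 0) : q ∈ mix l := by
  have := iot_facts l
  have h := h.2
  rw [mem_bad] at h
  rw [mem_pur] at hq
  rw [mem_mix]
  omega

theorem mix_tok {q : ℕ} (h : q ∈ mix l) : tok l jz q := by
  have := iot_facts l
  rw [mem_mix] at h
  unfold tok
  rw [mem_bad]
  omega

theorem mix_grp {q : ℕ} (h : q ∈ mix l) : q ∈ grp l := by
  have := iot_facts l
  rw [mem_mix] at h
  rw [mem_grp]
  omega

theorem ee_tok_zero {q : ℕ} (h : ¬ tok l jz q) : ee l jz q = 0 := by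
  unfold ee; rw [dif_neg h]

theorem kill_all (δ : Derivation k (RR l G jz) (RR l G jz))
    (hx : ∀ a : G, δ (b k (a, 0)) = 0) (ht : ∀ q, tok l jz q → δ (b k (0, ee l jz q)) = 0)
    (v : RR l G jz) : δ v = 0 := by
  have h1 : ∀ n : ℕ, ∀ i : Jsub l jz, ∑ q ∈ Finset.range (2 * iot l 6 + 1), i.1 q ≤ n →
      δ (b k (0, i)) = 0 := by
    intro n
    induction n with
    | zero =>
      intro i hi
      have hz := Finset.sum_eq_zero_iff.1 (Nat.le_zero.1 hi)
      have : i = 0 := by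
        apply Subtype.ext
        funext q
        by_cases hq : q < 2 * iot l 6 + 1
        · exact hz q (Finset.mem_range.2 hq)
        · exact mem_Jsub.1 i.2 q (fun h => h.2 (by omega) (Or.inr (by omega)))
      rw [this]; exact hx 0
    | succ n ih =>
      intro i hi
      by_cases hq : ∃ q ∈ Finset.range (2 * iot l 6 + 1), i.1 q ≠ 0
      · obtain ⟨q, hqr, hq⟩ := hq
        have e := ee_dec i hq
        have e' : ((0, i) : MM l G jz) = (0, ee l jz q) + (0, dec q i) :=
          Prod.ext (zero_add _).symm e.symm
        have htq : tok l jz q := by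
          by_contra hn
          exact hq (mem_Jsub.1 i.2 q hn)
        have hlt : ∑ r ∈ Finset.range (2 * iot l 6 + 1), (dec q i).1 r <
            ∑ r ∈ Finset.range (2 * iot l 6 + 1), i.1 r := by
          refine Finset.sum_lt_sum (fun r _ => dec_le _) ⟨q, hqr, ?_⟩
          rw [dec_same]; omega
        rw [e', b_add, dmul, ht q htq, ih (dec q i) (by omega)]; simp
      · push Not at hq
        exact ih i (by rw [Finset.sum_eq_zero hq]; omega)
  refine lext_app δ.toLinearMap 0 (fun m => ?_) v
  change δ (b k m) = 0
  have e' : m = (m.1, 0) + (0, m.2) := Prod.ext (add_zero _).symm (zero_add _).symm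
  rw [e', b_add, dmul, hx, h1 _ m.2 le_rfl]; simp

theorem der_sum_smul (s : Finset ℕ) (c : ℕ → k) (δ : ℕ → Derivation k (RR l G jz) (RR l G jz))
    (v : RR l G jz) : (∑ p ∈ s, c p • δ p) v = ∑ p ∈ s, c p • δ p v := by
  induction s using Finset.induction_on with
  | empty => rfl
  | insert a s ha ih =>
    rw [Finset.sum_insert ha, Finset.sum_insert ha, Derivation.add_apply, ih]; rfl

theorem ptD_x (p : ℕ) (a : G) : ptD p (b k ((a, 0) : MM l G jz)) = 0 := by
  rw [ptD_b]
  have e1 : ((a, 0) : MM l G jz).2.1 p = 0 := rfl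
  rw [e1, Nat.cast_zero, zero_smul]

theorem ptD_t (p : ℕ) {q : ℕ} (hq : tok l jz q) :
    ptD p (b k ((0, ee l jz q) : MM l G jz)) = if p = q then 1 else 0 := by
  rw [← dD_t p hq, dD_b, ptD_b]
  have e1 : ((0, ee l jz q) : MM l G jz).1.1 p = 0 := rfl
  rw [e1, zero_smul, zero_add]

theorem sum_ptD_t (c : ℕ → k) {q : ℕ} (hq : tok l jz q) :
    ∑ p ∈ mix l, c p • ptD p (b k ((0, ee l jz q) : MM l G jz)) =
      if q ∈ mix l then algebraMap k _ (c q) else 0 := by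
  simp only [ptD_t _ hq, smul_ite, smul_zero]
  rw [Finset.sum_ite_eq']
  simp only [Algebra.algebraMap_eq_smul_one]

theorem classify (hy : Hyp l G jz) (δ : Derivation k (RR l G jz) (RR l G jz))
    (hD : ∀ (q : JJ l) x, δ (DD hy q x) = DD hy q (δ x)) (hD0 : ∀ x, δ (dD 0 x) = dD 0 (δ x))
    (hδy : ∀ q : JJ l, δ (b k (ym hy q)) = 0)
    (hτ : jz = true → δ (b k (0, ee l jz 0)) = 0) :
    ∃ (c : ℕ → k) (μ : G →+ k), (∀ q ∈ grp l, μ (gG hy q) = 0) ∧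
      ∀ v, δ v = ∑ p ∈ mix l, c p • ptD p v + dg (mu1 μ) v := by
  have Jmem : ∀ q ∈ grp l ∪ pur l, q ∈ Finset.Icc 1 (2 * iot l 6) := fun q hq => by
    rw [Icc_split]; exact hq
  have hg : ∀ q ∈ grp l, δ (b k (gG hy q, 0)) = 0 := by
    intro q hq
    rw [← ym_grp hy hq]
    exact hδy ⟨q, Jmem q (Finset.mem_union_left _ hq)⟩
  have hg' : ∀ q, δ (b k (-gG hy q, 0)) = 0 := by
    intro q
    by_cases hq : q ∈ grp l
    · have h := congrArg δ (g_neg_mul (l := l) (jz := jz) (gG hy q))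
      rw [dmul, hg q hq, mul_zero, add_zero, Derivation.map_one_eq_zero, mul_comm] at h
      exact b_mul_inj _ _ h
    · rw [gG_zero hy hq, neg_zero]
      exact Derivation.map_one_eq_zero _
  have hdD : ∀ p ≤ 2 * iot l 6, ∀ x, δ (dD p x) = dD p (δ x) := by
    intro p hp x
    by_cases hp0 : p = 0
    · rw [hp0, hD0]
    · have h := hD ⟨p, Finset.mem_Icc.2 ⟨by omega, hp⟩⟩ x
      rw [DD_app, DD_app, dmul, hg', zero_mul, zero_add, ← sub_eq_zero, ← mul_sub] at h
      exact sub_eq_zero.1 (b_mul_inj _ _ h)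
  have hμ : ∀ a : G, ∃ c : k, δ (b k (a, 0)) = c • b k (a, 0) := by
    intro a
    obtain ⟨c, hc⟩ := const_lem hy (b k (-a, 0) * δ (b k (a, 0))) (fun p hp => by
      rw [dmul, ← hdD p hp, dD_x, dD_x, Derivation.map_smul]
      have : (-a).1 p = - (a.1 p) := rfl
      rw [this]
      simp only [Algebra.smul_def, map_neg]; ring)
    refine ⟨c, ?_⟩
    rw [Algebra.smul_def, ← hc]
    linear_combination (-(δ (b k (a, 0)))) * g_neg_mul (k := k) (l := l) (jz := jz) a
  choose μ0 hμ0 using hμ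
  let μ : G →+ k := AddMonoidHom.mk' μ0 (by
    intro a a'
    have e : ((a + a', 0) : MM l G jz) = (a, 0) + (a', 0) := Prod.ext rfl (add_zero _).symm
    have h := hμ0 (a + a')
    rw [e, b_add, dmul, hμ0, hμ0, smul_mul_assoc, mul_smul_comm, ← add_smul, ← b_add] at h
    exact (smul_b_inj _ h).symm)
  have ht : ∀ q, ∃ c : k, tok l jz q → δ (b k (0, ee l jz q)) = algebraMap k _ c := by
    intro q
    by_cases hq : tok l jz q
    · obtain ⟨c, hc⟩ := const_lem hy (δ (b k (0, ee l jz q))) (fun p hp => by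
        rw [← hdD p hp, dD_t _ hq]
        split_ifs
        · exact Derivation.map_one_eq_zero _
        · exact map_zero _)
      exact ⟨c, fun _ => hc⟩
    · exact ⟨0, fun h => absurd h hq⟩
  choose c hc using ht
  refine ⟨c, μ, fun q hq => ?_, fun v => ?_⟩
  · have h := hμ0 (gG hy q)
    rw [hg q hq] at h
    exact (smul_b_inj ((gG hy q, 0) : MM l G jz) (by rw [zero_smul, h]; rfl)).symm
  · have := kill_all (δ - (∑ p ∈ mix l, c p • ptD p + dg (mu1 μ))) (fun a => ?_) (fun q hq => ?_) v
    · rw [Derivation.sub_apply, Derivation.add_apply, der_sum_smul] at this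
      exact sub_eq_zero.1 this
    · rw [Derivation.sub_apply, Derivation.add_apply, der_sum_smul, dg_b, hμ0]
      simp only [ptD_x, smul_zero, Finset.sum_const_zero, zero_add]
      exact sub_self _
    · rw [Derivation.sub_apply, Derivation.add_apply, der_sum_smul, dg_b, sum_ptD_t c hq]
      have e : mu1 μ ((0, ee l jz q) : MM l G jz) = 0 := map_zero μ
      rw [e, zero_smul, add_zero]
      split_ifs with hm
      · rw [hc q hq, sub_self]
      · rw [sub_zero]
        by_cases h0 : q = 0
        · subst h0
          exact hτ (hq.1 rfl)
        · have hp : q ∈ pur l := by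
            by_contra hp
            exact hm (mix_of hq hp h0)
          rw [← ym_pur hy hp]
          exact hδy ⟨q, Jmem q (Finset.mem_union_right _ hp)⟩

end Cases
end Conc

namespace Conc
noncomputable section Trans
open MonAlg

variable {k : Type*} [Field k] {l : ℕ → ℕ} {G : AddSubgroup (ℕ → k)} {jz : Bool}

/-- translation -/
def ph : CA k l G jz ≃ₗ[k] RR l G jz :=
  (AddMonoidAlgebra.coeffLinearEquiv (R := k) (S := k) (M := MM l G jz)).symm

theorem ph_single (m : ↥G × ↥(jIdx l jz)) :
    ph (Finsupp.single m 1 : CA k l G jz) = b k ((m.1, m.2) : MM l G jz) := rfl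

theorem ph_X (α : G) (i : Jsub l jz) : ph (X k l G jz α.1 i.1) = b k ((α, i) : MM l G jz) := by
  unfold X
  rw [dif_pos (show α.1 ∈ G ∧ i.1 ∈ jIdx l jz from ⟨α.2, i.2⟩)]
  rfl

theorem CA_ext {V : Type*} [AddCommGroup V] [Module k V] (f g : CA k l G jz →ₗ[k] V)
    (h : ∀ m, f (Finsupp.single m 1) = g (Finsupp.single m 1)) (x : CA k l G jz) : f x = g x := by
  have : f = g := Finsupp.lhom_ext' fun m => LinearMap.ext_ring (h m)
  rw [this]

/-- the monomial as a linear combination -/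
theorem sum_lc {V : Type*} [AddCommGroup V] [Module k V] (u : CA k l G jz)
    (c : ↥G × ↥(jIdx l jz) → k) (T : ↥G × ↥(jIdx l jz) → V) :
    (u.sum fun a ca => (ca * c a) • T a) = Finsupp.linearCombination k (fun a => c a • T a) u := by
  rw [Finsupp.linearCombination_apply]
  simp only [mul_smul]

theorem ph_pstar (p : ℕ) (u : CA k l G jz) : ph (pstar k l G jz p u) = dg (co p) (ph u) := by
  unfold pstar
  rw [sum_lc]
  refine CA_ext (ph.toLinearMap ∘ₗ Finsupp.linearCombination k _)
    ((dg (co p)).toLinearMap ∘ₗ ph.toLinearMap) (fun m => ?_) u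
  change ph (Finsupp.linearCombination k _ (Finsupp.single m 1)) = dg (co p) (b k (m.1, m.2))
  rw [Finsupp.linearCombination_single, one_smul, map_smul, dg_b]
  rfl

theorem ph_dmu (μ : G →+ k) (u : CA k l G jz) :
    ph (dmu k l G jz (⇑μ) u) = dg (mu1 μ) (ph u) := by
  unfold dmu
  rw [sum_lc u (fun a => μ a.1)]
  refine CA_ext (ph.toLinearMap ∘ₗ Finsupp.linearCombination k _)
    ((dg (mu1 μ)).toLinearMap ∘ₗ ph.toLinearMap) (fun m => ?_) u
  change ph (Finsupp.linearCombination k _ (Finsupp.single m 1)) = dg (mu1 μ) (b k (m.1, m.2))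
  rw [Finsupp.linearCombination_single, one_smul, map_smul, dg_b]
  rfl

theorem ph_pt (p : ℕ) (u : CA k l G jz) : ph (pt k l G jz p u) = ptD p (ph u) := by
  unfold pt
  rw [sum_lc u (fun a => (a.2.1 p : k))]
  refine CA_ext (ph.toLinearMap ∘ₗ Finsupp.linearCombination k _)
    ((ptD p).toLinearMap ∘ₗ ph.toLinearMap) (fun m => ?_) u
  change ph (Finsupp.linearCombination k _ (Finsupp.single m 1)) = ptD p (b k (m.1, m.2))
  rw [Finsupp.linearCombination_single, one_smul, map_smul, ptD_b]
  congr 1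
  exact ph_X m.1 (dec p m.2)

theorem ph_dd (p : ℕ) (u : CA k l G jz) : ph (dd k l G jz p u) = dD p (ph u) := by
  unfold dd dD
  rw [map_add, ph_pstar, ph_pt]; rfl

theorem ph_mul (u v : CA k l G jz) : ph (mulA k l G jz u v) = ph u * ph v := by
  unfold mulA
  have h1 : ∀ (a : ↥G × ↥(jIdx l jz)) (ca : k), (v.sum fun b cb =>
      (ca * cb) • X k l G jz (a.1.1 + b.1.1) (a.2.1 + b.2.1)) =
      ca • Finsupp.linearCombination k
        (fun b => X k l G jz (a.1.1 + b.1.1) (a.2.1 + b.2.1)) v := by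
    intro a ca
    rw [Finsupp.linearCombination_apply, Finsupp.smul_sum]
    simp only [mul_smul]
  simp only [h1]
  have h2 : (u.sum fun a ca => ca • Finsupp.linearCombination k
        (fun b : ↥G × ↥(jIdx l jz) => X k l G jz (a.1.1 + b.1.1) (a.2.1 + b.2.1)) v) =
      Finsupp.linearCombination k (fun a : ↥G × ↥(jIdx l jz) => Finsupp.linearCombination k
        (fun b : ↥G × ↥(jIdx l jz) => X k l G jz (a.1.1 + b.1.1) (a.2.1 + b.2.1)) v) u := by
    rw [Finsupp.linearCombination_apply]
  rw [h2]
  refine CA_ext (ph.toLinearMap ∘ₗ Finsupp.linearCombination k _)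
    (LinearMap.mulRight k (ph v) ∘ₗ ph.toLinearMap) (fun m => ?_) u
  change ph (Finsupp.linearCombination k _ (Finsupp.single m 1)) = b k ((m.1, m.2) : MM l G jz) * ph v
  rw [Finsupp.linearCombination_single, one_smul]
  refine CA_ext (ph.toLinearMap ∘ₗ Finsupp.linearCombination k _)
    (LinearMap.mulLeft k (b k ((m.1, m.2) : MM l G jz)) ∘ₗ ph.toLinearMap) (fun n => ?_) v
  change ph (Finsupp.linearCombination k _ (Finsupp.single n 1)) =
    b k ((m.1, m.2) : MM l G jz) * b k ((n.1, n.2) : MM l G jz)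
  rw [Finsupp.linearCombination_single, one_smul, ← b_add]
  let i : Jsub l jz := m.2
  let j : Jsub l jz := n.2
  exact ph_X (m.1 + n.1) (i + j)

theorem ph_Dop (u : CA k l G jz) : ph (Dop k l G jz u) = EE l G jz (ph u) := by
  unfold Dop EE
  rw [map_add, map_sum, map_sum]
  have h1 : ∀ p ∈ pur l, ph (mulA k l G jz (X k l G jz 0 (Pi.single p 1)) (pt k l G jz p u)) =
      dg (ci p) (ph u) := by
    intro p hp
    rw [ph_mul, ph_pt, dg_eq, ci_eq]
    congr 1
    rw [← ph_X, ee_val (pur_tok hp)]; rfl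
  change ∑ p ∈ grp l, _ + ∑ p ∈ pur l, _ = _
  rw [Finset.sum_congr rfl h1]
  simp only [ph_pstar]
  generalize ph u = x
  have h := lext_app (∑ p ∈ grp l, (dg (co p)).toLinearMap + ∑ p ∈ pur l, (dg (ci p)).toLinearMap)
    ((dg (wt l G jz)).toLinearMap) (fun m => by
      rw [LinearMap.add_apply, LinearMap.sum_apply, LinearMap.sum_apply]
      change ∑ p ∈ grp l, dg (co p) (b k m) + ∑ p ∈ pur l, dg (ci p) (b k m) = dg _ (b k m)
      simp only [dg_b, ← Finset.sum_smul, ← add_smul]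
      rw [wt_app]; rfl) x
  rw [LinearMap.add_apply, LinearMap.sum_apply, LinearMap.sum_apply] at h
  exact h

theorem sgm_eq (hy : Hyp l G jz) {p : ℕ} (hp : p ∈ iSet l 1 6) :
    sgm k l p = (-gG hy p + -gG hy (bar l p)).1 := by
  have hi := iot_facts l
  rw [mem_iSet] at hp
  simp only [Nat.reduceSub] at hp
  have hb : bar l p = p + iot l 6 := by unfold bar; rw [if_pos hp.2]
  unfold sgm
  simp only [if_pos hp.2]
  rw [hb]
  change _ = -(gG hy p).1 + -(gG hy (p + iot l 6)).1
  by_cases h1 : p ∈ iSet l 1 3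
  · rw [if_pos h1]
    rw [mem_iSet] at h1
    simp only [Nat.reduceSub] at h1
    rw [gG_val hy (by rw [mem_grp]; omega), gG_val hy (by rw [mem_grp]; omega), sub_eq_add_neg]
  · rw [if_neg h1]
    rw [mem_iSet] at h1
    simp only [Nat.reduceSub] at h1
    by_cases h2 : p ∈ iSet l 4 5
    · rw [if_pos h2]
      rw [mem_iSet] at h2
      simp only [Nat.reduceSub] at h2
      rw [gG_val hy (by rw [mem_grp]; omega), gG_zero hy (by rw [mem_grp]; omega)]
      simp
    · rw [if_neg h2]
      rw [mem_iSet] at h2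
      simp only [Nat.reduceSub] at h2
      rw [gG_zero hy (by rw [mem_grp]; omega), gG_zero hy (by rw [mem_grp]; omega)]
      simp

theorem iSet16 : iSet l 1 6 = Finset.Icc 1 (iot l 6) := by
  ext p
  rw [mem_iSet, Finset.mem_Icc]
  have := iot_facts l
  simp only [Nat.reduceSub]
  omega

theorem half_split {V : Type*} [AddCommMonoid V] (f : ℕ → V) :
    ∑ q ∈ Finset.Icc 1 (2 * iot l 6), f q = ∑ q ∈ iSet l 1 6, (f q + f (bar l q)) := by
  rw [iSet16, Finset.sum_add_distrib]
  have e : Finset.Icc 1 (2 * iot l 6) =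
      Finset.Icc 1 (iot l 6) ∪ (Finset.Icc 1 (iot l 6)).image (bar l) := by
    ext q
    rw [Finset.mem_union, Finset.mem_image, Finset.mem_Icc, Finset.mem_Icc]
    constructor
    · intro h
      by_cases hq : q ≤ iot l 6
      · exact Or.inl ⟨h.1, hq⟩
      · refine Or.inr ⟨q - iot l 6, Finset.mem_Icc.2 ⟨by omega, by omega⟩, ?_⟩
        unfold bar; rw [if_pos (by omega)]; omega
    · rintro (h | ⟨r, hr, rfl⟩)
      · omega
      · rw [Finset.mem_Icc] at hr
        unfold bar; rw [if_pos (by omega)]; omega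
  rw [e, Finset.sum_union, Finset.sum_image]
  · intro r hr s hs h
    have hr := Finset.mem_Icc.1 hr
    have hs := Finset.mem_Icc.1 hs
    unfold bar at h
    rw [if_pos (by omega), if_pos (by omega)] at h
    omega
  · rw [Finset.disjoint_left]
    intro q hq h
    obtain ⟨r, hr, rfl⟩ := Finset.mem_image.1 h
    rw [Finset.mem_Icc] at hr hq
    unfold bar at hq; rw [if_pos (by omega)] at hq; omega

theorem ph_brk [CharZero k] (hy : Hyp l G jz) (u v : CA k l G jz) :
    ph (brk k l G jz u v) = (CC hy).br (ph u) (ph v) := by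
  unfold brk CData.br CData.P CData.L
  rw [map_sub, map_add, ph_mul, ph_mul, map_sub, map_sub, ph_Dop, ph_Dop, ph_dd, ph_dd, map_sum,
    map_smul, map_smul]
  have e2 : ∀ x : RR l G jz, (2 : k) • x = 2 * x := fun x => by
    rw [Algebra.smul_def, map_ofNat]
  rw [e2, e2]
  have h1 : ∑ q : JJ l, (((CC hy).ε q : ℤ) : RR l G jz) *
        ((CC hy).D q (ph u) * (CC hy).D ((CC hy).bar q) (ph v)) =
      ∑ q ∈ Finset.Icc 1 (2 * iot l 6), (((if q ≤ iot l 6 then 1 else -1 : ℤ)) : RR l G jz) *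
        (DD hy q (ph u) * DD hy (bar l q) (ph v)) :=
    Finset.sum_coe_sort (Finset.Icc 1 (2 * iot l 6))
      (fun q => (((if q ≤ iot l 6 then 1 else -1 : ℤ)) : RR l G jz) *
        (DD hy q (ph u) * DD hy (bar l q) (ph v)))
  rw [h1, half_split]
  have h2 : ∀ p ∈ iSet l 1 6, ph (mulA k l G jz (X k l G jz (sgm k l p) 0)
        (mulA k l G jz (dd k l G jz p u) (dd k l G jz (bar l p) v) -
          mulA k l G jz (dd k l G jz (bar l p) u) (dd k l G jz p v))) =
      (((if p ≤ iot l 6 then 1 else -1 : ℤ)) : RR l G jz) *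
        (DD hy p (ph u) * DD hy (bar l p) (ph v)) +
      (((if bar l p ≤ iot l 6 then 1 else -1 : ℤ)) : RR l G jz) *
        (DD hy (bar l p) (ph u) * DD hy (bar l (bar l p)) (ph v)) := by
    intro p hp
    have hx : ph (X k l G jz (sgm k l p) 0) =
        b k ((-gG hy p, 0) : MM l G jz) * b k ((-gG hy (bar l p), 0) : MM l G jz) := by
      rw [sgm_eq hy hp, ← b_add]
      exact ph_X (-gG hy p + -gG hy (bar l p)) 0
    have hp' := hp
    rw [iSet16, Finset.mem_Icc] at hp'
    have hb : bar l p = p + iot l 6 := by unfold bar; rw [if_pos hp'.2]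
    rw [bar_bar' (Finset.mem_Icc.2 ⟨hp'.1, by omega⟩), ph_mul, hx, map_sub, ph_mul, ph_mul,
      ph_dd, ph_dd, ph_dd, ph_dd, if_pos hp'.2, if_neg (by omega)]
    simp only [DD_app]
    push_cast
    ring
  rw [Finset.sum_congr rfl h2]
  rfl

end Trans
end Conc

namespace Conc
noncomputable section Exist
open MonAlg

variable {k : Type*} [Field k] {l : ℕ → ℕ} {G : AddSubgroup (ℕ → k)} {jz : Bool}

theorem ptD_ntok {p : ℕ} (h : ¬ tok l jz p) (v : RR l G jz) : ptD p v = 0 := by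
  refine lext_app (ptD p).toLinearMap 0 (fun m => ?_) v
  change ptD p (b k m) = 0
  rw [ptD_b, mem_Jsub.1 m.2.2 p h]; simp

theorem ptD_grp {q : ℕ} (h : q ∈ grp l) (v : RR l G jz) :
    ptD q v = ∑ r ∈ mix l, (if r = q then (1 : k) else 0) • ptD r v := by
  simp only [ite_smul, one_smul, zero_smul]
  rw [Finset.sum_ite_eq']
  split_ifs with hq
  · rfl
  · refine ptD_ntok (fun ht => hq (mix_of ht (grp_pur h) (grp_pos h))) v

theorem mem13 {p : ℕ} (h : p ∈ iSet l 1 3) : p ∈ grp l ∧ bar l p ∈ grp l ∧ p ≤ iot l 6 ∧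
    p ∈ Finset.Icc 1 (2 * iot l 6) := by
  have := iot_facts l
  rw [mem_iSet] at h
  simp only [Nat.reduceSub] at h
  have hb : bar l p = p + iot l 6 := by unfold bar; rw [if_pos (by omega)]
  rw [hb, mem_grp, mem_grp, Finset.mem_Icc]
  omega

variable [CharZero k]

theorem br_yy (hy : Hyp l G jz) (q : JJ l) (v : RR l G jz) :
    (CC hy).br ((CC hy).y q * (CC hy).y ((CC hy).bar q)) v =
      (CC hy).ε q * ((CC hy).y ((CC hy).bar q) * (CC hy).D ((CC hy).bar q) v -
        (CC hy).y q * (CC hy).D q v) := by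
  unfold CData.br CData.L
  rw [CData.P_mul_left, CData.P_y, CData.P_y, (CC hy).bar_bar, (CC hy).ε_bar]
  rw [dmul, dmul, (CC hy).E_y, (CC hy).E_y, (CC hy).D0_y, (CC hy).D0_y]
  push_cast
  ring

theorem yD (hy : Hyp l G jz) {q : ℕ} (hq : q ∈ grp l) (v : RR l G jz) :
    b k (ym hy q) * DD hy q v = dD q v := by
  rw [DD_app, ym_grp hy hq, ← mul_assoc, mul_comm (b k _), g_neg_mul, one_mul]

theorem mu1_muP (p : ℕ) (v : RR l G jz) :
    dg (mu1 (muP k l G p)) v = dg (co (bar l p)) v - dg (co p) v := by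
  refine lext_app (dg (mu1 (muP k l G p))).toLinearMap
    ((dg (co (bar l p))).toLinearMap - (dg (co p)).toLinearMap) (fun m => ?_) v
  change dg (mu1 (muP k l G p)) (b k m) = dg (co (bar l p)) (b k m) - dg (co p) (b k m)
  rw [dg_b, dg_b, dg_b, ← sub_smul]; rfl

theorem dg_add (μ ν : G →+ k) (v : RR l G jz) :
    dg (mu1 (μ + ν)) v = dg (mu1 μ) v + dg (mu1 ν) v := by
  refine lext_app (dg (mu1 (μ + ν))).toLinearMap
    ((dg (mu1 μ)).toLinearMap + (dg (mu1 ν)).toLinearMap) (fun m => ?_) v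
  change dg (mu1 (μ + ν)) (b k m) = dg (mu1 μ) (b k m) + dg (mu1 ν) (b k m)
  rw [dg_b, dg_b, dg_b, ← add_smul]; rfl

theorem dg_smul (a : k) (ν : G →+ k) (v : RR l G jz) :
    dg (mu1 (a • ν)) v = a • dg (mu1 ν) v := by
  refine lext_app (dg (mu1 (a • ν))).toLinearMap
    (a • (dg (mu1 ν)).toLinearMap) (fun m => ?_) v
  change dg (mu1 (a • ν)) (b k m) = a • dg (mu1 ν) (b k m)
  rw [dg_b, dg_b, smul_smul]; rfl

theorem dg_zero (v : RR l G jz) : dg (mu1 (0 : G →+ k)) v = 0 := by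
  have := dg_smul (0 : k) (0 : G →+ k) v
  rwa [zero_smul, zero_smul] at this

theorem span_ad (hy : Hyp l G jz) {ν : G →+ k} (h : ν ∈ spanMu k l G jz) :
    ∃ (c : ℕ → k) (u : RR l G jz), ∀ v,
      dg (mu1 ν) v = ∑ p ∈ mix l, c p • ptD p v + (CC hy).br u v := by
  unfold spanMu at h
  induction h using Submodule.span_induction with
  | mem x hx =>
    rcases hx with rfl | ⟨p, hp, rfl⟩
    · unfold muZero
      rcases (by cases jz <;> simp : jz = false ∨ jz = true) with hj | hj
      · subst hj
        refine ⟨0, (2 : k)⁻¹ • 1, fun v => ?_⟩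
        rw [CData.br_smul_left, CData.br_one]
        change dg (co 0) v = _ + (2 : k)⁻¹ • (2 * dD 0 v)
        rw [D0_diag rfl, dg_eq]
        have e2 : (2 : RR l G false) * diag (co 0) v = (2 : k) • diag (co 0) v := by
          rw [Algebra.smul_def, map_ofNat]
        rw [e2, smul_smul, inv_mul_cancel₀ two_ne_zero, one_smul]
        simp
      · refine ⟨0, 0, fun v => ?_⟩
        subst hj
        rw [CData.zero_br]
        have := dg_zero (l := l) (jz := true) v
        simpa using this
    · obtain ⟨h1, h2, h3, h4⟩ := mem13 hp
      refine ⟨fun r => (if r = p then 1 else 0) - (if r = bar l p then 1 else 0),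
        (CC hy).y ⟨p, h4⟩ * (CC hy).y ((CC hy).bar ⟨p, h4⟩), fun v => ?_⟩
      rw [br_yy, mu1_muP]
      simp only [sub_smul, Finset.sum_sub_distrib]
      rw [← ptD_grp h1, ← ptD_grp h2]
      change _ = ptD p v - ptD (bar l p) v + ((if p ≤ iot l 6 then 1 else -1 : ℤ) : RR l G jz) *
        (b k (ym hy (bar l p)) * DD hy (bar l p) v - b k (ym hy p) * DD hy p v)
      rw [yD hy h1, yD hy h2, if_pos h3]
      unfold dD
      rw [Derivation.add_apply, Derivation.add_apply]
      push_cast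
      ring
  | zero =>
    refine ⟨0, 0, fun v => ?_⟩
    rw [CData.zero_br, dg_zero]; simp
  | add x y _ _ hx hy' =>
    obtain ⟨c, u, h⟩ := hx
    obtain ⟨c', u', h'⟩ := hy'
    refine ⟨c + c', u + u', fun v => ?_⟩
    rw [CData.br_add_left, dg_add, h, h']
    simp only [Pi.add_apply, add_smul, Finset.sum_add_distrib]
    ring
  | smul a x _ hx =>
    obtain ⟨c, u, h⟩ := hx
    refine ⟨a • c, a • u, fun v => ?_⟩
    rw [CData.br_smul_left, dg_smul, h, smul_add, Finset.smul_sum]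
    simp only [Pi.smul_apply, smul_eq_mul, mul_smul]

theorem exist_core (hy : Hyp l G jz) {d : RR l G jz →ₗ[k] RR l G jz} (hd : (CC hy).IsDer d) :
    ∃ (c : ℕ → k) (μ : G →+ k) (u : RR l G jz), (∀ q ∈ grp l, μ (gG hy q) = 0) ∧
      ∀ v, d v = ∑ p ∈ mix l, c p • ptD p v + dg (mu1 μ) v + (CC hy).br u v := by
  have hpos := hy.pos
  have q0 : JJ l := ⟨1, Finset.mem_Icc.2 ⟨le_rfl, by omega⟩⟩
  have key : ∃ (u : RR l G jz) (δ : Derivation k (RR l G jz) (RR l G jz)),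
      (∀ v, d v = δ v + (CC hy).br u v) ∧
      (∀ (q : JJ l) a, δ (DD hy q a) = DD hy q (δ a)) ∧ (∀ a, δ (dD 0 a) = dD 0 (δ a)) ∧
      (∀ q : JJ l, δ (b k (ym hy q)) = 0) ∧ (jz = true → δ (b k (0, ee l jz 0)) = 0) := by
    rcases (by cases jz <;> simp : jz = false ∨ jz = true) with hj | hj
    · subst hj
      obtain ⟨u, δ, h1, h2, h3, h4⟩ := CData.G_main (gcase hy rfl) q0 hd
      exact ⟨u, δ, h1, h2, h3, h4, fun h => by simp at h⟩
    · subst hj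
      obtain ⟨u, δ, h1, h2, h3, h4, h5⟩ := CData.N_main (ncase hy rfl) q0 hd
      exact ⟨u, δ, h1, h2, h3, h4, fun _ => h5⟩
  obtain ⟨u, δ, h1, h2, h3, h4, h5⟩ := key
  obtain ⟨c, μ, hμ, h⟩ := classify hy δ h2 h3 h4 h5
  exact ⟨c, μ, u, hμ, fun v => by rw [h1, h]⟩

theorem mem_homPrime (hy : Hyp l G jz) {μ : G →+ k} (h : ∀ q ∈ grp l, μ (gG hy q) = 0) :
    μ ∈ homPrime k l G := by
  have h' : ∀ q, μ (gG hy q) = 0 := fun q => by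
    by_cases hq : q ∈ grp l
    · exact h q hq
    · rw [gG_zero hy hq, map_zero]
  intro p hp hs
  have hi := iot_facts l
  have hp6 : p ∈ iSet l 1 6 := by
    rw [mem_iSet] at *
    simp only [Nat.reduceSub] at *
    omega
  have e : (⟨sgm k l p, hs⟩ : G) = -gG hy p + -gG hy (bar l p) := Subtype.ext (sgm_eq hy hp6)
  rw [e, map_add, map_neg, map_neg, h', h']; simp

end Exist

noncomputable section Uniq
open MonAlg

variable {k : Type*} [Field k] {l : ℕ → ℕ} {G : AddSubgroup (ℕ → k)} {jz : Bool}

variable [CharZero k]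

theorem mu_ym (hy : Hyp l G jz) (μ : G →+ k) (q : ℕ) : mu1 μ (ym hy q) = μ (gG hy q) := by
  by_cases hq : q ∈ grp l
  · rw [ym_grp hy hq]; rfl
  · rw [gG_zero hy hq]; unfold ym; rw [if_neg hq]; rfl

theorem pt_ym (hy : Hyp l G jz) (c : ℕ → k) (q : JJ l) :
    ∑ p ∈ mix l, c p • ptD p (b k (ym hy q)) = 0 := by
  rcases JJ_cases q with ⟨h1, h2⟩ | ⟨h1, h2⟩
  · rw [ym_grp hy h1]
    simp only [ptD_x, smul_zero, Finset.sum_const_zero]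
  · rw [ym_pur hy h2, sum_ptD_t c (pur_tok h2), if_neg]
    exact fun h => h1 (mix_grp h)

theorem algm_inj {a a' : k} (h : algebraMap k (RR l G jz) a = algebraMap k _ a') : a = a' := by
  rw [alg_eq, alg_eq] at h
  exact smul_b_inj _ h

set_option maxHeartbeats 1600000 in
theorem uniq_core (hy : Hyp l G jz) (c : ℕ → k) (μ : G →+ k) (u : RR l G jz)
    (h : ∀ v, ∑ p ∈ mix l, c p • ptD p v + dg (mu1 μ) v + (CC hy).br u v = 0) :
    μ ∈ spanMu k l G jz ∧ (μ = 0 → u = 0 ∧ ∀ p ∈ mix l, c p = 0) := by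
  have hpos := hy.pos
  have hi := iot_facts l
  have d0 : (CC hy).D0 u = 0 := by
    have h1 := h 1
    simp only [Derivation.map_one_eq_zero, smul_zero, Finset.sum_const_zero, zero_add] at h1
    rw [CData.br_anti, CData.br_one, neg_eq_zero] at h1
    exact CData.cz (K := k) 2 two_ne_zero _ (by exact_mod_cast h1)
  have h' : ∀ v, ∑ p ∈ mix l, c p • ptD p v + dg (mu1 μ) v + ((CC hy).P u v +
      (CC hy).L u * (CC hy).D0 v) = 0 := by
    intro v
    have := h v
    unfold CData.br at this
    rw [d0, zero_mul, sub_zero] at this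
    exact this
  let m : ℕ → k := fun q => μ (gG hy q)
  have hD : ∀ q : JJ l, ((CC hy).ε q : RR l G jz) * (CC hy).D ((CC hy).bar q) u =
      m q • (CC hy).y q := by
    intro q
    have h1 := h' ((CC hy).y q)
    rw [CData.P_y', (CC hy).D0_y, mul_zero, add_zero] at h1
    have e : (CC hy).y q = b k (ym hy q) := rfl
    rw [e, pt_ym, zero_add, dg_b, mu_ym] at h1
    rw [e]
    linear_combination -h1
  have hD' : ∀ q : JJ l, (CC hy).D ((CC hy).bar q) u =
      ((CC hy).ε q : RR l G jz) * (m q • (CC hy).y q) := by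
    intro q
    rw [← hD, ← mul_assoc, CData.ε_sqA, one_mul]
  have hD2 : ∀ q : JJ l, (CC hy).D q u =
      - (((CC hy).ε q : RR l G jz) * (m (bar l q) • (CC hy).y ((CC hy).bar q))) := by
    intro q
    have := hD' ((CC hy).bar q)
    rw [(CC hy).bar_bar, (CC hy).ε_bar] at this
    rw [this]
    push_cast
    exact neg_mul _ _
  have hm : ∀ q : JJ l, m (bar l q) = - m q := by
    intro q
    have e1 := congrArg ((CC hy).D q) (hD' q)
    have e2 := congrArg ((CC hy).D ((CC hy).bar q)) (hD2 q)
    rw [(CC hy).D_comm, hD2 q] at e1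
    simp only [map_neg, CData.lin_int', Derivation.map_smul, (CC hy).D_y, if_true] at e1
    have e3 := congrArg (fun x => ((CC hy).ε q : RR l G jz) * x) e1
    simp only [mul_neg, ← mul_assoc, CData.ε_sqA, one_mul] at e3
    refine algm_inj (l := l) (G := G) (jz := jz) ?_
    rw [map_neg, Algebra.algebraMap_eq_smul_one, Algebra.algebraMap_eq_smul_one, ← e3, neg_neg]
  have hk : ∃ k0 : k, (CC hy).L u = algebraMap k _ k0 ∧ (jz = true → k0 = 0) ∧
      (μ = 0 → k0 = 0) := by
    rcases (by cases jz <;> simp : jz = false ∨ jz = true) with hj | hj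
    · subst hj
      have hG := gcase hy rfl
      have h1 := h' (b k (e0 hy rfl, 0))
      have h2 : (CC hy).P u (b k (e0 hy rfl, 0)) = 0 := by
        unfold CData.P; simp [hG.De]
      rw [h2, hG.D0e, dg_b] at h1
      simp only [ptD_x, smul_zero, Finset.sum_const_zero, zero_add] at h1
      refine ⟨-μ (e0 hy rfl), ?_, fun h => by simp at h, fun h => by rw [h]; simp⟩
      have h3 : b k (e0 hy rfl, 0) * ((CC hy).L u - algebraMap k _ (-μ (e0 hy rfl))) = 0 := by
        rw [map_neg]
        rw [Algebra.smul_def] at h1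
        change algebraMap k _ (μ (e0 hy rfl)) * _ + _ = _ at h1
        linear_combination h1
      exact sub_eq_zero.1 (b_mul_inj _ _ h3)
    · subst hj
      have hN := ncase hy rfl
      have h1 := h' (b k (0, ee l true 0))
      have h2 : (CC hy).P u (b k (0, ee l true 0)) = 0 := by
        unfold CData.P; simp [hN.Dτ]
      rw [h2, hN.D0τ, dg_b, sum_ptD_t c (tok_zero rfl),
        if_neg (fun h => grp_pos (mix_grp h) rfl)] at h1
      have h3 : mu1 μ ((0, ee l true 0) : MM l G true) = 0 := map_zero μ
      rw [h3] at h1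
      refine ⟨0, ?_, fun _ => rfl, fun _ => rfl⟩
      rw [map_zero]
      simpa using h1
  obtain ⟨k0, hk, hk1, hk2⟩ := hk
  have hα : ∀ α : G, μ α = ∑ q ∈ Finset.Icc 1 (2 * iot l 6), m q * α.1 q - k0 * α.1 0 := by
    intro α
    have h1 := h' (b k (α, 0))
    have hP : (CC hy).P u (b k (α, 0)) =
        - (∑ q ∈ Finset.Icc 1 (2 * iot l 6), m q * α.1 q) • b k (α, 0) := by
      rw [CData.P_anti]
      unfold CData.P
      rw [neg_smul, neg_inj, Finset.sum_smul]
      rw [← Finset.sum_coe_sort (Finset.Icc 1 (2 * iot l 6))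
        (fun q => (m q * α.1 q) • b k ((α, 0) : MM l G jz))]
      refine Finset.sum_congr (M := RR l G jz) rfl fun q _ => ?_
      rw [hD']
      have e : ((CC hy).ε q : RR l G jz) * ((CC hy).D q (b k (α, 0)) *
          (((CC hy).ε q : RR l G jz) * (m q • (CC hy).y q))) =
          (((CC hy).ε q : RR l G jz) * ((CC hy).ε q : RR l G jz)) *
          (m q • ((CC hy).y q * (CC hy).D q (b k (α, 0)))) := by
        simp only [Algebra.smul_def]; ring
      rw [e, CData.ε_sqA, one_mul, mul_smul]
      by_cases hq : q.1 ∈ grp l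
      · congr 1
        change b k (ym hy q) * DD hy q _ = _
        rw [yD hy hq, dD_x]
      · have : m q = 0 := by
          change μ (gG hy q) = 0
          rw [gG_zero hy hq, map_zero]
        rw [this, zero_smul, zero_smul]
    rw [hP, hk, dg_b] at h1
    simp only [ptD_x, smul_zero, Finset.sum_const_zero, zero_add] at h1
    change μ α • _ + (_ + algebraMap k _ k0 * dD 0 _) = 0 at h1
    rw [dD_x, ← Algebra.smul_def, smul_smul, ← add_smul, ← add_smul] at h1
    have h2 := smul_b_inj (c' := 0) _ (h1.trans (zero_smul _ _).symm)
    linear_combination h2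
  refine ⟨?_, fun hμ => ?_⟩
  · have e : μ = ∑ p ∈ iSet l 1 3, (-m p) • muP k l G p + (-k0) • muZero k G jz := by
      ext α
      rw [hα, AddMonoidHom.add_apply, AddMonoidHom.finsetSum_apply, half_split]
      have e1 : ∑ p ∈ iSet l 1 6, (m p * α.1 p + m (bar l p) * α.1 (bar l p)) =
          ∑ p ∈ iSet l 1 3, ((-m p) • muP k l G p) α := by
        symm
        refine Finset.sum_subset_zero_on_sdiff ?_ ?_ ?_
        · intro p hp
          rw [mem_iSet] at *
          simp only [Nat.reduceSub] at *
          omega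
        · intro p hp
          rw [Finset.mem_sdiff, iSet16, Finset.mem_Icc, mem_iSet] at hp
          simp only [Nat.reduceSub] at hp
          have hb : bar l p = p + iot l 6 := by unfold bar; rw [if_pos (by omega)]
          have hp0 := hm ⟨p, Finset.mem_Icc.2 ⟨by omega, by omega⟩⟩
          have hz : m (bar l p) = 0 := by
            change μ (gG hy _) = 0
            rw [gG_zero hy (by rw [hb, mem_grp]; omega), map_zero]
          have hz' : m p = 0 := by
            change m (bar l p) = - m p at hp0
            rw [hz] at hp0
            exact neg_eq_zero.1 hp0.symm
          rw [hz, hz']; ring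
        · intro p hp
          have hp0 := hm ⟨p, (mem13 hp).2.2.2⟩
          change m (bar l p) = - m p at hp0
          rw [hp0]
          change -m p * (α.1 (bar l p) - α.1 p) = _
          ring
      rw [e1]
      have e2 : ((-k0) • muZero k G jz) α = - (k0 * α.1 0) := by
        unfold muZero
        cases hj : jz
        · change -k0 * α.1 0 = _
          ring
        · rw [hk1 hj]; simp
      rw [e2]; ring
    rw [e]
    unfold spanMu
    refine Submodule.add_mem _ (Submodule.sum_mem _ fun p hp => Submodule.smul_mem _ _
      (Submodule.subset_span (Set.mem_insert_of_mem _ ⟨p, hp, rfl⟩)))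
      (Submodule.smul_mem _ _ (Submodule.subset_span (Set.mem_insert _ _)))
  · have hm0 : ∀ q, m q = 0 := fun q => by
      change μ (gG hy q) = 0
      rw [hμ]; rfl
    have hu : u = 0 := by
      obtain ⟨a, ha⟩ := (CC hy).const u d0 (fun q => by
        rw [hD2, hm0, zero_smul, mul_zero, neg_zero])
      rw [hk2 hμ, map_zero] at hk
      unfold CData.L at hk
      rw [ha, Derivation.map_algebraMap, sub_zero] at hk
      rw [ha]
      exact CData.cz (K := k) 2 two_ne_zero _ (by exact_mod_cast hk)
    refine ⟨hu, fun p hp => ?_⟩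
    have h1 := h (b k (0, ee l jz p))
    rw [hu, hμ, CData.zero_br, dg_zero, sum_ptD_t c (mix_tok hp), if_pos hp, add_zero, add_zero,
      ← map_zero (algebraMap k (RR l G jz))] at h1
    exact algm_inj h1

end Uniq
end Conc

/-- **Theorem 3.1.** Every derivation `d` of `𝒦` can be written uniquely as
`d = Σ_{p∈Ī₂∪J₃∪I₅} c_p ∂_{t_p} + d_μ + ad u` with `c_p ∈ F`, `μ ∈ Hom*_ℤ(Γ,F)`, `u ∈ 𝒦`;
i.e. `Der 𝒦 = (⊕_p F∂_{t_p}) ⊕ Hom*_ℤ(Γ,F) ⊕ ad 𝒦` as a direct sum of subspaces. -/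
theorem der_contact_decomposition
    {F : Type*} [Field F] [CharZero F] (ℓ : ℕ → ℕ) (Γ : AddSubgroup (ℕ → F)) (j0 : Bool)
    (hℓ : 0 < iot ℓ 6)
    (hΓ1 : ∀ p ∈ jSet ℓ 1 3 ∪ iSet ℓ 4 5, (Pi.single p (1 : F) : ℕ → F) ∈ Γ)
    (hΓ2 : ∀ α ∈ Γ, ∀ p ∈ iSet ℓ 6 6 ∪ barSet ℓ (iSet ℓ 4 6), α p = 0)
    (hΓ3 : ∀ α ∈ Γ, ∀ p, 2 * iot ℓ 6 < p → α p = 0)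
    (hΓ0 : (∃ α ∈ Γ, α 0 ≠ 0) → (Pi.single 0 (1 : F) : ℕ → F) ∈ Γ)
    (hJ0 : j0 = false → ∃ α ∈ Γ, α 0 ≠ 0)
    -- `Hom*_ℤ(Γ,F)`: a fixed complement of `span{μ_p : p ∈ {0}∪I_{1,3}}` in `Hom'_ℤ(Γ,F)`
    (H : Submodule F (↥Γ →+ F)) (hH0 : H ≤ homPrime F ℓ Γ)
    (hH1 : H ⊔ spanMu F ℓ Γ j0 = homPrime F ℓ Γ)
    (hH2 : H ⊓ spanMu F ℓ Γ j0 = ⊥)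
    -- a derivation `d` of `𝒦`
    (d : CA F ℓ Γ j0 →ₗ[F] CA F ℓ Γ j0)
    (hd : ∀ u v : CA F ℓ Γ j0,
      d (brk F ℓ Γ j0 u v) = brk F ℓ Γ j0 (d u) v + brk F ℓ Γ j0 u (d v)) :
    -- existence of the decomposition
    (∃ (c : ℕ → F) (μ : ↥Γ →+ F) (u : CA F ℓ Γ j0), μ ∈ H ∧
      ∀ v : CA F ℓ Γ j0,
        d v = (∑ p ∈ barSet ℓ (iSet ℓ 2 2) ∪ jSet ℓ 3 3 ∪ iSet ℓ 5 5, c p • pt F ℓ Γ j0 p v) +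
          dmu F ℓ Γ j0 (⇑μ) v + brk F ℓ Γ j0 u v) ∧
    -- uniqueness of the decomposition
    (∀ (c₁ c₂ : ℕ → F) (μ₁ μ₂ : ↥Γ →+ F) (u₁ u₂ : CA F ℓ Γ j0), μ₁ ∈ H → μ₂ ∈ H →
      (∀ v : CA F ℓ Γ j0,
        (∑ p ∈ barSet ℓ (iSet ℓ 2 2) ∪ jSet ℓ 3 3 ∪ iSet ℓ 5 5, c₁ p • pt F ℓ Γ j0 p v) +
          dmu F ℓ Γ j0 (⇑μ₁) v + brk F ℓ Γ j0 u₁ v =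
        (∑ p ∈ barSet ℓ (iSet ℓ 2 2) ∪ jSet ℓ 3 3 ∪ iSet ℓ 5 5, c₂ p • pt F ℓ Γ j0 p v) +
          dmu F ℓ Γ j0 (⇑μ₂) v + brk F ℓ Γ j0 u₂ v) →
      (∀ p ∈ barSet ℓ (iSet ℓ 2 2) ∪ jSet ℓ 3 3 ∪ iSet ℓ 5 5, c₁ p = c₂ p) ∧
        μ₁ = μ₂ ∧ u₁ = u₂) := by
  have hy : Conc.Hyp ℓ Γ j0 := ⟨hℓ, hΓ1, hΓ2, hΓ3, hΓ0, hJ0⟩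
  have hmix : barSet ℓ (iSet ℓ 2 2) ∪ jSet ℓ 3 3 ∪ iSet ℓ 5 5 = Conc.mix ℓ := rfl
  rw [hmix]
  constructor
  · let d' : Conc.RR ℓ Γ j0 →ₗ[F] Conc.RR ℓ Γ j0 :=
      Conc.ph.toLinearMap ∘ₗ d ∘ₗ Conc.ph.symm.toLinearMap
    have hd' : (Conc.CC hy).IsDer d' := by
      intro u v
      obtain ⟨u, rfl⟩ := Conc.ph.surjective u
      obtain ⟨v, rfl⟩ := Conc.ph.surjective v
      change Conc.ph (d (Conc.ph.symm _)) = (Conc.CC hy).br (Conc.ph (d (Conc.ph.symm _))) _ +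
        (Conc.CC hy).br _ (Conc.ph (d (Conc.ph.symm _)))
      rw [← Conc.ph_brk, LinearEquiv.symm_apply_apply, LinearEquiv.symm_apply_apply,
        LinearEquiv.symm_apply_apply, hd, map_add, Conc.ph_brk hy, Conc.ph_brk hy]
    obtain ⟨c, μ, u, hμ, h⟩ := Conc.exist_core hy hd'
    have hμ' := Conc.mem_homPrime hy hμ
    rw [← hH1] at hμ'
    obtain ⟨μ1, h1, ν, h2, rfl⟩ := Submodule.mem_sup.1 hμ'
    obtain ⟨c', u', h'⟩ := Conc.span_ad hy h2
    refine ⟨c + c', μ1, Conc.ph.symm (u + u'), h1, fun v => ?_⟩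
    apply Conc.ph.injective
    rw [map_add, map_add, Conc.ph_brk hy, Conc.ph_dmu, map_sum, LinearEquiv.apply_symm_apply,
      CData.br_add_left]
    have hv := h (Conc.ph v)
    change Conc.ph (d (Conc.ph.symm _)) = _ at hv
    rw [LinearEquiv.symm_apply_apply, Conc.dg_add, h'] at hv
    rw [hv]
    simp only [map_add, map_smul, Conc.ph_pt, Pi.add_apply, add_smul, Finset.sum_add_distrib]
    abel
  · intro c₁ c₂ μ₁ μ₂ u₁ u₂ hm1 hm2 h
    have key := Conc.uniq_core hy (c₁ - c₂) (μ₁ - μ₂) (Conc.ph u₁ - Conc.ph u₂) (fun w => by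
      obtain ⟨v, rfl⟩ := Conc.ph.surjective w
      have hv := congrArg Conc.ph (h v)
      rw [map_add, map_add, map_add, map_add, Conc.ph_brk hy, Conc.ph_brk hy, Conc.ph_dmu,
        Conc.ph_dmu, map_sum, map_sum] at hv
      simp only [map_smul, Conc.ph_pt] at hv
      have hs := Conc.dg_add (l := ℓ) (jz := j0) (μ₁ - μ₂) μ₂ (Conc.ph v)
      rw [sub_add_cancel] at hs
      rw [CData.br_sub_left]
      simp only [Pi.sub_apply, sub_smul, Finset.sum_sub_distrib]
      linear_combination hv - hs)
    have hz : μ₁ - μ₂ = 0 := by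
      have : μ₁ - μ₂ ∈ H ⊓ spanMu F ℓ Γ j0 := ⟨H.sub_mem hm1 hm2, key.1⟩
      rw [hH2] at this
      exact (Submodule.mem_bot F).1 this
    obtain ⟨k1, k2⟩ := key.2 hz
    exact ⟨fun p hp => sub_eq_zero.1 (k2 p hp), sub_eq_zero.1 hz,
      Conc.ph.injective (sub_eq_zero.1 k1)⟩

end
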